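/- Let f(z) = Σ_{n≥0} (a_n/n!) z^n be an E-function whose Taylor coefficients a_n all lie in a number field 𝕂 (a finite field extension of ℚ contained in ℚ̄). Then for every algebraic number α, either f(α) is transcendental or f(α) lies in the field 𝕂(α) generated by α over 𝕂. -/

import Mathlib

noncomputable section

/-- `ℚ̄`: the field of algebraic numbers, i.e. the algebraic closure of `ℚ` inside `ℂ`. -/
def Qbar : IntermediateField ℚ ℂ := algebraicClosure ℚ ℂ

/-- `f : ℂ → ℂ` is the E-function with Taylor coefficients `aₙ/n!` (the `aₙ` being
algebraic numbers): `f(z) = ∑ aₙ/n! zⁿ`; the conjugates of the `aₙ` grow at most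
geometrically; the `aₙ` admit denominators growing at most geometrically; and `f`
satisfies a nonzero linear differential equation with coefficients in `ℚ̄(z)`
(equivalently, after clearing denominators, with polynomial coefficients all of
whose coefficients are algebraic). -/
def IsEFunctionWith (a : ℕ → Qbar) (f : ℂ → ℂ) : Prop :=
  (∀ z : ℂ, HasSum (fun n : ℕ => (a n : ℂ) / n.factorial * z ^ n) (f z)) ∧
  (∃ C : ℝ, 0 < C ∧ ∀ σ : Qbar →+* ℂ, ∀ n : ℕ, ‖σ (a n)‖ ≤ C ^ (n + 1)) ∧
  (∃ D : ℝ, 0 < D ∧ ∃ d : ℕ → ℕ, (∀ n : ℕ, d n ≠ 0 ∧ (d n : ℝ) ≤ D ^ (n + 1)) ∧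
    ∀ n : ℕ, ∀ m ≤ n, IsIntegral ℤ ((d n : ℂ) * (a m : ℂ))) ∧
  (∃ r : ℕ, ∃ p : Fin (r + 1) → Polynomial ℂ,
    (∀ j, ∀ i, IsAlgebraic ℚ ((p j).coeff i)) ∧ (∃ j, p j ≠ 0) ∧
    ∀ z : ℂ, ∑ j : Fin (r + 1), (p j).eval z * iteratedDeriv (j : ℕ) f z = 0)

/-- `f : ℂ → ℂ` is an E-function. -/
def IsEFunction (f : ℂ → ℂ) : Prop := ∃ a : ℕ → Qbar, IsEFunctionWith a f

namespace EFun

open PowerSeries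

abbrev Pol := Polynomial ℚ

/-- The derivation `d/dX` of `ℚ⟦X⟧`. -/
abbrev D : Derivation ℚ ℚ⟦X⟧ ℚ⟦X⟧ := d⁄dX ℚ

lemma D_smul (p : Pol) (f : ℚ⟦X⟧) : D (p • f) = p • D f + Polynomial.derivative p • f := by
  simp only [Algebra.smul_def]
  change D ((p : ℚ⟦X⟧) * f) = (p : ℚ⟦X⟧) * D f + (Polynomial.derivative p : ℚ⟦X⟧) * f
  rw [Derivation.leibniz, derivative_coe, smul_eq_mul, smul_eq_mul, mul_comm f]

lemma smul_def (p : Pol) (f : ℚ⟦X⟧) : p • f = (p : ℚ⟦X⟧) * f := Algebra.smul_def p f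

/-- A finitely generated `ℚ[X]`-submodule of `ℚ⟦X⟧` stable under `T • d/dX` for some `T ∈ Z`. -/
def IsLattice (Z : Submonoid Pol) (M : Submodule Pol ℚ⟦X⟧) : Prop :=
  M.FG ∧ ∃ T ∈ Z, ∀ x ∈ M, T • D x ∈ M

def HasLattice (Z : Submonoid Pol) (f : ℚ⟦X⟧) : Prop := ∃ M, IsLattice Z M ∧ f ∈ M

lemma IsLattice.sup {Z : Submonoid Pol} {M N : Submodule Pol ℚ⟦X⟧}
    (hM : IsLattice Z M) (hN : IsLattice Z N) : IsLattice Z (M ⊔ N) := by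
  obtain ⟨hM, T, hT, h⟩ := hM
  obtain ⟨hN, U, hU, k⟩ := hN
  refine ⟨hM.sup hN, T * U, mul_mem hT hU, fun x hx => ?_⟩
  obtain ⟨y, hy, z, hz, rfl⟩ := Submodule.mem_sup.1 hx
  rw [map_add, smul_add]
  refine Submodule.add_mem_sup ?_ ?_
  · rw [mul_comm, mul_smul]; exact M.smul_mem _ (h _ hy)
  · rw [mul_smul]; exact N.smul_mem _ (k _ hz)

lemma IsLattice.mul {Z : Submonoid Pol} {M N : Submodule Pol ℚ⟦X⟧}
    (hM : IsLattice Z M) (hN : IsLattice Z N) : IsLattice Z (M * N) := by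
  obtain ⟨hM, T, hT, h⟩ := hM
  obtain ⟨hN, U, hU, k⟩ := hN
  refine ⟨hM.mul hN, T * U, mul_mem hT hU, fun x hx => ?_⟩
  induction hx using Submodule.mul_induction_on' with
  | mem_mul_mem y hy z hz =>
    have : (T * U) • D (y * z) = T • (y * U • D z) + U • ((T • D y) * z) := by
      rw [Derivation.leibniz]
      simp only [smul_def, smul_eq_mul, Polynomial.coe_mul]
      ring
    rw [this]
    exact add_mem (Submodule.smul_mem _ _ (Submodule.mul_mem_mul hy (k _ hz)))
      (Submodule.smul_mem _ _ (Submodule.mul_mem_mul (h _ hy) hz))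
  | add y hy z hz h1 h2 => rw [map_add, smul_add]; exact add_mem h1 h2

lemma HasLattice.add {Z : Submonoid Pol} {f g : ℚ⟦X⟧} (hf : HasLattice Z f)
    (hg : HasLattice Z g) : HasLattice Z (f + g) := by
  obtain ⟨M, hM, h⟩ := hf
  obtain ⟨N, hN, k⟩ := hg
  exact ⟨_, hM.sup hN, Submodule.add_mem_sup h k⟩

lemma HasLattice.mul {Z : Submonoid Pol} {f g : ℚ⟦X⟧} (hf : HasLattice Z f)
    (hg : HasLattice Z g) : HasLattice Z (f * g) := by
  obtain ⟨M, hM, h⟩ := hf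
  obtain ⟨N, hN, k⟩ := hg
  exact ⟨_, hM.mul hN, Submodule.mul_mem_mul h k⟩

lemma HasLattice.smul {Z : Submonoid Pol} {f : ℚ⟦X⟧} (hf : HasLattice Z f) (p : Pol) :
    HasLattice Z (p • f) := by
  obtain ⟨M, hM, h⟩ := hf
  exact ⟨_, hM, M.smul_mem p h⟩

lemma hasLattice_one (Z : Submonoid Pol) : HasLattice Z 1 := by
  refine ⟨Submodule.span Pol {1}, ⟨Submodule.fg_span_singleton _, 1, one_mem _, fun x hx => ?_⟩,
    Submodule.mem_span_singleton_self _⟩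
  obtain ⟨p, rfl⟩ := Submodule.mem_span_singleton.1 hx
  rw [D_smul]
  simpa using Submodule.smul_mem _ _ (Submodule.mem_span_singleton_self _)

/-- The `ℚ[X]`-span of the first `r` derivatives of `f`. -/
def derivSpan (f : ℚ⟦X⟧) (r : ℕ) : Submodule Pol ℚ⟦X⟧ :=
  Submodule.span Pol ((fun i => D^[i] f) '' Set.Iio r)

lemma derivSpan_fg (f : ℚ⟦X⟧) (r : ℕ) : (derivSpan f r).FG :=
  Submodule.fg_span ((Set.finite_Iio r).image _)

lemma derivSpan_mono (f : ℚ⟦X⟧) : Monotone (derivSpan f) := fun _ _ h =>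
  Submodule.span_mono (Set.image_mono (Set.Iio_subset_Iio h))

lemma iterate_mem_derivSpan (f : ℚ⟦X⟧) {i r : ℕ} (h : i < r) : D^[i] f ∈ derivSpan f r :=
  Submodule.subset_span ⟨i, h, rfl⟩

lemma D_mem_derivSpan {f x : ℚ⟦X⟧} {r : ℕ} (h : x ∈ derivSpan f r) :
    D x ∈ derivSpan f (r + 1) := by
  induction h using Submodule.span_induction with
  | mem x hx =>
    obtain ⟨i, hi, rfl⟩ := hx
    simp only [← Function.iterate_succ_apply' (f := D)]
    exact iterate_mem_derivSpan f (Nat.succ_lt_succ hi)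
  | zero => simp
  | add x y _ _ hx hy => rw [map_add]; exact add_mem hx hy
  | smul p x h hx =>
    rw [D_smul]
    exact add_mem (Submodule.smul_mem _ _ hx)
      (Submodule.smul_mem _ _ (derivSpan_mono f (Nat.le_succ r) h))

lemma smul_iterate_succ_mem {f : ℚ⟦X⟧} {r : ℕ} {Q : Pol} (h : Q • D^[r] f ∈ derivSpan f r) :
    Q • D^[r + 1] f ∈ derivSpan f (r + 1) := by
  have := D_mem_derivSpan h
  rw [D_smul] at this
  rw [Function.iterate_succ_apply']
  exact (Submodule.add_mem_iff_left _
    (Submodule.smul_mem _ _ (iterate_mem_derivSpan f (Nat.lt_succ_self r)))).1 this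

lemma isLattice_derivSpan {Z : Submonoid Pol} {f : ℚ⟦X⟧} {r : ℕ} {Q : Pol} (hQ : Q ∈ Z)
    (h : Q • D^[r] f ∈ derivSpan f r) : IsLattice Z (derivSpan f r) := by
  refine ⟨derivSpan_fg f r, Q, hQ, fun x hx => ?_⟩
  induction hx using Submodule.span_induction with
  | mem x hx =>
    obtain ⟨i, hi, rfl⟩ := hx
    simp only [← Function.iterate_succ_apply' (f := D)]
    rcases (Nat.succ_le_of_lt hi).lt_or_eq with hi | hi
    · exact Submodule.smul_mem _ _ (iterate_mem_derivSpan f hi)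
    · subst hi; exact h
  | zero => simp
  | add x y _ _ hx hy => rw [map_add, smul_add]; exact add_mem hx hy
  | smul p x h hx =>
    rw [D_smul, smul_add, smul_comm]
    exact add_mem (Submodule.smul_mem _ _ hx)
      (Submodule.smul_mem _ _ (Submodule.smul_mem _ _ h))

lemma hasLattice_of_smul_mem {Z : Submonoid Pol} {f : ℚ⟦X⟧} {r : ℕ} {Q : Pol} (hQ : Q ∈ Z)
    (h : Q • D^[r] f ∈ derivSpan f r) : HasLattice Z f :=
  ⟨_, isLattice_derivSpan hQ (smul_iterate_succ_mem h),
    iterate_mem_derivSpan f (i := 0) (Nat.succ_pos r)⟩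

/-- A polynomial multiple `T ^ r • Dʳ x` stays in a lattice. -/
lemma pow_smul_iterate_mem {M : Submodule Pol ℚ⟦X⟧} {T : Pol} (h : ∀ x ∈ M, T • D x ∈ M)
    {x : ℚ⟦X⟧} (hx : x ∈ M) (r : ℕ) : T ^ r • D^[r] x ∈ M := by
  induction r with
  | zero => simpa using hx
  | succ r ih =>
    have h1 := h _ ih
    rw [D_smul, smul_add, ← mul_smul, ← pow_succ', ← Function.iterate_succ_apply' (f := D)] at h1
    refine (Submodule.add_mem_iff_left _ ?_).1 h1
    rw [Polynomial.derivative_pow]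
    cases r with
    | zero => simp
    | succ r =>
      have : T • (Polynomial.C ((r + 1 : ℕ) : ℚ) * T ^ (r + 1 - 1) * Polynomial.derivative T) •
          D^[r + 1] x = (Polynomial.C ((r + 1 : ℕ) : ℚ) * Polynomial.derivative T) •
            T ^ (r + 1) • D^[r + 1] x := by
        rw [← mul_smul, ← mul_smul]
        congr 1
        rw [Nat.add_sub_cancel]
        ring
      rw [this]
      exact M.smul_mem _ ih

lemma HasLattice.exists_smul_mem {Z : Submonoid Pol} {f : ℚ⟦X⟧} (hf : HasLattice Z f) :
    ∃ r, ∃ Q ∈ Z, Q • D^[r] f ∈ derivSpan f r := by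
  obtain ⟨M, ⟨hM, T, hT, h⟩, hf⟩ := hf
  have := isNoetherian_of_fg_of_noetherian M hM
  let F : ℕ →o Submodule Pol M :=
    ⟨fun r => Submodule.span Pol ((fun i => (⟨T ^ i • D^[i] f, pow_smul_iterate_mem h hf i⟩ : M)) ''
      Set.Iio r), fun a b hab => Submodule.span_mono (Set.image_mono (Set.Iio_subset_Iio hab))⟩
  obtain ⟨r, hr⟩ := (monotone_stabilizes_iff_noetherian.2 this) F
  refine ⟨r, T ^ r, pow_mem hT r, ?_⟩
  have h1 : (⟨T ^ r • D^[r] f, pow_smul_iterate_mem h hf r⟩ : M) ∈ F r := by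
    rw [hr (r + 1) (Nat.le_succ r)]
    exact Submodule.subset_span ⟨r, Nat.lt_succ_self r, rfl⟩
  have h2 : F r ≤ (derivSpan f r).comap M.subtype := by
    refine Submodule.span_le.2 ?_
    rintro _ ⟨i, hi, rfl⟩
    exact Submodule.smul_mem _ _ (iterate_mem_derivSpan f hi)
  exact h2 h1

lemma HasLattice.D {Z : Submonoid Pol} {f : ℚ⟦X⟧} (hf : HasLattice Z f) :
    HasLattice Z (D f) := by
  obtain ⟨r, Q, hQ, h⟩ := hf.exists_smul_mem
  exact ⟨_, isLattice_derivSpan hQ (smul_iterate_succ_mem (smul_iterate_succ_mem h)),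
    iterate_mem_derivSpan f (i := 1) (by omega)⟩

/-- The polynomials that do not vanish at `1`. -/
def nonvanishing : Submonoid Pol := (nonZeroDivisors ℚ).comap (Polynomial.evalRingHom (1 : ℚ))

lemma mem_nonvanishing {p : Pol} : p ∈ nonvanishing ↔ p.eval 1 ≠ 0 := by
  simp [nonvanishing]

lemma ne_zero_of_mem_nonvanishing {p : Pol} (h : p ∈ nonvanishing) : p ≠ 0 := by
  rintro rfl
  simp [mem_nonvanishing] at h

lemma smul_D_mem {p T : Pol} {x : ℚ⟦X⟧} {M : Submodule Pol ℚ⟦X⟧} (hT : ∀ x ∈ M, T • D x ∈ M) (h : p • x ∈ M) :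
    (p * T) • D x + (T * Polynomial.derivative p) • x ∈ M := by
  have := hT _ h
  rw [D_smul, smul_add, ← mul_smul, ← mul_smul, mul_comm T p] at this
  exact this

/-- The polynomial torsion of a lattice nonsingular at `1` modulo another such lattice is supported
away from `1`. -/
lemma exists_nonvanishing_smul_mem {M N : Submodule Pol ℚ⟦X⟧} (hM : IsLattice nonvanishing M)
    (hN : IsLattice nonvanishing N) {W : ℚ⟦X⟧} (hW : W ∈ N) {p : Pol} (hp : p ≠ 0)
    (hpW : p • W ∈ M) : ∃ q ∈ nonvanishing, q • W ∈ M := by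
  obtain ⟨hfg, T, hT, hTN⟩ := hN
  obtain ⟨-, U, hU, hUM⟩ := hM
  let N' : Submodule Pol ℚ⟦X⟧ :=
    { carrier := {x | x ∈ N ∧ ∃ p : Pol, p ≠ 0 ∧ p • x ∈ M}
      add_mem' := by
        rintro x y ⟨hx, p, hp, hpx⟩ ⟨hy, q, hq, hqy⟩
        refine ⟨add_mem hx hy, p * q, mul_ne_zero hp hq, ?_⟩
        rw [smul_add]
        refine add_mem ?_ ?_
        · rw [mul_comm, mul_smul]; exact M.smul_mem _ hpx
        · rw [mul_smul]; exact M.smul_mem _ hqy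
      zero_mem' := ⟨zero_mem _, 1, one_ne_zero, by simp⟩
      smul_mem' := by
        rintro c x ⟨hx, p, hp, hpx⟩
        exact ⟨N.smul_mem _ hx, p, hp, by rw [smul_comm]; exact M.smul_mem _ hpx⟩ }
  have hN' : N'.FG := by
    have := isNoetherian_of_fg_of_noetherian N hfg
    have h1 := IsNoetherian.noetherian (N'.comap N.subtype)
    have h2 := h1.map N.subtype
    rwa [Submodule.map_comap_subtype, inf_eq_right.2 (fun x hx => hx.1)] at h2
  have hstab : ∀ x ∈ N', (T * U) • D x ∈ N' := by
    rintro x ⟨hx, p, hp, hpx⟩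
    refine ⟨?_, p * p, mul_ne_zero hp hp, ?_⟩
    · rw [mul_comm, mul_smul]; exact N.smul_mem _ (hTN _ hx)
    · have h1 := M.smul_mem (p * T) (smul_D_mem hUM hpx)
      have h2 := M.smul_mem (T * U * Polynomial.derivative p) hpx
      have h3 := sub_mem h1 h2
      convert h3 using 1
      simp only [smul_def, Polynomial.coe_mul, mul_add]
      ring
  have hex : ∃ p : Pol, p ≠ 0 ∧ ∀ x ∈ N', p • x ∈ M := by
    classical
    obtain ⟨S, hS⟩ := hN'
    have : ∀ x ∈ S, ∃ p : Pol, p ≠ 0 ∧ p • x ∈ M := fun x hx =>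
      (show x ∈ N' by rw [← hS]; exact Submodule.subset_span hx).2
    choose! P hP hPM using this
    refine ⟨∏ x ∈ S, P x, Finset.prod_ne_zero_iff.2 hP, fun x hx => ?_⟩
    rw [← hS] at hx
    induction hx using Submodule.span_induction with
    | mem x hx =>
      rw [← Finset.prod_erase_mul _ _ hx, mul_smul]
      exact M.smul_mem _ (hPM x hx)
    | zero => simp
    | add x y _ _ hx hy => rw [smul_add]; exact add_mem hx hy
    | smul c x _ hx => rw [smul_comm]; exact M.smul_mem _ hx
  have key : ∀ n : ℕ, ∀ p : Pol, p ≠ 0 → p.rootMultiplicity 1 = n → (∀ x ∈ N', p • x ∈ M) →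
      ∃ q ∈ nonvanishing, ∀ x ∈ N', q • x ∈ M := by
    intro n
    induction n with
    | zero =>
      intro p hp h0 h
      refine ⟨p, mem_nonvanishing.2 fun h1 => ?_, h⟩
      have := (Polynomial.rootMultiplicity_pos hp).2 h1
      omega
    | succ n ih =>
      intro p hp hn h
      have hroot : p.IsRoot 1 := (Polynomial.rootMultiplicity_pos hp).1 (by omega)
      have hd := Polynomial.derivative_rootMultiplicity_of_root hroot
      have hd0 : Polynomial.derivative p ≠ 0 := by
        intro h0
        have := Polynomial.derivative_eq_zero.1 h0
        rw [Polynomial.eq_C_of_natDegree_eq_zero this] at hroot hp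
        simp [Polynomial.IsRoot] at hroot
        simp [hroot] at hp
      have hTU : (T * U) ∈ nonvanishing := mul_mem hT hU
      have hne := mul_ne_zero (ne_zero_of_mem_nonvanishing hTU) hd0
      refine ih (T * U * Polynomial.derivative p) hne ?_ fun x hx => ?_
      · rw [Polynomial.rootMultiplicity_mul hne, hd, hn,
          Polynomial.rootMultiplicity_eq_zero (mem_nonvanishing.1 hTU)]
        omega
      · have h1 := M.smul_mem T (smul_D_mem hUM (h x hx))
        have h2 := h _ (hstab x hx)
        have h3 := sub_mem h1 h2
        convert h3 using 1
        simp only [smul_def, Polynomial.coe_mul, mul_add]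
        ring
  obtain ⟨p', hp', h'⟩ := hex
  obtain ⟨q, hq, h⟩ := key _ p' hp' rfl h'
  exact ⟨q, hq, h W ⟨hW, p, hp, hpW⟩⟩

/-- The numerator `aₙ` in the expansion `∑ aₙ / n! Xⁿ`. -/
def expCoeff (n : ℕ) (f : ℚ⟦X⟧) : ℚ := n.factorial * coeff n f

lemma expCoeff_add (n : ℕ) (f g : ℚ⟦X⟧) : expCoeff n (f + g) = expCoeff n f + expCoeff n g := by
  simp [expCoeff, mul_add]

lemma expCoeff_D (n : ℕ) (f : ℚ⟦X⟧) : expCoeff n (D f) = expCoeff (n + 1) f := by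
  rw [expCoeff, expCoeff, D, coeff_derivative, Nat.factorial_succ]
  push_cast
  ring

lemma expCoeff_iterate_D (n i : ℕ) (f : ℚ⟦X⟧) : expCoeff n (D^[i] f) = expCoeff (n + i) f := by
  induction i generalizing n with
  | zero => rfl
  | succ i ih => rw [Function.iterate_succ_apply', expCoeff_D, ih]; congr 1; omega

lemma expCoeff_mul (n : ℕ) (f g : ℚ⟦X⟧) : expCoeff n (f * g) =
    ∑ ij ∈ Finset.HasAntidiagonal.antidiagonal n, (n.choose ij.1 : ℚ) * (expCoeff ij.1 f * expCoeff ij.2 g) := by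
  rw [expCoeff, coeff_mul, Finset.mul_sum]
  refine Finset.sum_congr rfl fun ij hij => ?_
  obtain ⟨i, j⟩ := ij
  obtain rfl := Finset.HasAntidiagonal.mem_antidiagonal.1 hij
  simp only [expCoeff]
  rw [← Nat.add_choose_mul_factorial_mul_factorial i j, Nat.choose_symm_add]
  push_cast
  ring

/-- Geometric growth (with constant `C`) of the `aₙ` and of their common denominators. -/
def EBound (C : ℕ) (f : ℚ⟦X⟧) : Prop := ∀ n, |expCoeff n f| ≤ (C : ℚ) ^ (n + 1) ∧
  ∃ d : ℕ, 0 < d ∧ d ≤ C ^ (n + 1) ∧ ∀ m ≤ n, ∃ z : ℤ, (d : ℚ) * expCoeff m f = z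

lemma EBound.mono {C C' : ℕ} {f : ℚ⟦X⟧} (h : EBound C f) (hC : C ≤ C') : EBound C' f := by
  intro n
  obtain ⟨h1, d, hd, h2, h3⟩ := h n
  exact ⟨h1.trans (by gcongr), d, hd, h2.trans (by gcongr), h3⟩

lemma EBound.common {C C' : ℕ} {f g : ℚ⟦X⟧} (hf : EBound C f) (hg : EBound C' g) :
    ∃ B, 1 ≤ B ∧ EBound B f ∧ EBound B g :=
  ⟨C + C' + 1, by omega, hf.mono (by omega), hg.mono (by omega)⟩

lemma EBound.add {C : ℕ} {f g : ℚ⟦X⟧} (hC : 1 ≤ C) (hf : EBound C f) (hg : EBound C g) :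
    EBound (2 * C * C) (f + g) := by
  intro n
  obtain ⟨h1, d, hd, h2, h3⟩ := hf n
  obtain ⟨k1, e, he, k2, k3⟩ := hg n
  constructor
  · rw [expCoeff_add]
    have hC' : (1 : ℚ) ≤ (C : ℚ) ^ (n + 1) := one_le_pow₀ (by exact_mod_cast hC)
    have h2' : (2 : ℚ) ≤ 2 ^ (n + 1) := le_self_pow₀ (by norm_num) (by omega)
    calc _ ≤ (C : ℚ) ^ (n + 1) + (C : ℚ) ^ (n + 1) := (abs_add_le _ _).trans (add_le_add h1 k1)
      _ = 2 * (C : ℚ) ^ (n + 1) * 1 := by ring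
      _ ≤ 2 ^ (n + 1) * (C : ℚ) ^ (n + 1) * (C : ℚ) ^ (n + 1) := by gcongr
      _ = _ := by push_cast; ring
  · refine ⟨d * e, Nat.mul_pos hd he, ?_, fun m hm => ?_⟩
    · calc d * e ≤ C ^ (n + 1) * C ^ (n + 1) := Nat.mul_le_mul h2 k2
        _ ≤ 2 ^ (n + 1) * (C ^ (n + 1) * C ^ (n + 1)) := Nat.le_mul_of_pos_left _ (by positivity)
        _ = _ := by ring
    · obtain ⟨z, hz⟩ := h3 m hm
      obtain ⟨w, hw⟩ := k3 m hm
      refine ⟨e * z + d * w, ?_⟩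
      rw [expCoeff_add]
      push_cast
      rw [← hz, ← hw]
      ring

lemma EBound.mul {C : ℕ} {f g : ℚ⟦X⟧} (hC : 1 ≤ C) (hf : EBound C f) (hg : EBound C g) :
    EBound (2 * C * C) (f * g) := by
  intro n
  constructor
  · rw [expCoeff_mul]
    have hC' : (1 : ℚ) ≤ (C : ℚ) := by exact_mod_cast hC
    calc _ ≤ ∑ ij ∈ Finset.HasAntidiagonal.antidiagonal n, (n.choose ij.1 : ℚ) * (C : ℚ) ^ (2 * n + 2) := by
          refine (Finset.abs_sum_le_sum_abs _ _).trans (Finset.sum_le_sum fun ij hij => ?_)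
          rw [abs_mul, abs_mul, Nat.abs_cast]
          refine mul_le_mul_of_nonneg_left ?_ (by positivity)
          refine (mul_le_mul (hf ij.1).1 (hg ij.2).1 (abs_nonneg _) (by positivity)).trans ?_
          rw [← pow_add]
          have := Finset.HasAntidiagonal.mem_antidiagonal.1 hij
          exact pow_le_pow_right₀ hC' (by omega)
      _ = (2 : ℚ) ^ n * (C : ℚ) ^ (2 * n + 2) := by
          rw [← Finset.sum_mul, Finset.Nat.sum_antidiagonal_eq_sum_range_succ_mk]
          congr 1
          exact_mod_cast Nat.sum_range_choose n
      _ ≤ (2 : ℚ) ^ (n + 1) * (C : ℚ) ^ (2 * n + 2) := by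
          gcongr
          · norm_num
          · omega
      _ = _ := by push_cast; ring
  · obtain ⟨-, d, hd, h2, h3⟩ := hf n
    obtain ⟨-, e, he, k2, k3⟩ := hg n
    refine ⟨d * e, Nat.mul_pos hd he, ?_, fun m hm => ?_⟩
    · calc d * e ≤ C ^ (n + 1) * C ^ (n + 1) := Nat.mul_le_mul h2 k2
        _ ≤ 2 ^ (n + 1) * (C ^ (n + 1) * C ^ (n + 1)) := Nat.le_mul_of_pos_left _ (by positivity)
        _ = _ := by ring
    · choose! z hz using h3
      choose! w hw using k3
      refine ⟨∑ ij ∈ Finset.HasAntidiagonal.antidiagonal m, (m.choose ij.1 : ℤ) * (z ij.1 * w ij.2), ?_⟩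
      rw [expCoeff_mul, Finset.mul_sum]
      push_cast
      refine Finset.sum_congr rfl fun ij hij => ?_
      have := Finset.HasAntidiagonal.mem_antidiagonal.1 hij
      rw [← hz ij.1 (by omega), ← hw ij.2 (by omega)]
      ring

lemma EBound.D {C : ℕ} {f : ℚ⟦X⟧} (hC : 1 ≤ C) (hf : EBound C f) : EBound (C * C) (D f) := by
  intro n
  obtain ⟨h1, d, hd, h2, h3⟩ := hf (n + 1)
  refine ⟨?_, d, hd, ?_, fun m hm => ?_⟩
  · rw [expCoeff_D]
    refine h1.trans ?_
    push_cast
    rw [← pow_two, ← pow_mul]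
    exact pow_le_pow_right₀ (by exact_mod_cast hC) (by omega)
  · refine h2.trans ?_
    rw [← pow_two, ← pow_mul]
    exact Nat.pow_le_pow_right hC (by omega)
  · rw [expCoeff_D]
    exact h3 _ (by omega)

lemma EBound.of_finite {f : ℚ⟦X⟧} {C : ℕ} (hC : 1 ≤ C) {d : ℕ} (hd : 0 < d) (hdC : d ≤ C)
    (h : ∀ n, |expCoeff n f| ≤ C) (hz : ∀ n, ∃ z : ℤ, (d : ℚ) * expCoeff n f = z) :
    EBound C f := fun n =>
  ⟨(h n).trans (le_self_pow₀ (by exact_mod_cast hC) (by omega)), d, hd,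
    hdC.trans (Nat.le_self_pow (by omega) _), fun m _ => hz m⟩

lemma eBound_C (q : ℚ) : ∃ B, EBound B (C q) := by
  refine ⟨q.num.natAbs + q.den, EBound.of_finite (d := q.den) (by have := q.pos; omega) q.pos
    (by omega) (fun n => ?_) fun n => ?_⟩
  · have h1 : |q| ≤ q.num.natAbs := by
      rw [Nat.cast_natAbs, Int.cast_abs]
      nth_rw 1 [← Rat.num_div_den q]
      rw [abs_div, Nat.abs_cast]
      exact div_le_self (abs_nonneg _) (by exact_mod_cast q.pos)
    have h2 : (0 : ℚ) ≤ q.den := by positivity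
    rcases n with _ | n
    · simp only [expCoeff, Nat.factorial, coeff_zero_C]
      push_cast at h1 ⊢
      rw [one_mul]
      linarith
    · simp [expCoeff]
      positivity
  · rcases n with _ | n
    · exact ⟨q.num, by simp [expCoeff, mul_comm]⟩
    · exact ⟨0, by simp [expCoeff]⟩

lemma eBound_X : EBound 1 (X : ℚ⟦X⟧) := by
  refine EBound.of_finite (d := 1) le_rfl one_pos le_rfl (fun n => ?_) fun n => ?_ <;>
  rcases n with _ | _ | n
  any_goals simp [expCoeff, coeff_X]
  · exact ⟨0, by simp⟩
  · exact ⟨1, by simp⟩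
  · exact ⟨0, by simp⟩

/-- Power series satisfying the two arithmetic conditions in the definition of an E-function. -/
def eSeries : Subalgebra ℚ ℚ⟦X⟧ where
  carrier := {f | ∃ C, EBound C f}
  add_mem' := by
    rintro f g ⟨C, hf⟩ ⟨C', hg⟩
    obtain ⟨B, hB, hf, hg⟩ := hf.common hg
    exact ⟨_, hf.add hB hg⟩
  mul_mem' := by
    rintro f g ⟨C, hf⟩ ⟨C', hg⟩
    obtain ⟨B, hB, hf, hg⟩ := hf.common hg
    exact ⟨_, hf.mul hB hg⟩
  algebraMap_mem' := eBound_C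

lemma D_mem_eSeries {f : ℚ⟦X⟧} (h : f ∈ eSeries) : D f ∈ eSeries := by
  obtain ⟨C, h⟩ := h
  exact ⟨_, (h.mono (Nat.le_succ C)).D (by omega)⟩

lemma iterate_D_mem_eSeries {f : ℚ⟦X⟧} (h : f ∈ eSeries) (i : ℕ) : D^[i] f ∈ eSeries := by
  induction i with
  | zero => exact h
  | succ i ih => rw [Function.iterate_succ_apply']; exact D_mem_eSeries ih

lemma coe_mem_eSeries (p : Pol) : (p : ℚ⟦X⟧) ∈ eSeries := by
  induction p using Polynomial.induction_on' with
  | add p q hp hq => rw [Polynomial.coe_add]; exact add_mem hp hq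
  | monomial n a =>
    rw [← Polynomial.C_mul_X_pow_eq_monomial, Polynomial.coe_mul, Polynomial.coe_pow,
      Polynomial.coe_X, Polynomial.coe_C]
    have hX : (X : ℚ⟦X⟧) ∈ eSeries := ⟨1, eBound_X⟩
    exact mul_mem (eSeries.algebraMap_mem a) (pow_mem hX n)

lemma smul_mem_eSeries {f : ℚ⟦X⟧} (h : f ∈ eSeries) (p : Pol) : p • f ∈ eSeries := by
  rw [smul_def]; exact mul_mem (coe_mem_eSeries p) h

/-! ### Values -/

/-- The sum of the power series `f` at the complex number `z`. -/
def value (z : ℂ) (f : ℚ⟦X⟧) : ℂ := ∑' n, ((coeff n f : ℚ) : ℂ) * z ^ n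

lemma EBound.norm_coeff_le {C : ℕ} {f : ℚ⟦X⟧} (h : EBound C f) (n : ℕ) :
    ‖((coeff n f : ℚ) : ℂ)‖ ≤ (C : ℝ) ^ (n + 1) / n.factorial := by
  rw [le_div_iff₀ (by positivity), mul_comm]
  have h1 : (((|expCoeff n f| : ℚ)) : ℝ) ≤ (((C : ℚ) ^ (n + 1) : ℚ) : ℝ) := by
    exact_mod_cast (h n).1
  rw [expCoeff, abs_mul, Nat.abs_cast] at h1
  push_cast at h1
  rw [Complex.norm_ratCast]
  exact h1

lemma summable_norm_value {f : ℚ⟦X⟧} (h : f ∈ eSeries) (z : ℂ) :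
    Summable fun n => ‖((coeff n f : ℚ) : ℂ) * z ^ n‖ := by
  obtain ⟨C, h⟩ := h
  refine Summable.of_nonneg_of_le (fun _ => norm_nonneg _) (fun n => ?_)
    ((Real.summable_pow_div_factorial (C * ‖z‖)).mul_left (C : ℝ))
  rw [norm_mul, norm_pow]
  calc _ ≤ (C : ℝ) ^ (n + 1) / n.factorial * ‖z‖ ^ n := by gcongr; exact h.norm_coeff_le n
    _ = _ := by rw [mul_pow]; ring

lemma hasSum_value {f : ℚ⟦X⟧} (h : f ∈ eSeries) (z : ℂ) :
    HasSum (fun n => ((coeff n f : ℚ) : ℂ) * z ^ n) (value z f) :=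
  (summable_norm_value h z).of_norm.hasSum

lemma value_add {f g : ℚ⟦X⟧} (hf : f ∈ eSeries) (hg : g ∈ eSeries) (z : ℂ) :
    value z (f + g) = value z f + value z g := by
  have := ((hasSum_value hf z).add (hasSum_value hg z)).tsum_eq
  rw [← this, value]
  refine tsum_congr fun n => ?_
  simp [add_mul]

lemma value_mul {f g : ℚ⟦X⟧} (hf : f ∈ eSeries) (hg : g ∈ eSeries) (z : ℂ) :
    value z (f * g) = value z f * value z g := by
  have := tsum_mul_tsum_eq_tsum_sum_antidiagonal_of_summable_norm (summable_norm_value hf z)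
    (summable_norm_value hg z)
  rw [value, value, value, this]
  refine tsum_congr fun n => ?_
  rw [coeff_mul]
  push_cast
  rw [Finset.sum_mul]
  refine Finset.sum_congr rfl fun ij hij => ?_
  rw [← Finset.HasAntidiagonal.mem_antidiagonal.1 hij, pow_add]
  ring

lemma value_C (q : ℚ) (z : ℂ) : value z (C q) = q := by
  rw [value, tsum_eq_single 0]
  · simp
  · intro n hn
    simp [coeff_C, hn]

lemma value_X (z : ℂ) : value z X = z := by
  rw [value, tsum_eq_single 1]
  · simp
  · intro n hn
    simp [coeff_X, hn]

/-- Evaluation at `z` as a ring homomorphism. -/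
def valueHom (z : ℂ) : eSeries →ₐ[ℚ] ℂ where
  toFun f := value z f
  map_zero' := by simp [value]
  map_one' := by simpa using value_C 1 z
  map_add' f g := value_add f.2 g.2 z
  map_mul' f g := value_mul f.2 g.2 z
  commutes' q := by simpa using value_C q z

lemma value_coe (p : Pol) (z : ℂ) : value z (p : ℚ⟦X⟧) = Polynomial.aeval z p := by
  induction p using Polynomial.induction_on' with
  | add p q hp hq =>
    rw [Polynomial.coe_add, value_add (coe_mem_eSeries p) (coe_mem_eSeries q), hp, hq, map_add]
  | monomial n a =>
    have hX : (X : ℚ⟦X⟧) ∈ eSeries := ⟨1, eBound_X⟩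
    have h1 : value z (X ^ n : ℚ⟦X⟧) = z ^ n := by
      have := map_pow (valueHom z) ⟨X, hX⟩ n
      simpa [valueHom, value_X] using this
    rw [← Polynomial.C_mul_X_pow_eq_monomial, Polynomial.coe_mul, Polynomial.coe_pow,
      Polynomial.coe_X, Polynomial.coe_C, value_mul (f := C a) (eSeries.algebraMap_mem a) (pow_mem hX n),
      value_C, h1]
    simp

lemma value_smul {f : ℚ⟦X⟧} (hf : f ∈ eSeries) (p : Pol) (z : ℂ) :
    value z (p • f) = Polynomial.aeval z p * value z f := by
  rw [smul_def, value_mul (coe_mem_eSeries p) hf, value_coe]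

/-- An E-series vanishing at `1` is divisible by `1 - X` among E-series. -/
lemma exists_one_sub_X_mul {f : ℚ⟦X⟧} (hf : f ∈ eSeries) (h0 : value 1 f = 0) :
    ∃ g ∈ eSeries, (1 - X) * g = f := by
  have hsum := hasSum_value hf 1
  rw [h0] at hsum
  obtain ⟨C, hf⟩ := hf
  let g : ℚ⟦X⟧ := PowerSeries.mk fun n => ∑ k ∈ Finset.range (n + 1), coeff k f
  have hg : ∀ n, coeff n g = ∑ k ∈ Finset.range (n + 1), coeff k f := fun n => coeff_mk _ _
  refine ⟨g, ?_, ?_⟩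
  swap
  · ext n
    rw [sub_mul, one_mul, map_sub, hg]
    rcases n with _ | n
    · simp
    · rw [coeff_succ_X_mul, hg, Finset.sum_range_succ]
      ring
  · obtain ⟨B, hB⟩ := exists_nat_ge (Real.exp C)
    have hbound : ∀ n, |expCoeff n g| ≤ (C : ℚ) ^ (n + 2) * B := by
      intro n
      have h1 : HasSum (fun k => ((coeff (k + (n + 1)) f : ℚ) : ℂ))
          (0 - ∑ k ∈ Finset.range (n + 1), ((coeff k f : ℚ) : ℂ)) := by
        simpa using (hasSum_nat_add_iff' (n + 1)).2 hsum
      have h2 : HasSum (fun k => (C : ℝ) ^ (n + 2) / n.factorial * ((C : ℝ) ^ k / k.factorial))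
          ((C : ℝ) ^ (n + 2) / n.factorial * Real.exp C) := by
        have := NormedSpace.expSeries_div_hasSum_exp (𝔸 := ℝ) (C : ℝ)
        rw [← Real.exp_eq_exp_ℝ] at this
        exact this.mul_left _
      have h3 : ‖(0 - ∑ k ∈ Finset.range (n + 1), ((coeff k f : ℚ) : ℂ))‖ ≤
          (C : ℝ) ^ (n + 2) / n.factorial * Real.exp C := by
        refine h1.norm_le_of_bounded h2 fun k => ?_
        refine (hf.norm_coeff_le _).trans ?_
        rw [div_mul_div_comm, ← pow_add]
        have : k + (n + 1) + 1 = n + 2 + k := by omega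
        rw [this]
        gcongr
        have h4 : n.factorial * k.factorial ≤ (n + k).factorial :=
          Nat.le_of_dvd (Nat.factorial_pos _) (Nat.factorial_mul_factorial_dvd_factorial_add n k)
        have h5 : (n + k).factorial ≤ (k + (n + 1)).factorial := Nat.factorial_le (by omega)
        exact_mod_cast h4.trans h5
      have h4 : (0 - ∑ k ∈ Finset.range (n + 1), ((coeff k f : ℚ) : ℂ)) = ((-coeff n g : ℚ) : ℂ) := by
        rw [hg]; push_cast; ring
      rw [h4, Complex.norm_ratCast] at h3
      push_cast at h3
      rw [abs_neg] at h3
      have h5 : (|expCoeff n g| : ℝ) ≤ (C : ℝ) ^ (n + 2) * B := by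
        rw [expCoeff]
        push_cast
        rw [abs_mul, Nat.abs_cast]
        calc (n.factorial : ℝ) * |((coeff n g : ℚ) : ℝ)|
            ≤ n.factorial * ((C : ℝ) ^ (n + 2) / n.factorial * Real.exp C) := by gcongr
          _ = (C : ℝ) ^ (n + 2) * Real.exp C := by field_simp
          _ ≤ _ := by gcongr
      exact_mod_cast h5
    refine ⟨(C + 1) * (C + 1) * (B + 1), fun n => ⟨(hbound n).trans ?_, ?_⟩⟩
    · push_cast
      rw [mul_pow, ← pow_two, ← pow_mul]
      have hC1 : (1 : ℚ) ≤ (C : ℚ) + 1 := by simp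
      calc (C : ℚ) ^ (n + 2) * B ≤ ((C : ℚ) + 1) ^ (n + 2) * (B + 1) := by gcongr <;> simp
        _ ≤ _ := by
          gcongr
          · omega
          · exact le_self_pow₀ (by simp) (by omega)
    · obtain ⟨-, d, hd, h2, h3⟩ := hf n
      refine ⟨d, hd, h2.trans (Nat.pow_le_pow_left (by nlinarith [Nat.zero_le (C * C * B)]) _),
        fun m hm => ?_⟩
      choose! z hz using h3
      refine ⟨∑ k ∈ Finset.range (m + 1), (m.descFactorial (m - k) : ℤ) * z k, ?_⟩
      rw [expCoeff, hg, Finset.mul_sum, Finset.mul_sum]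
      push_cast
      refine Finset.sum_congr rfl fun k hk => ?_
      have hk : k ≤ m := Nat.lt_succ_iff.1 (Finset.mem_range.1 hk)
      rw [← hz k (by omega), expCoeff]
      have : (m.factorial : ℚ) = m.descFactorial (m - k) * k.factorial := by
        have := Nat.factorial_mul_descFactorial (Nat.sub_le m k)
        rw [Nat.sub_sub_self hk] at this
        rw [← this]; push_cast; ring
      rw [this]
      ring

/-- The element `∑_{i < r} Q i • Dⁱ φ`. -/
def comb (φ : ℚ⟦X⟧) (r : ℕ) (Q : ℕ → Pol) : ℚ⟦X⟧ := ∑ i ∈ Finset.range r, Q i • D^[i] φ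

lemma comb_add (φ : ℚ⟦X⟧) (r : ℕ) (P Q : ℕ → Pol) :
    comb φ r (P + Q) = comb φ r P + comb φ r Q := by
  simp [comb, add_smul, Finset.sum_add_distrib]

lemma comb_smul (φ : ℚ⟦X⟧) (r : ℕ) (p : Pol) (Q : ℕ → Pol) :
    comb φ r (p • Q) = p • comb φ r Q := by
  simp [comb, mul_smul, Finset.smul_sum]

lemma comb_sum (φ : ℚ⟦X⟧) (r : ℕ) {ι : Type*} (s : Finset ι) (Q : ι → ℕ → Pol) :
    comb φ r (∑ j ∈ s, Q j) = ∑ j ∈ s, comb φ r (Q j) := by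
  simp only [comb, Finset.sum_apply, Finset.sum_smul]
  exact Finset.sum_comm

lemma comb_mem_derivSpan (φ : ℚ⟦X⟧) (r : ℕ) (Q : ℕ → Pol) : comb φ r Q ∈ derivSpan φ r :=
  Submodule.sum_mem _ fun _ hi => Submodule.smul_mem _ _
    (iterate_mem_derivSpan φ (Finset.mem_range.1 hi))

lemma exists_comb_of_mem {φ x : ℚ⟦X⟧} {r : ℕ} (h : x ∈ derivSpan φ r) :
    ∃ Q : ℕ → Pol, x = comb φ r Q := by
  induction h using Submodule.span_induction with
  | mem x hx =>
    obtain ⟨i, hi, rfl⟩ := hx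
    refine ⟨Pi.single i 1, ?_⟩
    rw [comb, Finset.sum_eq_single i]
    · simp
    · intro j _ hj; simp [hj]
    · intro h; exact absurd (Finset.mem_range.2 hi) h
  | zero => exact ⟨0, by simp [comb]⟩
  | add x y _ _ hx hy =>
    obtain ⟨P, rfl⟩ := hx
    obtain ⟨Q, rfl⟩ := hy
    exact ⟨P + Q, (comb_add _ _ _ _).symm⟩
  | smul p x _ hx =>
    obtain ⟨P, rfl⟩ := hx
    exact ⟨p • P, (comb_smul _ _ _ _).symm⟩

/-- The action of `T • d/dX` on coordinates, when `T • Dʳ φ = ∑ A i • Dⁱ φ`. -/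
def nabla (T : Pol) (A : ℕ → Pol) (r : ℕ) (Q : ℕ → Pol) : ℕ → Pol := fun i =>
  T * Polynomial.derivative (Q i) + (if i = 0 then 0 else T * Q (i - 1)) + A i * Q (r - 1)

lemma comb_nabla {T : Pol} {A : ℕ → Pol} {r : ℕ} {φ : ℚ⟦X⟧} (hr : 0 < r)
    (h : T • D^[r] φ = comb φ r A) (Q : ℕ → Pol) :
    T • D (comb φ r Q) = comb φ r (nabla T A r Q) := by
  obtain ⟨r, rfl⟩ := Nat.exists_eq_add_of_lt hr
  rw [zero_add] at *
  have h1 : comb φ (r + 1) (nabla T A (r + 1) Q) =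
      ∑ i ∈ Finset.range (r + 1), (T * Polynomial.derivative (Q i)) • D^[i] φ +
      ∑ i ∈ Finset.range r, (T * Q i) • D^[i + 1] φ + Q r • comb φ (r + 1) A := by
    simp only [comb, nabla, add_smul, Finset.sum_add_distrib, Finset.smul_sum]
    congr 1
    · congr 1
      rw [Finset.sum_range_succ']
      simp
    · refine Finset.sum_congr rfl fun i _ => ?_
      rw [← mul_smul, mul_comm, Nat.add_sub_cancel]
  rw [h1, ← h, comb, map_sum, Finset.smul_sum]
  simp only [D_smul, smul_add, ← mul_smul, Finset.sum_add_distrib,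
    ← Function.iterate_succ_apply' (f := D)]
  rw [Finset.sum_range_succ (fun i => (T * Q i) • D^[i + 1] φ) r, mul_comm T (Q r)]
  abel

/-- The polynomial `1 - X`. -/
abbrev sPol : Pol := 1 - Polynomial.X

/-- Coordinates of `(1 - X) ^ c * T ^ l • Dˡ W`, when `Q` are those of `(1 - X) ^ c • W` and
`T = (1 - X) * U`. -/
def derivCoords (U : Pol) (A : ℕ → Pol) (r c : ℕ) (Q : ℕ → Pol) : ℕ → ℕ → Pol
  | 0 => Q
  | l + 1 => nabla (sPol * U) A r (derivCoords U A r c Q l) +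
      ((c : Pol) * U - (l : Pol) * Polynomial.derivative (sPol * U)) • derivCoords U A r c Q l

lemma comb_derivCoords {U : Pol} {A : ℕ → Pol} {r : ℕ} {φ : ℚ⟦X⟧} (hr : 0 < r)
    (h : (sPol * U) • D^[r] φ = comb φ r A) {c : ℕ} {Q : ℕ → Pol} {W : ℚ⟦X⟧}
    (hW : comb φ r Q = sPol ^ c • W) (l : ℕ) :
    comb φ r (derivCoords U A r c Q l) = (sPol ^ c * (sPol * U) ^ l) • D^[l] W := by
  induction l with
  | zero => simpa [derivCoords] using hW
  | succ l ih =>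
    rw [derivCoords, comb_add, comb_smul, ← comb_nabla hr h, ih, D_smul, smul_add, ← mul_smul,
      ← mul_smul, ← mul_smul, ← Function.iterate_succ_apply' (f := D), add_assoc, ← add_smul]
    have h1 : (sPol * U * Polynomial.derivative (sPol ^ c * (sPol * U) ^ l) +
        ((c : Pol) * U - (l : Pol) * Polynomial.derivative (sPol * U)) *
          (sPol ^ c * (sPol * U) ^ l)) = 0 := by
      have hs : Polynomial.derivative sPol = -1 := by simp [sPol]
      have hc : sPol * Polynomial.derivative (sPol ^ c) = -(c : Pol) * sPol ^ c := by
        rw [Polynomial.derivative_pow, hs]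
        rcases c with _ | c
        · simp
        · rw [Nat.add_sub_cancel]; simp; ring
      have hl : (sPol * U) * Polynomial.derivative ((sPol * U) ^ l) =
          l * Polynomial.derivative (sPol * U) * (sPol * U) ^ l := by
        rw [Polynomial.derivative_pow]
        rcases l with _ | l
        · simp
        · rw [Nat.add_sub_cancel, pow_succ]; simp only [map_natCast]; ring
      rw [Polynomial.derivative_mul]
      linear_combination U * (sPol * U) ^ l * hc + sPol ^ c * hl
    rw [h1, zero_smul, add_zero]
    congr 1
    ring

lemma natDegree_nabla_le {T : Pol} {A : ℕ → Pol} {r κ m : ℕ} (hr : 0 < r)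
    (hT : T.natDegree ≤ κ) (hA : ∀ i < r, (A i).natDegree ≤ κ) {Q : ℕ → Pol}
    (hQ : ∀ i < r, (Q i).natDegree ≤ m) : ∀ i < r, (nabla T A r Q i).natDegree ≤ m + κ := by
  intro i hi
  have hm : ∀ {p q : Pol}, p.natDegree ≤ κ → q.natDegree ≤ m → (p * q).natDegree ≤ m + κ :=
    fun hp hq => Polynomial.natDegree_mul_le.trans (by omega)
  refine (Polynomial.natDegree_add_le_of_degree_le (n := m + κ) (Polynomial.natDegree_add_le_of_degree_le ?_ ?_) ?_)
  · exact hm hT ((Polynomial.natDegree_derivative_le _).trans ((Nat.sub_le _ _).trans (hQ i hi)))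
  · split_ifs
    · simp
    · exact hm hT (hQ _ (by omega))
  · exact hm (hA i hi) (hQ _ (by omega))

lemma natDegree_derivCoords_le {U : Pol} {A : ℕ → Pol} {r κ m c : ℕ} (hr : 0 < r)
    (hT : (sPol * U).natDegree ≤ κ) (hU : U.natDegree ≤ κ)
    (hA : ∀ i < r, (A i).natDegree ≤ κ) {Q : ℕ → Pol}
    (hQ : ∀ i < r, (Q i).natDegree ≤ m) (l : ℕ) :
    ∀ i < r, (derivCoords U A r c Q l i).natDegree ≤ m + κ * l := by
  induction l with
  | zero => simpa [derivCoords] using hQ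
  | succ l ih =>
    intro i hi
    have h1 := natDegree_nabla_le hr hT hA ih i hi
    rw [derivCoords, Pi.add_apply, Pi.smul_apply, smul_eq_mul]
    refine Polynomial.natDegree_add_le_of_degree_le (by rw [Nat.mul_succ]; omega) ?_
    refine Polynomial.natDegree_mul_le_of_le (m := κ) (n := m + κ * l) ?_ (ih i hi) |>.trans
      (by rw [Nat.mul_succ]; omega)
    refine (Polynomial.natDegree_sub_le_of_le (m := κ) (n := κ) ?_ ?_).trans (by simp)
    · exact (Polynomial.natDegree_mul_le_of_le (Polynomial.natDegree_natCast _).le hU).trans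
        (by omega)
    · exact (Polynomial.natDegree_mul_le_of_le (Polynomial.natDegree_natCast _).le
        ((Polynomial.natDegree_derivative_le _).trans ((Nat.sub_le _ _).trans hT))).trans (by omega)

lemma natDegree_det_le {r : ℕ} (M : Matrix (Fin r) (Fin r) Pol) {m : ℕ}
    (h : ∀ i j, (M i j).natDegree ≤ m) : M.det.natDegree ≤ r * m := by
  rw [Matrix.det_apply]
  refine Polynomial.natDegree_sum_le_of_forall_le _ _ fun σ _ => ?_
  refine (Polynomial.natDegree_smul_le _ _).trans ?_
  refine (Polynomial.natDegree_prod_le _ _).trans ?_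
  refine (Finset.sum_le_card_nsmul _ _ m fun i _ => h _ _).trans ?_
  simp

lemma X_pow_dvd_iterate_D {W : ℚ⟦X⟧} {n : ℕ} (h : ∀ k < n, coeff k W = 0) (l : ℕ) :
    ∀ k < n - l, coeff k (D^[l] W) = 0 := by
  induction l with
  | zero => simpa using h
  | succ l ih =>
    intro k hk
    rw [Function.iterate_succ_apply', D, coeff_derivative, ih _ (by omega), zero_mul]

/-- **Zero estimate**: a combination of the derivatives of `φ` vanishing to high order at the
origin satisfies a differential equation of order smaller than `r`. -/
lemma exists_smul_mem_of_coeff_eq_zero {U : Pol} {A : ℕ → Pol} {r κ m c o : ℕ} {φ : ℚ⟦X⟧}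
    (hr : 0 < r) (hU0 : U ≠ 0) (h : (sPol * U) • D^[r] φ = comb φ r A)
    (hT : (sPol * U).natDegree ≤ κ) (hU : U.natDegree ≤ κ)
    (hA : ∀ i < r, (A i).natDegree ≤ κ) (ho : coeff o φ ≠ 0) {Q : ℕ → Pol} {W : ℚ⟦X⟧}
    (hW : comb φ r Q = sPol ^ c • W) (hQ : ∀ i < r, (Q i).natDegree ≤ m) {n : ℕ}
    (hn : r + o + r * (m + κ * r) < n) (hWn : ∀ k < n, coeff k W = 0) :
    ∃ l < r, ∃ P : Pol, P ≠ 0 ∧ P • D^[l] W ∈ derivSpan W l := by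
  let R := derivCoords U A r c Q
  let M : Matrix (Fin r) (Fin r) Pol := Matrix.of fun l i => R l i
  have hs : sPol ≠ 0 := by
    intro h0
    simpa [sPol] using congrArg (Polynomial.eval 0) h0
  have hcomb : ∀ l : Fin r, ∑ i : Fin r, M l i • D^[i] φ =
      (sPol ^ c * (sPol * U) ^ (l : ℕ)) • D^[l] W := fun l => by
    rw [← comb_derivCoords hr h hW, comb, Finset.sum_range]
    rfl
  by_cases hdet : M.det = 0
  · obtain ⟨v, hv0, hv⟩ := Matrix.exists_vecMul_eq_zero_iff.2 hdet
    let v' : ℕ → Pol := fun l => if hl : l < r then v ⟨l, hl⟩ else 0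
    have hsum : ∑ l ∈ Finset.range r, (v' l * (sPol ^ c * (sPol * U) ^ l)) • D^[l] W = 0 := by
      rw [Finset.sum_range]
      have h1 : ∀ l : Fin r, (v' l * (sPol ^ c * (sPol * U) ^ (l : ℕ))) • D^[l] W =
          ∑ i : Fin r, (v l * M l i) • D^[i] φ := fun l => by
        rw [mul_smul, ← hcomb l, Finset.smul_sum]
        refine Finset.sum_congr rfl fun i _ => ?_
        rw [mul_smul, show v' l = v l from dif_pos l.2]
      rw [Finset.sum_congr rfl fun l _ => h1 l, Finset.sum_comm]
      refine Finset.sum_eq_zero fun i _ => ?_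
      rw [← Finset.sum_smul]
      have h2 : ∑ l, v l * M l i = 0 := congrFun hv i
      rw [h2, zero_smul]
    have hex : ∃ l, v' l ≠ 0 := by
      obtain ⟨l, hl⟩ := Function.ne_iff.1 hv0
      exact ⟨l, by simpa [v'] using hl⟩
    have hlt : ∀ l, v' l ≠ 0 → l < r := fun l hl => by
      by_contra hlr
      simp [v', hlr] at hl
    obtain ⟨l, hl, hmax⟩ : ∃ l, v' l ≠ 0 ∧ ∀ k, l < k → v' k = 0 := by
      classical
      obtain ⟨l0, hl0⟩ := hex
      refine ⟨Nat.findGreatest (fun l => v' l ≠ 0) r, Nat.findGreatest_spec (P := fun l => v' l ≠ 0) (hlt _ hl0).le hl0,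
        fun k hk => ?_⟩
      by_contra hk0
      exact Nat.findGreatest_is_greatest hk (hlt _ hk0).le hk0
    refine ⟨l, hlt l hl, v' l * (sPol ^ c * (sPol * U) ^ l),
      mul_ne_zero hl (mul_ne_zero (pow_ne_zero _ hs) (pow_ne_zero _ (mul_ne_zero hs hU0))), ?_⟩
    have h2 : ∑ k ∈ Finset.range (l + 1), (v' k * (sPol ^ c * (sPol * U) ^ k)) • D^[k] W = 0 := by
      rw [← hsum]
      refine Finset.sum_subset (Finset.range_subset_range.2 (hlt l hl)) fun k _ hk => ?_
      rw [hmax k (by simpa using hk)]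
      simp
    rw [Finset.sum_range_succ] at h2
    rw [eq_neg_of_add_eq_zero_right h2]
    exact neg_mem (comb_mem_derivSpan W l _)
  · exfalso
    have h1 : M.det • φ = ∑ l : Fin r, M.adjugate ⟨0, hr⟩ l •
        ((sPol ^ c * (sPol * U) ^ (l : ℕ)) • D^[l] W) := by
      have h0 : ∀ l : Fin r, M.adjugate ⟨0, hr⟩ l • ((sPol ^ c * (sPol * U) ^ (l : ℕ)) • D^[l] W) =
          ∑ i : Fin r, (M.adjugate ⟨0, hr⟩ l * M l i) • D^[i] φ := fun l => by
        rw [← hcomb l, Finset.smul_sum]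
        exact Finset.sum_congr rfl fun i _ => (mul_smul _ _ _).symm
      rw [Finset.sum_congr rfl fun l _ => h0 l, Finset.sum_comm]
      have h2 : ∀ i : Fin r, ∑ l, M.adjugate ⟨0, hr⟩ l * M l i =
          if (⟨0, hr⟩ : Fin r) = i then M.det else 0 := fun i => by
        rw [← Matrix.mul_apply, Matrix.adjugate_mul, Matrix.smul_apply, Matrix.one_apply]
        simp
      have h3 : ∀ i : Fin r, ∑ l, (M.adjugate ⟨0, hr⟩ l * M l i) • D^[i] φ =
          (if (⟨0, hr⟩ : Fin r) = i then M.det else 0) • D^[i] φ := fun i => by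
        rw [← Finset.sum_smul, h2 i]
      rw [Finset.sum_congr rfl fun i _ => h3 i, Finset.sum_eq_single ⟨0, hr⟩]
      · rw [if_pos rfl]
        rfl
      · intro i _ hi
        rw [if_neg hi.symm, zero_smul]
      · intro hi
        exact absurd (Finset.mem_univ _) hi
    have h3 : ∀ k < n - r, coeff k (M.det • φ) = 0 := by
      intro k hk
      have h4 : (X : ℚ⟦X⟧) ^ (n - r) ∣ M.det • φ := by
        rw [h1]
        refine Finset.dvd_sum fun l _ => ?_
        rw [smul_def, smul_def]
        refine Dvd.dvd.mul_left (Dvd.dvd.mul_left (X_pow_dvd_iff.2 fun k hk => ?_) _) _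
        exact X_pow_dvd_iterate_D hWn l k (by omega)
      exact X_pow_dvd_iff.1 h4 k hk
    have hord : (M.det • φ).order ≤ (r * (m + κ * r) + o : ℕ) := by
      rw [smul_def, order_mul, Nat.cast_add]
      refine add_le_add ?_ (order_le _ ho)
      refine (order_le M.det.natDegree ?_).trans ?_
      · rw [Polynomial.coeff_coe]
        exact Polynomial.leadingCoeff_ne_zero.2 hdet
      · exact_mod_cast natDegree_det_le M fun l i =>
          (natDegree_derivCoords_le hr hT hU hA hQ l i i.2).trans
            (Nat.add_le_add_left (Nat.mul_le_mul_left _ l.2.le) _)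
    have hne : M.det • φ ≠ 0 := by
      rw [smul_def]
      refine mul_ne_zero (by simpa using hdet) ?_
      rintro rfl
      simp at ho
    have h5 : ((n - r : ℕ) : ℕ∞) ≤ (M.det • φ).order := nat_le_order _ _ h3
    have h6 := h5.trans hord
    norm_cast at h6
    omega

/-- A small integer vector orthogonal to the integer vectors `F` but not to all of the `w j`. -/
lemma exists_small_orthogonal {n q Q E : ℕ} (hq : 0 < q) (hqn : q < n) (hQ : 1 ≤ Q)
    (hE : n ≤ E * q) (F : Set (Fin n → ℤ)) (hF : ∀ v ∈ F, ∀ i, |v i| ≤ Q)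
    (w : Fin q → Fin n → ℚ)
    (hw : ∀ α : Fin q → ℚ, ∑ j, α j • w j ∈
      Submodule.span ℚ ((fun (v : Fin n → ℤ) i => (v i : ℚ)) '' F) → α = 0) :
    ∃ p : Fin n → ℤ, (∀ i, |p i| ≤ ((n * Q) ^ E : ℕ)) ∧
      (∀ v ∈ F, ∑ i, p i * v i = 0) ∧ ∃ j, ∑ i, (p i : ℚ) * w j i ≠ 0 := by
  classical
  set cast : (Fin n → ℤ) → Fin n → ℚ := fun v i => (v i : ℚ) with hcast
  have hwi : LinearIndependent ℚ w := by
    rw [Fintype.linearIndependent_iff]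
    intro α hα
    exact congrFun (hw α (by rw [hα]; exact zero_mem _))
  obtain ⟨b0, hb0F, hb0s, hb0⟩ := exists_linearIndependent ℚ (cast '' F)
  have hun : LinearIndepOn ℚ id (b0 ∪ Set.range w) := by
    refine LinearIndepOn.id_union hb0 hwi.linearIndepOn_id ?_
    rw [hb0s, Submodule.disjoint_def]
    intro x hx hxw
    rw [Submodule.mem_span_range_iff_exists_fun] at hxw
    obtain ⟨α, rfl⟩ := hxw
    rw [hw α hx]
    simp
  obtain ⟨b, hbt, hsb, htb, hb⟩ := exists_linearIndepOn_id_extension hun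
    (Set.subset_union_left (t := Set.range fun i : Fin n => (Pi.single i 1 : Fin n → ℚ)))
  have hspan : Submodule.span ℚ b = ⊤ := by
    rw [eq_top_iff]
    intro x _
    rw [pi_eq_sum_univ' x]
    refine Submodule.sum_mem _ fun i _ => Submodule.smul_mem _ _ ?_
    have h1 : (Pi.single i 1 : Fin n → ℚ) ∈ Submodule.span ℚ b := htb (Or.inr ⟨i, rfl⟩)
    convert h1 using 1
  have hbfin : b.Finite := hb.setFinite
  have hcardb : b.ncard = n := by
    let B : Module.Basis b ℚ (Fin n → ℚ) := Module.Basis.mk (v := ((↑) : b → Fin n → ℚ)) hb (by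
      rw [Subtype.range_coe, hspan])
    have := Module.finrank_eq_nat_card_basis B
    rw [Module.finrank_fin_fun] at this
    exact this.symm
  have hcardw : (Set.range w).ncard = q := by
    rw [← Set.image_univ, Set.ncard_image_of_injective _ hwi.injective, Set.ncard_univ]
    simp
  set R := b \ Set.range w with hR
  have hRfin : R.Finite := hbfin.subset Set.sdiff_subset
  have hcardR : R.ncard = n - q := by
    rw [hR, Set.ncard_sdiff (Set.subset_union_right.trans hsb), hcardb, hcardw]
  have : Fintype R := hRfin.fintype
  let _ : SeminormedAddCommGroup (Matrix R (Fin n) ℤ) := Matrix.seminormedAddCommGroup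
  have hcard : Fintype.card R = n - q := by
    rw [← hcardR, Set.ncard_eq_toFinset_card' , Set.toFinset_card]
  have hint : ∀ v : R, ∃ u : Fin n → ℤ, cast u = v ∧ ∀ i, |u i| ≤ Q := by
    rintro ⟨v, hvb, hvw⟩
    rcases hbt hvb with (h | h) | ⟨i, rfl⟩
    · obtain ⟨u, hu, rfl⟩ := hb0F h
      exact ⟨u, rfl, hF u hu⟩
    · exact absurd h hvw
    · refine ⟨Pi.single i 1, ?_, fun k => ?_⟩
      · ext k
        by_cases h : k = i
        · subst h; simp [cast]
        · simp [cast, h]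
      · by_cases h : k = i
        · subst h; simpa using hQ
        · simp [h]
  choose u hu huQ using hint
  obtain ⟨p, hp0, hp, hpn⟩ := Int.Matrix.exists_ne_zero_int_vec_norm_le (Matrix.of u)
    (by rw [hcard, Fintype.card_fin]; omega) (by rw [hcard]; omega)
  have hortho : ∀ v : R, ∑ i, (p i : ℚ) * v.1 i = 0 := fun v => by
    have := congrFun hp v
    rw [Matrix.mulVec, dotProduct] at this
    rw [← hu v]
    have h2 : ((∑ i, u v i * p i : ℤ) : ℚ) = 0 := by exact_mod_cast this
    rw [← h2]
    push_cast
    exact Finset.sum_congr rfl fun i _ => mul_comm _ _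
  let Λ : (Fin n → ℚ) →ₗ[ℚ] ℚ := ∑ i, (p i : ℚ) • LinearMap.proj i
  have hΛ : ∀ x, Λ x = ∑ i, (p i : ℚ) * x i := fun x => by simp [Λ]
  have hex : ∃ j, ∑ i, (p i : ℚ) * w j i ≠ 0 := by
    by_contra! hcon
    have hker : Submodule.span ℚ b ≤ LinearMap.ker Λ := by
      rw [Submodule.span_le]
      intro v hv
      rw [SetLike.mem_coe, LinearMap.mem_ker, hΛ]
      by_cases h : v ∈ Set.range w
      · obtain ⟨j, rfl⟩ := h
        exact hcon j
      · exact hortho ⟨v, hv, h⟩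
    refine hp0 (funext fun i => ?_)
    have : (Pi.single i 1 : Fin n → ℚ) ∈ LinearMap.ker Λ := hker (by rw [hspan]; trivial)
    rw [LinearMap.mem_ker, hΛ] at this
    simpa [Pi.single_apply] using this
  refine ⟨p, fun i => ?_, fun v hv => ?_, hex⟩
  · have hA : max 1 ‖Matrix.of u‖ ≤ Q := by
      refine max_le (by exact_mod_cast hQ) ((Matrix.norm_le_iff (by positivity)).2 fun v k => ?_)
      rw [Int.norm_eq_abs]
      exact_mod_cast huQ v k
    have hnR : (1 : ℝ) ≤ n := by exact_mod_cast (by omega : 1 ≤ n)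
    have h1 : ‖p‖ ≤ (n * Q : ℝ) ^ E := by
      refine hpn.trans ?_
      rw [hcard, Fintype.card_fin]
      refine (Real.rpow_le_rpow (by positivity) (mul_le_mul_of_nonneg_left hA (by positivity))
        ?_).trans ?_
      · push_cast [hqn.le]
        apply div_nonneg
        · rw [sub_nonneg]; exact_mod_cast hqn.le
        · simp
      rw [← Real.rpow_natCast]
      refine Real.rpow_le_rpow_of_exponent_le ?_ ?_
      · have : (1 : ℝ) ≤ Q := by exact_mod_cast hQ
        nlinarith
      · push_cast [hqn.le]
        rw [sub_sub_cancel, div_le_iff₀ (by exact_mod_cast hq)]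
        have : (n : ℝ) ≤ E * q := by exact_mod_cast hE
        have : (0 : ℝ) ≤ q := by positivity
        linarith
    have h2 := (norm_le_pi_norm p i).trans h1
    rw [Int.norm_eq_abs] at h2
    exact_mod_cast h2
  · have hker : Submodule.span ℚ (cast '' F) ≤ LinearMap.ker Λ := by
      rw [← hb0s, Submodule.span_le]
      intro x hx
      rw [SetLike.mem_coe, LinearMap.mem_ker, hΛ]
      refine hortho ⟨x, hsb (Or.inl hx), ?_⟩
      rintro ⟨j, rfl⟩
      have h3 := hw (Pi.single j 1) (by
        rw [Finset.sum_eq_single j]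
        · simpa using Submodule.subset_span (hb0F hx)
        · intro k _ hk; simp [hk]
        · simp)
      simpa using congrFun h3 j
    have h4 := hker (Submodule.subset_span ⟨v, hv, rfl⟩)
    rw [LinearMap.mem_ker, hΛ] at h4
    simp only [cast] at h4
    exact_mod_cast h4

lemma expCoeff_X_pow_mul (n k : ℕ) (h : ℚ⟦X⟧) :
    expCoeff n (X ^ k * h) = n.descFactorial k * expCoeff (n - k) h := by
  rw [expCoeff, expCoeff, coeff_X_pow_mul']
  split_ifs with hk
  · rw [← mul_assoc, ← Nat.factorial_mul_descFactorial hk]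
    push_cast
    ring
  · rw [Nat.descFactorial_of_lt (by omega)]
    simp

/-- The linear functional `h ↦ ∑_{n < N} p n * expCoeff n h`. -/
def pair {N : ℕ} (p : Fin N → ℤ) : ℚ⟦X⟧ →ₗ[ℚ] ℚ where
  toFun h := ∑ n : Fin N, p n * expCoeff n h
  map_add' f g := by
    simp only [expCoeff_add, mul_add, Finset.sum_add_distrib]
  map_smul' c f := by
    rw [RingHom.id_apply, smul_eq_mul, Finset.mul_sum]
    refine Finset.sum_congr rfl fun n _ => ?_
    simp only [expCoeff, coeff_smul, smul_eq_mul]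
    ring

lemma pair_apply {N : ℕ} (p : Fin N → ℤ) (h : ℚ⟦X⟧) :
    pair p h = ∑ n : Fin N, p n * expCoeff n h := rfl

/-- Polynomials with integer coefficients. -/
def intPol : Subring Pol := (Polynomial.mapRingHom (Int.castRingHom ℚ)).range

lemma derivative_mem_intPol {p : Pol} (h : p ∈ intPol) : Polynomial.derivative p ∈ intPol := by
  obtain ⟨q, rfl⟩ := h
  exact ⟨Polynomial.derivative q, by simp [Polynomial.derivative_map]⟩

lemma sPol_mem_intPol : sPol ∈ intPol :=
  sub_mem (one_mem _) ⟨Polynomial.X, by simp⟩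

lemma derivCoords_mem_intPol {U : Pol} {A : ℕ → Pol} (hU : U ∈ intPol) (hA : ∀ i, A i ∈ intPol)
    (r c : ℕ) {Q : ℕ → Pol} (hQ : ∀ i, Q i ∈ intPol) (l i : ℕ) :
    derivCoords U A r c Q l i ∈ intPol := by
  have hT : sPol * U ∈ intPol := mul_mem sPol_mem_intPol hU
  induction l generalizing i with
  | zero => exact hQ i
  | succ l ih =>
    rw [derivCoords, Pi.add_apply, Pi.smul_apply, smul_eq_mul, nabla]
    refine add_mem (add_mem (add_mem (mul_mem hT (derivative_mem_intPol (ih _))) ?_)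
      (mul_mem (hA _) (ih _))) (mul_mem (sub_mem (mul_mem (natCast_mem _ _) hU)
      (mul_mem (natCast_mem _ _) (derivative_mem_intPol hT))) (ih _))
    split_ifs
    · exact zero_mem _
    · exact mul_mem hT (ih _)

/-- All `d * pair p (X ^ l * g)` are integer multiples of `b`. -/
def PairDvd {N : ℕ} (p : Fin N → ℤ) (d b : ℕ) (g : ℚ⟦X⟧) : Prop :=
  ∀ l : ℕ, ∃ z : ℤ, (d : ℚ) * pair p (X ^ l * g) = b * z

section PairDvd

variable {N : ℕ} {p : Fin N → ℤ} {d b : ℕ}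

lemma PairDvd.zero : PairDvd p d b 0 := fun _ => ⟨0, by simp⟩

lemma PairDvd.add {f g : ℚ⟦X⟧} (hf : PairDvd p d b f) (hg : PairDvd p d b g) :
    PairDvd p d b (f + g) := fun l => by
  obtain ⟨y, hy⟩ := hf l
  obtain ⟨z, hz⟩ := hg l
  refine ⟨y + z, ?_⟩
  rw [mul_add, map_add, mul_add, hy, hz]
  push_cast
  ring

lemma PairDvd.sum {ι : Type*} {s : Finset ι} {f : ι → ℚ⟦X⟧} (hf : ∀ i ∈ s, PairDvd p d b (f i)) :
    PairDvd p d b (∑ i ∈ s, f i) :=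
  Finset.sum_induction _ _ (fun _ _ => PairDvd.add) PairDvd.zero hf

lemma PairDvd.smul {f : ℚ⟦X⟧} (hf : PairDvd p d b f) {P : Pol} (hP : P ∈ intPol) :
    PairDvd p d b (P • f) := by
  obtain ⟨q, rfl⟩ := hP
  induction q using Polynomial.induction_on' with
  | add q q' hq hq' => rw [map_add, add_smul]; exact hq.add hq'
  | monomial n a =>
    intro l
    obtain ⟨z, hz⟩ := hf (l + n)
    refine ⟨a * z, ?_⟩
    have : (X : ℚ⟦X⟧) ^ l * ((Polynomial.mapRingHom (Int.castRingHom ℚ))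
        (Polynomial.monomial n a) • f) = (a : ℚ) • (X ^ (l + n) * f) := by
      rw [smul_def, Polynomial.coe_mapRingHom, Polynomial.map_monomial,
        ← Polynomial.C_mul_X_pow_eq_monomial, smul_eq_C_mul]
      push_cast
      simp only [eq_intCast]
      ring
    rw [this, map_smul, smul_eq_mul, mul_left_comm, hz]
    push_cast
    ring

lemma pair_X_pow_mul_eq_zero {l : ℕ} (hl : N ≤ l) (f : ℚ⟦X⟧) : pair p (X ^ l * f) = 0 := by
  rw [pair_apply]
  refine Finset.sum_eq_zero fun n _ => ?_
  rw [expCoeff_X_pow_mul, Nat.descFactorial_of_lt (by omega)]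
  simp

lemma PairDvd.of_sPol_smul {f : ℚ⟦X⟧} (hf : PairDvd p d b (sPol • f)) : PairDvd p d b f := by
  have key : ∀ k l, N ≤ l + k → ∃ z : ℤ, (d : ℚ) * pair p (X ^ l * f) = b * z := by
    intro k
    induction k with
    | zero => intro l hl; exact ⟨0, by rw [pair_X_pow_mul_eq_zero (by simpa using hl)]; simp⟩
    | succ k ih =>
      intro l hl
      obtain ⟨y, hy⟩ := ih (l + 1) (by omega)
      obtain ⟨z, hz⟩ := hf l
      refine ⟨z + y, ?_⟩
      have : X ^ l * f = X ^ l * (sPol • f) + X ^ (l + 1) * f := by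
        rw [smul_def, sPol]
        push_cast
        ring
      rw [this, map_add, mul_add, hy, hz]
      push_cast
      ring
  intro l
  exact key N l (by omega)

lemma PairDvd.of_sPol_pow_smul {f : ℚ⟦X⟧} (k : ℕ) (hf : PairDvd p d b (sPol ^ k • f)) :
    PairDvd p d b f := by
  induction k with
  | zero => simpa using hf
  | succ k ih => exact ih (PairDvd.of_sPol_smul (by rwa [← mul_smul, ← pow_succ']))

lemma pairDvd_iterate_D {φ : ℚ⟦X⟧} {m i K : ℕ} (hK : N + i ≤ K)
    (hd : ∀ k ≤ K, ∃ z : ℤ, (d : ℚ) * expCoeff k φ = z)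
    (h0 : ∀ k < m, pair p (X ^ k * D^[i] φ) = 0) : PairDvd p d m.factorial (D^[i] φ) := by
  intro l
  rcases lt_or_ge l m with hl | hl
  · exact ⟨0, by rw [h0 l hl]; simp⟩
  · obtain ⟨e, he⟩ := Nat.factorial_dvd_factorial hl
    have h1 : ∀ n : Fin N, ∃ z : ℤ, (d : ℚ) * expCoeff ((n : ℕ) - l + i) φ = z :=
      fun n => hd _ (by omega)
    choose z hz using h1
    refine ⟨∑ n : Fin N, p n * (e * ((n : ℕ).choose l) * z n), ?_⟩
    rw [pair_apply, Finset.mul_sum]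
    push_cast
    rw [Finset.mul_sum]
    refine Finset.sum_congr rfl fun n _ => ?_
    rw [expCoeff_X_pow_mul, expCoeff_iterate_D, ← hz n, Nat.descFactorial_eq_factorial_mul_choose,
      he]
    push_cast
    ring

lemma abs_pair_le {φ : ℚ⟦X⟧} {C H : ℕ} (hC : 1 ≤ C) (hφ : EBound C φ) (hp : ∀ n, |p n| ≤ H)
    (k j : ℕ) : |pair p (X ^ k * D^[j] φ)| ≤
      (N * (H * (k.factorial * 2 ^ N * C ^ (N + j + 1))) : ℕ) := by
  rw [pair_apply]
  refine (Finset.abs_sum_le_sum_abs _ _).trans ?_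
  refine (Finset.sum_le_card_nsmul _ _ ((H * (k.factorial * 2 ^ N * C ^ (N + j + 1)) : ℕ) : ℚ)
    fun n _ => ?_).trans (by simp)
  rw [abs_mul, expCoeff_X_pow_mul, expCoeff_iterate_D, abs_mul, Nat.abs_cast,
    Nat.descFactorial_eq_factorial_mul_choose]
  push_cast
  have h1 : |(p n : ℚ)| ≤ H := by exact_mod_cast hp n
  have h2 : |expCoeff ((n : ℕ) - k + j) φ| ≤ (C : ℚ) ^ (N + j + 1) := by
    refine (hφ _).1.trans (pow_le_pow_right₀ (by exact_mod_cast hC) (by omega))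
  have h3 : (((n : ℕ).choose k : ℕ) : ℚ) ≤ 2 ^ N := by
    have := (Nat.choose_le_two_pow n k).trans (Nat.pow_le_pow_right two_pos n.2.le)
    exact_mod_cast this
  gcongr

end PairDvd

lemma abs_map_smul_le (Λ : ℚ⟦X⟧ →ₗ[ℚ] ℚ) {T : Pol} {τ t : ℕ} (hτ : T.natDegree ≤ τ)
    (ht : ∑ i ∈ Finset.range (τ + 1), |T.coeff i| ≤ t) {g : ℚ⟦X⟧} {B : ℚ} {K : ℕ}
    (h : ∀ k ≤ K + τ, |Λ (X ^ k * g)| ≤ B) : ∀ k ≤ K, |Λ (X ^ k * (T • g))| ≤ t * B := by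
  intro k hk
  have h1 : X ^ k * (T • g) = ∑ i ∈ Finset.range (τ + 1), T.coeff i • (X ^ (k + i) * g) := by
    conv_lhs => rw [smul_def, T.as_sum_range_C_mul_X_pow' (n := τ + 1) (by omega)]
    rw [← Polynomial.coeToPowerSeries.ringHom_apply, map_sum, Finset.sum_mul, Finset.mul_sum]
    refine Finset.sum_congr rfl fun i _ => ?_
    rw [Polynomial.coeToPowerSeries.ringHom_apply, smul_eq_C_mul]
    push_cast
    ring
  have hB : 0 ≤ B := (abs_nonneg _).trans (h 0 (by omega))
  rw [h1, map_sum]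
  refine (Finset.abs_sum_le_sum_abs _ _).trans ?_
  refine le_trans ?_ (mul_le_mul_of_nonneg_right ht hB)
  rw [Finset.sum_mul]
  refine Finset.sum_le_sum fun i hi => ?_
  rw [map_smul, smul_eq_mul, abs_mul]
  exact mul_le_mul_of_nonneg_left (h _ (by have := Finset.mem_range.1 hi; omega)) (abs_nonneg _)

lemma abs_map_pow_smul_le (Λ : ℚ⟦X⟧ →ₗ[ℚ] ℚ) {T : Pol} {τ t : ℕ} (hτ : T.natDegree ≤ τ)
    (ht : ∑ i ∈ Finset.range (τ + 1), |T.coeff i| ≤ t) (j : ℕ) {g : ℚ⟦X⟧} {B : ℚ} {K : ℕ}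
    (h : ∀ k ≤ K + τ * j, |Λ (X ^ k * g)| ≤ B) :
    ∀ k ≤ K, |Λ (X ^ k * (T ^ j • g))| ≤ t ^ j * B := by
  induction j generalizing g B with
  | zero => simpa using h
  | succ j ih =>
    intro k hk
    have h1 := ih (g := T • g) (B := t * B) (abs_map_smul_le Λ hτ ht
      (by intro k hk; exact h k (by rw [Nat.mul_succ]; omega))) k hk
    rw [pow_succ, mul_smul, pow_succ, mul_assoc]
    exact h1

end EFun

namespace EFun

open PowerSeries

lemma exists_pow_lt_factorial (L J0 : ℕ) : ∃ J, J0 ≤ J ∧ L ^ J < J.factorial := by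
  have h := FloorSemiring.tendsto_pow_div_factorial_atTop (L : ℝ)
  obtain ⟨J, hJ, hJ0⟩ := ((h.eventually (gt_mem_nhds one_pos)).and
    (Filter.eventually_ge_atTop J0)).exists
  refine ⟨J, hJ0, ?_⟩
  rw [div_lt_one (by positivity)] at hJ
  exact_mod_cast hJ

lemma parameter_bound {A C t N J H Q b : ℕ} (hC : 1 ≤ C) (hN : N = A * J) (hJ : 1 ≤ J)
    (hQ : Q = 2 ^ N * (C ^ (N + J + 1) * C ^ (N + J + 1))) (hH : H = (N * Q) ^ (2 * A))
    (hb : J.factorial * b ≤ C ^ (N + J + 1) * (t ^ J * (N * (H * (b * 2 ^ N * C ^ (N + J + 1))))))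
    (hb0 : 0 < b) :
    J.factorial ≤ (C ^ (2 * (A + 2)) * t * 2 ^ (2 * A) *
      (2 ^ (2 * A) * C ^ (2 * (A + 2))) ^ (2 * A)) ^ J := by
  have h1 : C ^ (N + J + 1) ≤ C ^ ((A + 2) * J) := by
    refine Nat.pow_le_pow_right hC ?_
    rw [hN, add_mul]
    omega
  have h2 : N ≤ 2 ^ (A * J) := hN ▸ Nat.lt_two_pow_self.le
  have h3 : J.factorial ≤ C ^ (N + J + 1) * (t ^ J * (N * (H * (2 ^ N * C ^ (N + J + 1))))) := by
    refine Nat.le_of_mul_le_mul_right (hb.trans_eq ?_) hb0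
    ring
  refine h3.trans ?_
  have h4 : N * Q ≤ (2 ^ (2 * A) * C ^ (2 * (A + 2))) ^ J := by
    rw [hQ]
    calc N * (2 ^ N * (C ^ (N + J + 1) * C ^ (N + J + 1)))
        ≤ 2 ^ (A * J) * (2 ^ (A * J) * (C ^ ((A + 2) * J) * C ^ ((A + 2) * J))) := by
          subst hN; gcongr
      _ = _ := by ring
  have h5 : H ≤ ((2 ^ (2 * A) * C ^ (2 * (A + 2))) ^ J) ^ (2 * A) := by
    rw [hH]; exact Nat.pow_le_pow_left h4 _
  calc C ^ (N + J + 1) * (t ^ J * (N * (H * (2 ^ N * C ^ (N + J + 1)))))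
      ≤ C ^ ((A + 2) * J) * (t ^ J * (2 ^ (A * J) *
        (((2 ^ (2 * A) * C ^ (2 * (A + 2))) ^ J) ^ (2 * A) *
          (2 ^ (A * J) * C ^ ((A + 2) * J))))) := by
        subst hN; gcongr
    _ = _ := by ring

lemma natDegree_sPol_pow_le (k : ℕ) : (sPol ^ k).natDegree ≤ k := by
  have h1 : sPol.natDegree ≤ 1 :=
    (Polynomial.natDegree_sub_le_of_le (m := 0) (n := 1) (by simp) (by simp)).trans (by simp)
  exact Polynomial.natDegree_pow_le.trans (by nlinarith)

/-- The vector `(expCoeff n h)_{n < N}`. -/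
def truncVec (N : ℕ) : ℚ⟦X⟧ →ₗ[ℚ] (Fin N → ℚ) where
  toFun h := fun n => expCoeff n h
  map_add' f g := funext fun n => expCoeff_add _ _ _
  map_smul' c f := funext fun n => by
    simp only [expCoeff, coeff_smul, smul_eq_mul, RingHom.id_apply, Pi.smul_apply]
    ring

lemma coeff_eq_zero_of_truncVec {N : ℕ} {h : ℚ⟦X⟧} (h0 : truncVec N h = 0) :
    ∀ k < N, coeff k h = 0 := fun k hk => by
  have := congrFun h0 ⟨k, hk⟩
  simp only [truncVec, LinearMap.coe_mk, AddHom.coe_mk, expCoeff, Pi.zero_apply, mul_eq_zero,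
    Nat.cast_eq_zero] at this
  exact this.resolve_left (Nat.factorial_ne_zero k)

lemma exists_comb_of_mem_span {N m r : ℕ} {φ : ℚ⟦X⟧} {S : Set (Fin N → ℚ)}
    (hS : ∀ x ∈ S, ∃ k < m, ∃ i < r, ∃ c : ℚ, x = c • truncVec N (X ^ k * D^[i] φ))
    {x : Fin N → ℚ} (hx : x ∈ Submodule.span ℚ S) :
    ∃ c : ℕ → Pol, (∀ i, (c i).natDegree ≤ m) ∧ x = truncVec N (comb φ r c) := by
  induction hx using Submodule.span_induction with
  | mem x hx =>
    obtain ⟨k, hk, i, hi, c, rfl⟩ := hS x hx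
    refine ⟨Pi.single i (Polynomial.C c * Polynomial.X ^ k), fun l => ?_, ?_⟩
    · by_cases h : l = i
      · subst h
        rw [Pi.single_eq_same]
        exact (Polynomial.natDegree_C_mul_X_pow_le _ _).trans hk.le
      · simp [h]
    · rw [comb, Finset.sum_eq_single i]
      · rw [Pi.single_eq_same, ← map_smul, smul_def, smul_eq_C_mul]
        push_cast
        rw [mul_assoc]
      · intro j _ hj; simp [hj]
      · intro h; exact absurd (Finset.mem_range.2 hi) h
  | zero => exact ⟨0, by simp, by simp [comb]⟩
  | add x y _ _ hx hy =>
    obtain ⟨P, hP, rfl⟩ := hx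
    obtain ⟨Q, hQ, rfl⟩ := hy
    exact ⟨P + Q, fun i => Polynomial.natDegree_add_le_of_degree_le (hP i) (hQ i),
      by rw [comb_add, map_add]⟩
  | smul q x _ hx =>
    obtain ⟨P, hP, rfl⟩ := hx
    refine ⟨Polynomial.C q • P, fun i => ?_, ?_⟩
    · rw [Pi.smul_apply, smul_eq_mul]
      exact (Polynomial.natDegree_C_mul_le _ _).trans (hP i)
    · rw [comb_smul, ← map_smul, smul_def, smul_eq_C_mul, Polynomial.coe_C]


/-- **Construction of exceptional combinations** by the Thue–Siegel method. -/
lemma exists_comb_of_lower_order {U T₃ : Pol} {A : ℕ → Pol} {r a : ℕ} {φ : ℚ⟦X⟧} (hr : 0 < r)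
    (hφ : φ ∈ eSeries) (hφ0 : φ ≠ 0) (hU0 : U ≠ 0) (h : (sPol * U) • D^[r] φ = comb φ r A)
    (hU : U ∈ intPol) (hA : ∀ i, A i ∈ intPol) (hT : sPol * U = sPol ^ a * T₃)
    (j₁ : ℕ) (hj₁ : r ≤ j₁) :
    ∃ (J : ℕ) (α : ℕ → ℚ) (c : ℕ → Pol), (∃ j ∈ Finset.Ioc j₁ J, α j ≠ 0) ∧
      ∃ l < r, ∃ P : Pol, P ≠ 0 ∧
        P • D^[l] (∑ j ∈ Finset.Ioc j₁ J, α j • (T₃ ^ j • D^[j] φ) + comb φ r c) ∈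
          derivSpan (∑ j ∈ Finset.Ioc j₁ J, α j • (T₃ ^ j • D^[j] φ) + comb φ r c) l := by
  by_contra! hcon
  obtain ⟨C0, hC0⟩ := hφ
  obtain ⟨C, hC, hφ⟩ : ∃ C, 1 ≤ C ∧ EBound C φ := ⟨C0 + 1, by omega, hC0.mono (by omega)⟩
  obtain ⟨o, ho⟩ : ∃ o, coeff o φ ≠ 0 := by
    by_contra! h0
    exact hφ0 (PowerSeries.ext (by simpa using h0))
  obtain ⟨κ, hκT, hκU, hκA⟩ : ∃ κ, (sPol * U).natDegree ≤ κ ∧ U.natDegree ≤ κ ∧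
      ∀ i < r, (A i).natDegree ≤ κ := by
    refine ⟨(sPol * U).natDegree + U.natDegree + ∑ i ∈ Finset.range r, (A i).natDegree,
      by omega, by omega, fun i hi => ?_⟩
    have := Finset.single_le_sum (f := fun i => (A i).natDegree) (fun _ _ => Nat.zero_le _)
      (Finset.mem_range.2 hi)
    omega
  set τ := T₃.natDegree with hτ
  obtain ⟨t, ht⟩ := exists_nat_ge (∑ i ∈ Finset.range (τ + 1), |T₃.coeff i|)
  obtain ⟨B, hB⟩ : ∃ B, B = τ + 1 := ⟨_, rfl⟩
  obtain ⟨A', hA'⟩ : ∃ A', A' = r + o + r * (a + κ + B + κ * r) + 1 := ⟨_, rfl⟩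
  obtain ⟨J, hJ0, hJ⟩ := exists_pow_lt_factorial ((C ^ (2 * (A' + 2)) * (t + 1) * 2 ^ (2 * A') *
      (2 ^ (2 * A') * C ^ (2 * (A' + 2))) ^ (2 * A'))) (2 * j₁ + 1)
  refine absurd hJ (not_lt.2 ?_)
  have hJ1 : 1 ≤ J := by omega
  obtain ⟨N, hN⟩ : ∃ N, N = A' * J := ⟨_, rfl⟩
  obtain ⟨m, hm⟩ : ∃ m, m = B * J := ⟨_, rfl⟩
  obtain ⟨q, hq⟩ : ∃ q, q = J - j₁ := ⟨_, rfl⟩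
  have hq0 : 0 < q := by omega
  have hA2 : 2 ≤ A' := by
    rw [hA']
    omega
  have hqN : q < N := by
    have : 2 * J ≤ N := hN ▸ Nat.mul_le_mul_right J hA2
    omega
  have hNq : N ≤ 2 * A' * q := by
    rw [hN, mul_comm 2, mul_assoc]
    exact Nat.mul_le_mul_left _ (by omega)
  -- the denominator and the integer vectors
  obtain ⟨d, hd0, hdC, hd⟩ := (hφ (N + J)).2
  choose! e he using hd
  let F : Set (Fin N → ℤ) := {v | ∃ k < m, ∃ i < r, v = fun n : Fin N =>
    ((n : ℕ).choose k : ℤ) * e ((n : ℕ) - k + i)}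
  have hFv : ∀ k < m, ∀ i < r, (fun n : Fin N => ((((n : ℕ).choose k : ℤ) *
      e ((n : ℕ) - k + i) : ℤ) : ℚ)) =
      ((d : ℚ) / k.factorial) • truncVec N (X ^ k * D^[i] φ) := by
    intro k hk i hi
    funext n
    have hk0 : (k.factorial : ℚ) ≠ 0 := by exact_mod_cast Nat.factorial_ne_zero k
    simp only [truncVec, LinearMap.coe_mk, AddHom.coe_mk, Pi.smul_apply, smul_eq_mul]
    rw [expCoeff_X_pow_mul, expCoeff_iterate_D, Nat.descFactorial_eq_factorial_mul_choose]
    push_cast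
    rw [← he _ (by omega)]
    field_simp
  have hFQ : ∀ v ∈ F, ∀ n, |v n| ≤ ((2 ^ N * (C ^ (N + J + 1) * C ^ (N + J + 1)) : ℕ) : ℤ) := by
    rintro v ⟨k, hk, i, hi, rfl⟩ n
    have h1 : |((e ((n : ℕ) - k + i) : ℤ) : ℚ)| ≤ (C : ℚ) ^ (N + J + 1) * C ^ (N + J + 1) := by
      rw [← he _ (by omega), abs_mul, Nat.abs_cast]
      refine mul_le_mul ?_ ?_ (abs_nonneg _) (by positivity)
      · exact_mod_cast hdC
      · exact (hφ _).1.trans (pow_le_pow_right₀ (by exact_mod_cast hC) (by omega))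
    have h2 : |(e ((n : ℕ) - k + i) : ℤ)| ≤ (C : ℤ) ^ (N + J + 1) * C ^ (N + J + 1) := by
      exact_mod_cast h1
    have h3 : (((n : ℕ).choose k : ℕ) : ℤ) ≤ 2 ^ N := by
      have := (Nat.choose_le_two_pow n k).trans (Nat.pow_le_pow_right two_pos n.2.le)
      exact_mod_cast this
    rw [abs_mul, Nat.abs_cast]
    push_cast
    gcongr
  let G : ℕ → ℕ → Pol := derivCoords U A r 0 (Pi.single 0 1)
  have hsing : comb φ r (Pi.single 0 1) = φ := by
    rw [comb, Finset.sum_eq_single 0]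
    · simp
    · intro j _ hj; simp [hj]
    · intro h; exact absurd (Finset.mem_range.2 hr) h
  have hG : ∀ j, comb φ r (G j) = sPol ^ (a * j) • (T₃ ^ j • D^[j] φ) := fun j => by
    rw [comb_derivCoords hr h (W := φ) (by simpa using hsing), hT, pow_zero, one_mul, mul_pow,
      ← pow_mul, mul_smul]
  have hGdeg : ∀ j, ∀ i < r, (G j i).natDegree ≤ κ * j := fun j i hi => by
    refine (natDegree_derivCoords_le hr hκT hκU hκA (m := 0) (fun i hi => ?_) j i hi).trans
      (by omega)
    by_cases h0 : i = 0
    · subst h0; simp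
    · simp [h0]
  have hGint : ∀ j i, G j i ∈ intPol := fun j i => derivCoords_mem_intPol hU hA r 0 (fun i => by
    by_cases h0 : i = 0
    · subst h0; simp [one_mem]
    · simp [h0, zero_mem]) j i
  let w : Fin q → Fin N → ℚ := fun j =>
    truncVec N (T₃ ^ (j₁ + 1 + j) • D^[j₁ + 1 + (j : ℕ)] φ)
  have hFspan : ∀ x ∈ ((fun (v : Fin N → ℤ) i => (v i : ℚ)) '' F),
      ∃ k < m, ∃ i < r, ∃ c : ℚ, x = c • truncVec N (X ^ k * D^[i] φ) := by
    rintro _ ⟨v, ⟨k, hk, i, hi, rfl⟩, rfl⟩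
    exact ⟨k, hk, i, hi, _, hFv k hk i hi⟩
  have hw : ∀ α : Fin q → ℚ, ∑ j, α j • w j ∈
      Submodule.span ℚ ((fun (v : Fin N → ℤ) i => (v i : ℚ)) '' F) → α = 0 := by
    intro α hα
    by_contra hα0
    obtain ⟨c, hcdeg, hc⟩ := exists_comb_of_mem_span hFspan hα
    let α' : ℕ → ℚ := fun j => if hj : j - (j₁ + 1) < q then α ⟨j - (j₁ + 1), hj⟩ else 0
    have hα' : ∀ j : Fin q, α' (j₁ + 1 + j) = α j := fun j => by
      simp [α']
    have hIoc : Finset.Ioc j₁ J = (Finset.range q).map (addLeftEmbedding (j₁ + 1)) := by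
      rw [Finset.range_eq_Ico, Finset.map_add_left_Ico]
      ext x
      simp only [Finset.mem_Ioc, Finset.mem_Ico]
      omega
    have hsumW : truncVec N (∑ j ∈ Finset.Ioc j₁ J, α' j • (T₃ ^ j • D^[j] φ)) =
        ∑ j, α j • w j := by
      rw [hIoc, Finset.sum_map, map_sum, Finset.sum_range]
      refine Finset.sum_congr rfl fun j _ => ?_
      rw [addLeftEmbedding_apply, map_smul, hα']
    obtain ⟨j₀, hj₀⟩ := Function.ne_iff.1 hα0
    set W := ∑ j ∈ Finset.Ioc j₁ J, α' j • (T₃ ^ j • D^[j] φ) + comb φ r (-c) with hWdef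
    have hneg : comb φ r (-c) = - comb φ r c := by
      simp [comb]
    have htr : truncVec N W = 0 := by
      rw [hWdef, map_add, hsumW, hc, hneg, map_neg, add_neg_cancel]
    obtain ⟨Q, hQ⟩ : ∃ Q : ℕ → Pol, Q = ∑ j ∈ Finset.Ioc j₁ J,
        (Polynomial.C (α' j) * sPol ^ (a * (J - j))) • G j + sPol ^ (a * J) • (-c) := ⟨_, rfl⟩
    have hQW : comb φ r Q = sPol ^ (a * J) • W := by
      rw [hQ, comb_add, comb_sum, comb_smul, hWdef, smul_add, Finset.smul_sum]
      congr 1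
      refine Finset.sum_congr rfl fun j hj => ?_
      rw [comb_smul, hG, ← mul_smul, mul_assoc, ← pow_add, ← mul_add,
        Nat.sub_add_cancel (Finset.mem_Ioc.1 hj).2, mul_smul, smul_comm (sPol ^ (a * J)) (α' j)]
      rw [smul_def, smul_eq_C_mul, Polynomial.coe_C]
    have hQdeg : ∀ i < r, (Q i).natDegree ≤ (a + κ + B) * J := by
      intro i hi
      rw [hQ, Pi.add_apply]
      refine Polynomial.natDegree_add_le_of_degree_le ?_ ?_
      · rw [Finset.sum_apply]
        refine Polynomial.natDegree_sum_le_of_forall_le _ _ fun j hj => ?_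
        have hjJ := (Finset.mem_Ioc.1 hj).2
        rw [Pi.smul_apply, smul_eq_mul]
        refine (Polynomial.natDegree_mul_le_of_le (m := a * J) (n := κ * J) ?_
          ((hGdeg j i hi).trans (Nat.mul_le_mul_left _ hjJ))).trans ?_
        · exact (Polynomial.natDegree_C_mul_le _ _).trans ((natDegree_sPol_pow_le _).trans
            (Nat.mul_le_mul_left _ (Nat.sub_le _ _)))
        · rw [add_mul, add_mul]; omega
      · rw [Pi.smul_apply, smul_eq_mul]
        refine (Polynomial.natDegree_mul_le_of_le (m := a * J) (n := B * J)
          (natDegree_sPol_pow_le _) ?_).trans ?_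
        · rw [Pi.neg_apply, Polynomial.natDegree_neg, ← hm]; exact hcdeg i
        · rw [add_mul, add_mul]; omega
    obtain ⟨l, hl, P, hP0, hP⟩ := exists_smul_mem_of_coeff_eq_zero hr hU0 h hκT hκU hκA ho hQW
      hQdeg (n := N) (by
        rw [hN, hA']
        have h1 : r + o ≤ (r + o) * J := Nat.le_mul_of_pos_right _ hJ1
        have h2 : κ * r ≤ κ * r * J := Nat.le_mul_of_pos_right _ hJ1
        calc r + o + r * ((a + κ + B) * J + κ * r)
            ≤ (r + o) * J + r * ((a + κ + B) * J + κ * r * J) := by gcongr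
          _ < (r + o) * J + r * ((a + κ + B) * J + κ * r * J) + J := by omega
          _ = _ := by ring) (coeff_eq_zero_of_truncVec htr)
    refine hcon J α' (-c) ⟨j₁ + 1 + j₀, ?_, ?_⟩ l hl P hP0 hP
    · rw [Finset.mem_Ioc]; have := j₀.2; omega
    · rw [hα']; exact hj₀
  obtain ⟨p, hpH, hpF, j, hj⟩ := exists_small_orthogonal hq0 hqN
    (Nat.mul_pos (by positivity) (by positivity)) hNq F hFQ w hw
  obtain ⟨H, hH⟩ : ∃ H, H = (N * (2 ^ N * (C ^ (N + J + 1) * C ^ (N + J + 1)))) ^ (2 * A') :=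
    ⟨_, rfl⟩
  rw [← hH] at hpH
  have hpφ : ∀ i < r, ∀ k < m, pair p (X ^ k * D^[i] φ) = 0 := by
    intro i hi k hk
    have h1 := hpF _ ⟨k, hk, i, hi, rfl⟩
    have h2 : ∑ n, (p n : ℚ) * (((d : ℚ) / k.factorial) • truncVec N (X ^ k * D^[i] φ)) n = 0 := by
      rw [← hFv k hk i hi]
      simp only
      exact_mod_cast h1
    have h3 : ((d : ℚ) / k.factorial) * pair p (X ^ k * D^[i] φ) = 0 := by
      rw [← h2, pair_apply, Finset.mul_sum]
      refine Finset.sum_congr rfl fun n _ => ?_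
      simp only [truncVec, LinearMap.coe_mk, AddHom.coe_mk, Pi.smul_apply, smul_eq_mul]
      ring
    refine (mul_eq_zero.1 h3).resolve_left (div_ne_zero ?_ ?_)
    · exact_mod_cast hd0.ne'
    · exact_mod_cast Nat.factorial_ne_zero k
  obtain ⟨j', hj'⟩ : ∃ j', j' = j₁ + 1 + (j : ℕ) := ⟨_, rfl⟩
  have hj'J : j' ≤ J := by have := j.2; omega
  have hne : pair p (T₃ ^ j' • D^[j'] φ) ≠ 0 := by
    rw [pair_apply, hj']
    exact hj
  have hdvd : PairDvd p d m.factorial (T₃ ^ j' • D^[j'] φ) := by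
    refine PairDvd.of_sPol_pow_smul (a * j') ?_
    rw [← hG]
    refine PairDvd.sum fun i hi => PairDvd.smul ?_ (hGint _ _)
    have hi' := Finset.mem_range.1 hi
    exact pairDvd_iterate_D (K := N + J) (by omega) (fun k hk => ⟨e k, he k hk⟩) (hpφ i hi')
  obtain ⟨z, hz⟩ := hdvd 0
  rw [pow_zero, one_mul] at hz
  have hz0 : z ≠ 0 := by
    rintro rfl
    rw [Int.cast_zero, mul_zero, mul_eq_zero] at hz
    refine hz.elim (fun h0 => ?_) hne
    exact hd0.ne' (by exact_mod_cast h0)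
  have hlow : (m.factorial : ℚ) ≤ d * |pair p (T₃ ^ j' • D^[j'] φ)| := by
    have h1 : (1 : ℚ) ≤ |(z : ℚ)| := by exact_mod_cast Int.one_le_abs hz0
    calc (m.factorial : ℚ) ≤ m.factorial * |(z : ℚ)| := le_mul_of_one_le_right (by positivity) h1
      _ = |(d : ℚ) * pair p (T₃ ^ j' • D^[j'] φ)| := by rw [hz, abs_mul, Nat.abs_cast]
      _ = _ := by rw [abs_mul, Nat.abs_cast]
  have hup := abs_map_pow_smul_le (pair p) (T := T₃) (t := t) le_rfl ht j' (g := D^[j'] φ)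
    (B := (N * (H * ((τ * J).factorial * 2 ^ N * C ^ (N + J + 1))) : ℕ)) (K := 0) (by
      intro k hk
      refine (abs_pair_le hC hφ hpH k j').trans ?_
      have h1 : k ≤ τ * J := (hk.trans (by rw [zero_add])).trans (Nat.mul_le_mul_left _ hj'J)
      have h2 := Nat.factorial_le h1
      have h3 : C ^ (N + j' + 1) ≤ C ^ (N + J + 1) := Nat.pow_le_pow_right hC (by omega)
      exact_mod_cast Nat.mul_le_mul_left _ (Nat.mul_le_mul_left _ (Nat.mul_le_mul
        (Nat.mul_le_mul_right _ h2) h3))) 0 le_rfl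
  rw [pow_zero, one_mul] at hup
  refine parameter_bound (t := t + 1) hC hN hJ1 rfl hH (b := (τ * J).factorial) ?_
    (Nat.factorial_pos _)
  have hfac : J.factorial * (τ * J).factorial ≤ m.factorial := by
    refine Nat.le_of_dvd (Nat.factorial_pos _) ?_
    have := Nat.factorial_mul_factorial_dvd_factorial_add J (τ * J)
    rwa [show J + τ * J = m by rw [hm, hB]; ring] at this
  refine hfac.trans ?_
  have hdC' : (d : ℚ) ≤ (C : ℚ) ^ (N + J + 1) := by exact_mod_cast hdC
  have ht' : (t : ℚ) ^ j' ≤ ((t + 1 : ℕ) : ℚ) ^ J := by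
    refine (pow_le_pow_left₀ (by positivity) (by push_cast; linarith) j').trans
      (pow_le_pow_right₀ (by push_cast; linarith [(Nat.cast_nonneg t : (0 : ℚ) ≤ t)]) hj'J)
  have hfin : (m.factorial : ℚ) ≤ (C : ℚ) ^ (N + J + 1) * (((t + 1 : ℕ) : ℚ) ^ J *
      ((N * (H * ((τ * J).factorial * 2 ^ N * C ^ (N + J + 1))) : ℕ) : ℚ)) := by
    refine hlow.trans (mul_le_mul hdC' (hup.trans ?_) (abs_nonneg _) (by positivity))
    exact mul_le_mul_of_nonneg_right ht' (by positivity)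
  exact_mod_cast hfin

lemma HasLattice.zero (Z : Submonoid Pol) : HasLattice Z 0 := by
  simpa using (hasLattice_one Z).smul 0

lemma isLattice_bot (Z : Submonoid Pol) : IsLattice Z ⊥ :=
  ⟨Submodule.fg_bot, 1, one_mem _, by simp⟩

lemma exists_isLattice_of_fg {Z : Submonoid Pol} {N : Submodule Pol ℚ⟦X⟧} (hN : N.FG)
    (h : ∀ x ∈ N, HasLattice Z x) : ∃ M, IsLattice Z M ∧ N ≤ M := by
  induction N, hN using Submodule.fg_induction with
  | singleton x =>
    obtain ⟨M, hM, hx⟩ := h x (Submodule.mem_span_singleton_self x)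
    exact ⟨M, hM, by simpa using hx⟩
  | sup M₁ M₂ _ _ h₁ h₂ =>
    obtain ⟨N₁, hN₁, hM₁⟩ := h₁ fun x hx => h x (Submodule.mem_sup_left hx)
    obtain ⟨N₂, hN₂, hM₂⟩ := h₂ fun x hx => h x (Submodule.mem_sup_right hx)
    exact ⟨N₁ ⊔ N₂, hN₁.sup hN₂, sup_le_sup hM₁ hM₂⟩

lemma exists_le_derivSpan_of_fg {φ : ℚ⟦X⟧} {N : Submodule Pol ℚ⟦X⟧} (hN : N.FG)
    (h : ∀ x ∈ N, ∃ j, x ∈ derivSpan φ j) : ∃ j, N ≤ derivSpan φ j := by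
  induction N, hN using Submodule.fg_induction with
  | singleton x =>
    obtain ⟨j, hx⟩ := h x (Submodule.mem_span_singleton_self x)
    exact ⟨j, by simpa using hx⟩
  | sup M₁ M₂ _ _ h₁ h₂ =>
    obtain ⟨i, hi⟩ := h₁ fun x hx => h x (Submodule.mem_sup_left hx)
    obtain ⟨j, hj⟩ := h₂ fun x hx => h x (Submodule.mem_sup_right hx)
    exact ⟨max i j, sup_le (hi.trans (derivSpan_mono φ (le_max_left _ _)))
      (hj.trans (derivSpan_mono φ (le_max_right _ _)))⟩

lemma exists_ne_zero_smul_mem_derivSpan {φ : ℚ⟦X⟧} {r : ℕ} {P : Pol} (hP : P ≠ 0)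
    (h : P • D^[r] φ ∈ derivSpan φ r) (j : ℕ) :
    ∃ p : Pol, p ≠ 0 ∧ ∀ x ∈ derivSpan φ j, p • x ∈ derivSpan φ r := by
  induction j with
  | zero =>
    refine ⟨1, one_ne_zero, fun x hx => ?_⟩
    rw [one_smul]
    exact derivSpan_mono φ (Nat.zero_le r) hx
  | succ j ih =>
    obtain ⟨p, hp, hpx⟩ := ih
    rcases Nat.lt_or_ge j r with hj | hj
    · refine ⟨1, one_ne_zero, fun x hx => ?_⟩
      rw [one_smul]
      exact derivSpan_mono φ hj hx
    · have h1 : P • D^[j] φ ∈ derivSpan φ j := by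
        obtain ⟨k, rfl⟩ := Nat.exists_eq_add_of_le hj
        clear hpx hj
        induction k with
        | zero => exact h
        | succ k ih => exact smul_iterate_succ_mem ih
      refine ⟨p * P, mul_ne_zero hp hP, fun x hx => ?_⟩
      rw [mul_smul]
      refine hpx _ ?_
      induction hx using Submodule.span_induction with
      | mem x hx =>
        obtain ⟨i, hi, rfl⟩ := hx
        rcases (Nat.lt_succ_iff.1 hi).lt_or_eq with hi | rfl
        · exact Submodule.smul_mem _ _ (iterate_mem_derivSpan φ hi)
        · exact h1
      | zero => simp
      | add x y _ _ hx hy => rw [smul_add]; exact add_mem hx hy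
      | smul q x _ hx => rw [smul_comm]; exact Submodule.smul_mem _ _ hx

lemma exists_uniform_derivSpan {φ : ℚ⟦X⟧} {r : ℕ} {P : Pol} (hP : P ≠ 0)
    (h : P • D^[r] φ ∈ derivSpan φ r) : ∃ j₁, r ≤ j₁ ∧ ∀ W j, HasLattice nonvanishing W →
      W ∈ derivSpan φ j → ∃ q ∈ nonvanishing, q • W ∈ derivSpan φ j₁ := by
  let B : Submodule Pol ℚ⟦X⟧ :=
    { carrier := {W | HasLattice nonvanishing W}
      add_mem' := fun ha hb => ha.add hb
      zero_mem' := HasLattice.zero _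
      smul_mem' := fun c x hx => hx.smul c }
  obtain ⟨M, hM, hBM⟩ := exists_isLattice_of_fg (Z := nonvanishing)
    ((derivSpan_fg φ r).of_le (inf_le_right : B ⊓ derivSpan φ r ≤ _)) fun x hx => hx.1
  let V : Submodule Pol ℚ⟦X⟧ := ⨆ j, derivSpan φ j
  have hV : ∀ x, x ∈ V ↔ ∃ j, x ∈ derivSpan φ j := fun x =>
    Submodule.mem_iSup_of_directed _ (derivSpan_mono φ).directed_le
  obtain ⟨j₀, hj₀⟩ := exists_le_derivSpan_of_fg
    (hM.1.of_le (inf_le_left : M ⊓ V ≤ M)) fun x hx => (hV x).1 hx.2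
  refine ⟨max r j₀, le_max_left _ _, fun W j hW hWj => ?_⟩
  obtain ⟨p, hp, hpx⟩ := exists_ne_zero_smul_mem_derivSpan hP h j
  obtain ⟨N, hN, hWN⟩ := id hW
  obtain ⟨q, hq, hqW⟩ := exists_nonvanishing_smul_mem hM hN hWN hp
    (hBM ⟨hW.smul p, hpx W hWj⟩)
  exact ⟨q, hq, derivSpan_mono φ (le_max_right _ _)
    (hj₀ ⟨hqW, (hV _).2 ⟨j, Submodule.smul_mem _ _ hWj⟩⟩)⟩

lemma exists_C_mul_mem_intPol (p : Pol) : ∃ d : ℤ, d ≠ 0 ∧ Polynomial.C (d : ℚ) * p ∈ intPol := by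
  obtain ⟨b, hb0, hb⟩ := IsLocalization.integerNormalization_spec (nonZeroDivisors ℤ) p
  refine ⟨b, nonZeroDivisors.ne_zero hb0, ?_⟩
  refine ⟨IsLocalization.integerNormalization (nonZeroDivisors ℤ) p, ?_⟩
  rw [Polynomial.coe_mapRingHom]
  refine hb.trans ?_
  simp

lemma exists_common_C_mul_mem_intPol (A : ℕ → Pol) (r : ℕ) :
    ∃ d : ℤ, d ≠ 0 ∧ ∀ i < r, Polynomial.C (d : ℚ) * A i ∈ intPol := by
  induction r with
  | zero => exact ⟨1, one_ne_zero, by simp⟩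
  | succ r ih =>
    obtain ⟨d, hd, h⟩ := ih
    obtain ⟨e, he, h'⟩ := exists_C_mul_mem_intPol (A r)
    have hC : ∀ n : ℤ, Polynomial.C (n : ℚ) ∈ intPol := fun n => ⟨Polynomial.C n, by simp⟩
    refine ⟨d * e, mul_ne_zero hd he, fun i hi => ?_⟩
    rw [Int.cast_mul, Polynomial.C_mul]
    rcases (Nat.lt_succ_iff.1 hi).lt_or_eq with hi | rfl
    · rw [mul_assoc, mul_left_comm]
      exact mul_mem (hC e) (h i hi)
    · rw [mul_assoc]
      exact mul_mem (hC d) h'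

/-- **Theorem of André–Chudnovsky type**: an E-function with rational coefficients lies in a
lattice for the derivation that is nonsingular at `1`. -/
theorem hasLattice_nonvanishing {r : ℕ} : ∀ {φ : ℚ⟦X⟧}, φ ∈ eSeries → ∀ {P : Pol}, P ≠ 0 →
    P • D^[r] φ ∈ derivSpan φ r → HasLattice nonvanishing φ := by
  induction r using Nat.strong_induction_on with
  | _ r ih =>
    intro φ hφ P hP h
    by_cases hφ0 : φ = 0
    · rw [hφ0]; exact HasLattice.zero _
    have hr : 0 < r := by
      rcases Nat.eq_zero_or_pos r with rfl | hr
      · exfalso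
        simp only [Function.iterate_zero, id, derivSpan, Set.Iio_zero_eq_empty, Set.image_empty,
          Submodule.span_empty, Submodule.mem_bot] at h
        rw [smul_def, mul_eq_zero] at h
        exact h.elim (by simpa using hP) hφ0
      · exact hr
    by_contra hNS
    obtain ⟨j₁, hj₁, huni⟩ := exists_uniform_derivSpan hP h
    obtain ⟨A₀, hA₀⟩ := exists_comb_of_mem h
    obtain ⟨d, hd, hint⟩ := exists_common_C_mul_mem_intPol (fun i => if i < r then A₀ i else P)
      (r + 1)
    have hU : Polynomial.C (d : ℚ) * P ∈ intPol := by simpa using hint r (Nat.lt_succ_self r)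
    have hC0 : Polynomial.C (d : ℚ) ≠ 0 := by simpa using hd
    have hs : sPol ≠ 0 := by
      intro h0
      simpa [sPol] using congrArg (Polynomial.eval 0) h0
    let A : ℕ → Pol := fun i => if i < r then sPol * (Polynomial.C (d : ℚ) * A₀ i) else 0
    have hA : ∀ i, A i ∈ intPol := fun i => by
      by_cases hi : i < r
      · simp only [A, hi, if_true]
        refine mul_mem sPol_mem_intPol ?_
        simpa [hi] using hint i (Nat.lt_succ_of_lt hi)
      · simp only [A, hi, if_false]
        exact zero_mem _
    have hrel : (sPol * (Polynomial.C (d : ℚ) * P)) • D^[r] φ = comb φ r A := by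
      rw [← mul_assoc, mul_smul, hA₀, ← comb_smul, comb, comb]
      refine Finset.sum_congr rfl fun i hi => ?_
      simp [A, Finset.mem_range.1 hi, mul_assoc]
    have hT0 : sPol * (Polynomial.C (d : ℚ) * P) ≠ 0 := mul_ne_zero hs (mul_ne_zero hC0 hP)
    obtain ⟨T, hT, hT1⟩ := Polynomial.exists_eq_pow_rootMultiplicity_mul_and_not_dvd _ hT0 1
    set a := Polynomial.rootMultiplicity 1 (sPol * (Polynomial.C (d : ℚ) * P))
    have hT' : sPol * (Polynomial.C (d : ℚ) * P) = sPol ^ a * ((-1) ^ a * T) := by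
      rw [hT, ← mul_assoc, ← mul_pow]
      congr 2
      simp [sPol]
    have hTn : (-1) ^ a * T ∈ nonvanishing := by
      rw [mem_nonvanishing]
      rw [Polynomial.dvd_iff_isRoot] at hT1
      simpa using hT1
    obtain ⟨J, α, c, ⟨j, hj, hαj⟩, l, hl, P', hP', hW⟩ := exists_comb_of_lower_order hr hφ hφ0
      (mul_ne_zero hC0 hP) hrel hU hA hT' j₁ hj₁
    set T₃ := (-1) ^ a * T
    set W := ∑ j ∈ Finset.Ioc j₁ J, α j • (T₃ ^ j • D^[j] φ) + comb φ r c with hWdef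
    have hterm : ∀ j, α j • (T₃ ^ j • D^[j] φ) = (Polynomial.C (α j) * T₃ ^ j) • D^[j] φ := by
      intro j
      rw [mul_smul, smul_def (Polynomial.C (α j)), smul_eq_C_mul, Polynomial.coe_C]
    have hWE : W ∈ eSeries := by
      refine add_mem (sum_mem fun j _ => ?_) (sum_mem fun i _ => ?_)
      · rw [hterm]
        exact smul_mem_eSeries (iterate_D_mem_eSeries hφ _) _
      · exact smul_mem_eSeries (iterate_D_mem_eSeries hφ _) _
    have hWNS : HasLattice nonvanishing W := ih l hl hWE hP' hW
    obtain ⟨j₀, hj₀, hαj₀, hmax⟩ : ∃ j₀ ∈ Finset.Ioc j₁ J, α j₀ ≠ 0 ∧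
        ∀ k ∈ Finset.Ioc j₁ J, j₀ < k → α k = 0 := by
      obtain ⟨j₀, hj₀, hmax⟩ := Finset.exists_max_image ((Finset.Ioc j₁ J).filter (α · ≠ 0)) id
        ⟨j, Finset.mem_filter.2 ⟨hj, hαj⟩⟩
      rw [Finset.mem_filter] at hj₀
      refine ⟨j₀, hj₀.1, hj₀.2, fun k hk hlt => ?_⟩
      by_contra hk0
      exact absurd (hmax k (Finset.mem_filter.2 ⟨hk, hk0⟩)) (not_le.2 hlt)
    have hj₀' := Finset.mem_Ioc.1 hj₀
    have hsplit : W - (Polynomial.C (α j₀) * T₃ ^ j₀) • D^[j₀] φ ∈ derivSpan φ j₀ := by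
      rw [hWdef, ← Finset.add_sum_erase _ _ hj₀, hterm j₀, add_assoc, add_sub_cancel_left]
      refine add_mem (Submodule.sum_mem _ fun k hk => ?_)
        (derivSpan_mono φ (by omega) (comb_mem_derivSpan φ r c))
      rw [Finset.mem_erase] at hk
      rcases lt_or_gt_of_ne hk.1 with hlt | hgt
      · rw [hterm]
        exact Submodule.smul_mem _ _ (iterate_mem_derivSpan φ hlt)
      · rw [hmax k hk.2 hgt, zero_smul]
        exact zero_mem _
    have hWmem : W ∈ derivSpan φ (j₀ + 1) := by
      rw [← sub_add_cancel W ((Polynomial.C (α j₀) * T₃ ^ j₀) • D^[j₀] φ)]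
      exact add_mem (derivSpan_mono φ (Nat.le_succ _) hsplit)
        (Submodule.smul_mem _ _ (iterate_mem_derivSpan φ (Nat.lt_succ_self _)))
    obtain ⟨q, hq, hqW⟩ := huni W _ hWNS hWmem
    refine hNS (hasLattice_of_smul_mem (r := j₀) (Q := q * (Polynomial.C (α j₀) * T₃ ^ j₀)) ?_ ?_)
    · refine mul_mem hq (mul_mem ?_ (pow_mem hTn _))
      rw [mem_nonvanishing]
      simpa using hαj₀
    · have h1 := sub_mem (derivSpan_mono φ hj₀'.1.le hqW) (Submodule.smul_mem _ q hsplit)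
      rwa [smul_sub, sub_sub_cancel, ← mul_smul] at h1

end EFun

namespace EFun

open Filter Topology

/-- An entire function of polynomial growth is a polynomial. -/
lemma exists_polynomial_of_growth {q : ℂ → ℂ} (hq : Differentiable ℂ q) {K : ℝ} {d : ℕ}
    (hb : ∀ z, ‖q z‖ ≤ K * (1 + ‖z‖) ^ d) : ∃ G : Polynomial ℂ, ∀ z, q z = G.eval z := by
  have hz : ∀ n, d < n → iteratedDeriv n q 0 = 0 := fun n hn => by
    have hbound : ∀ R : ℝ, 0 < R →
        ‖iteratedDeriv n q 0‖ ≤ n.factorial * (K * (1 + R) ^ d) / R ^ n := fun R hR =>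
      Complex.norm_iteratedDeriv_le_of_forall_mem_sphere_norm_le n hR hq.diffContOnCl
        fun z hz => by
          have : ‖z‖ = R := by simpa using hz
          simpa [this] using hb z
    have hK : 0 ≤ K := by simpa using (norm_nonneg _).trans (hb 0)
    have hlim : Tendsto (fun R : ℝ => (n.factorial * K * 2 ^ d) * R⁻¹) atTop (𝓝 0) := by
      simpa using tendsto_inv_atTop_zero.const_mul (n.factorial * K * 2 ^ d : ℝ)
    refine norm_le_zero_iff.1 (ge_of_tendsto hlim ?_)
    filter_upwards [eventually_ge_atTop (1 : ℝ)] with R hR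
    refine (hbound R (by linarith)).trans ?_
    have hR0 : 0 < R := by linarith
    rw [div_le_iff₀ (by positivity)]
    have h1 : (1 + R) ^ d ≤ 2 ^ d * R ^ d := by
      rw [← mul_pow]; gcongr; linarith
    have h2 : R ^ d ≤ R⁻¹ * R ^ n := by
      obtain ⟨m, rfl⟩ := Nat.exists_eq_add_of_lt hn
      rw [pow_succ, mul_comm (R⁻¹), mul_assoc, mul_inv_cancel₀ hR0.ne', mul_one]
      exact pow_le_pow_right₀ hR (by omega)
    calc (n.factorial : ℝ) * (K * (1 + R) ^ d) ≤ n.factorial * (K * (2 ^ d * R ^ d)) := by gcongr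
      _ ≤ n.factorial * (K * (2 ^ d * (R⁻¹ * R ^ n))) := by gcongr
      _ = _ := by ring
  refine ⟨∑ n ∈ Finset.range (d + 1), Polynomial.monomial n ((n.factorial : ℂ)⁻¹ * iteratedDeriv n q 0),
    fun z => ?_⟩
  rw [← Complex.taylorSeries_eq_of_entire' (c := 0) (z := z) hq,
    tsum_eq_sum (s := Finset.range (d + 1)) fun n hn => by
      rw [hz n (by simpa using hn)]; simp]
  simp [Polynomial.eval_finsetSum]

lemma eventually_ne_zero_of_ne_zero {h : ℂ → ℂ} (hh : Differentiable ℂ h) (h0 : h ≠ 0) (z : ℂ) :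
    ∀ᶠ w in 𝓝[≠] z, h w ≠ 0 := by
  refine ((hh.analyticAt z).eventually_eq_zero_or_eventually_ne_zero).resolve_left fun he => h0 ?_
  have := AnalyticOnNhd.eq_of_eventuallyEq (f := h) (g := 0) (z₀ := z)
    (fun w _ => hh.analyticAt w) (fun w _ => analyticAt_const) he
  exact this

/-- If an entire function `f` is bounded by a polynomial multiple of an entire function `h`, then
`f` is a polynomial multiple of `h`. -/
lemma exists_polynomial_mul {f h : ℂ → ℂ} (hf : Differentiable ℂ f) (hh : Differentiable ℂ h)
    (h0 : h ≠ 0) {K : ℝ} {d : ℕ} (hb : ∀ z, ‖f z‖ ≤ K * (1 + ‖z‖) ^ d * ‖h z‖) :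
    ∃ G : Polynomial ℂ, ∀ z, f z = G.eval z * h z := by
  have hm : MeromorphicOn (f / h) Set.univ := fun z _ =>
    (hf.analyticAt z).meromorphicAt.div (hh.analyticAt z).meromorphicAt
  set q := toMeromorphicNFOn (f / h) Set.univ with hqdef
  have hqe : ∀ z, ∀ᶠ w in 𝓝[≠] z, q w = f w / h w := fun z => by
    filter_upwards [hm.toMeromorphicNFOn_eq_self_on_nhdsNE (Set.mem_univ z)] with w hw
    exact hw
  have hqb : ∀ z, ∀ᶠ w in 𝓝[≠] z, ‖q w‖ ≤ K * (1 + ‖w‖) ^ d := fun z => by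
    filter_upwards [hqe z, eventually_ne_zero_of_ne_zero hh h0 z] with w hw hw0
    rw [hw, norm_div, div_le_iff₀ (norm_pos_iff.2 hw0)]
    exact hb w
  have hcont : ∀ z, Tendsto (fun w : ℂ => K * (1 + ‖w‖) ^ d) (𝓝[≠] z) (𝓝 (K * (1 + ‖z‖) ^ d)) :=
    fun z => ((by fun_prop : Continuous fun w : ℂ => K * (1 + ‖w‖) ^ d).tendsto z).mono_left
      nhdsWithin_le_nhds
  have hqa : ∀ z, AnalyticAt ℂ q z := fun z => by
    have hNF : MeromorphicNFAt q z := meromorphicNFOn_toMeromorphicNFOn (f / h) Set.univ (Set.mem_univ z)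
    rw [← hNF.meromorphicOrderAt_nonneg_iff_analyticAt]
    by_contra! hneg
    have ht := tendsto_norm_atTop_iff_cobounded.2 (tendsto_cobounded_of_meromorphicOrderAt_neg hneg)
    exact not_tendsto_atTop_of_tendsto_nhds (hcont z) (tendsto_atTop_mono' _ (hqb z) ht)
  have hqd : Differentiable ℂ q := fun z => (hqa z).differentiableAt
  obtain ⟨G, hG⟩ := exists_polynomial_of_growth hqd (K := K) (d := d) fun z =>
    le_of_tendsto_of_tendsto ((hqd.continuous.norm.tendsto z).mono_left nhdsWithin_le_nhds)
      (hcont z) (hqb z)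
  refine ⟨G, fun z => ?_⟩
  rw [← hG]
  have he : f =ᶠ[𝓝[≠] z] fun w => q w * h w := by
    filter_upwards [hqe z, eventually_ne_zero_of_ne_zero hh h0 z] with w hw hw0
    rw [hw, div_mul_cancel₀ _ hw0]
  exact ((ContinuousAt.eventuallyEq_nhds_iff_eventuallyEq_nhdsNE hf.continuous.continuousAt
    (hqd.continuous.mul hh.continuous).continuousAt).1 he).eq_of_nhds

end EFun

namespace EFun

open scoped TensorProduct

lemma injective_of_linearIndependent_comp_basis {R M N ι : Type*} [CommRing R] [AddCommGroup M]
    [Module R M] [AddCommGroup N] [Module R N] (b : Module.Basis ι R M) (f : M →ₗ[R] N)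
    (h : LinearIndependent R (f ∘ b)) : Function.Injective f := by
  have : f = (Finsupp.linearCombination R (f ∘ b)) ∘ₗ b.repr.toLinearMap :=
    b.ext fun i => by simp
  rw [this]
  exact Function.Injective.comp (g := Finsupp.linearCombination R (f ∘ b)) h b.repr.injective

/-- If `k` is algebraically closed in `F` and `L/k` is finite, then `F ⊗ L` is a domain. -/
lemma isDomain_tensor_of_finite {k F L : Type*} [Field k] [CharZero k] [Field F] [Field L]
    [Algebra k F] [Algebra k L] [FiniteDimensional k L]
    (h : ∀ x : F, IsAlgebraic k x → x ∈ (algebraMap k F).range) : IsDomain (F ⊗[k] L) := by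
  let pb := Field.powerBasisOfFiniteOfSeparable k L
  let Ω := AlgebraicClosure F
  let φ : L →ₐ[k] Ω := IsAlgClosed.lift
  let Φ : F ⊗[k] L →ₐ[F] Ω := Algebra.TensorProduct.lift (Algebra.ofId F Ω) φ fun _ _ => .all _ _
  have hint : IsIntegral k (φ pb.gen) := (Algebra.IsIntegral.isIntegral pb.gen).map φ
  have hint' : IsIntegral F (φ pb.gen) := hint.tower_top
  have hdeg : (minpoly F (φ pb.gen)).natDegree = pb.dim := by
    have hk : minpoly k (φ pb.gen) = minpoly k pb.gen := minpoly.algHom_eq φ φ.injective _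
    have hd : minpoly F (φ pb.gen) ∣ (minpoly k (φ pb.gen)).map (algebraMap k F) :=
      minpoly.dvd_map_of_isScalarTower _ _ _
    obtain ⟨g, hg⟩ := (Polynomial.mem_lifts _).1 (integralClosure.mem_lifts_of_monic_of_dvd_map F
      (minpoly.monic hint) (minpoly.monic hint') hd)
    have hl : minpoly F (φ pb.gen) ∈ Polynomial.lifts (algebraMap k F) := by
      rw [Polynomial.lifts_iff_coeff_lifts]
      intro n
      rw [← hg, Polynomial.coeff_map]
      exact h _ ((g.coeff n).2 : IsIntegral k _).isAlgebraic
    obtain ⟨g0, hg0⟩ := (Polynomial.mem_lifts _).1 hl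
    have hz : Polynomial.aeval (φ pb.gen) g0 = 0 := by
      rw [← Polynomial.aeval_map_algebraMap F, hg0, minpoly.aeval]
    have hg00 : g0 ≠ 0 := by
      rintro rfl
      exact minpoly.ne_zero hint' (by simpa using hg0.symm)
    rw [← pb.natDegree_minpoly, ← hk]
    apply le_antisymm
    · simpa using Polynomial.natDegree_le_of_dvd hd
        (Polynomial.map_ne_zero (minpoly.ne_zero hint))
    · have := Polynomial.natDegree_le_of_dvd (minpoly.dvd k _ hz) hg00
      rwa [← hg0, Polynomial.natDegree_map]
  have hli := linearIndependent_pow (K := F) (φ pb.gen)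
  have hinj : Function.Injective Φ :=
    injective_of_linearIndependent_comp_basis (Algebra.TensorProduct.basis F pb.basis)
      Φ.toLinearMap (by
        have he : Φ.toLinearMap ∘ Algebra.TensorProduct.basis F pb.basis =
            (fun i : Fin (minpoly F (φ pb.gen)).natDegree => φ pb.gen ^ (i : ℕ)) ∘
              Fin.cast hdeg.symm := by
          ext i
          simp [Φ]
        rw [he]
        exact hli.comp _ (Fin.cast_injective _))
  exact hinj.isDomain Φ.toRingHom

lemma repr_eq_zero_of_mul_eq_zero {k F A Q ι : Type*} [Field k] [CharZero k] [Field F]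
    [CommRing A] [Field Q] [Algebra k F] [Algebra k A] [Algebra k Q] [FiniteDimensional k Q]
    (h : ∀ x : F, IsAlgebraic k x → x ∈ (algebraMap k F).range) (b : Module.Basis ι k F)
    (ψ : A →ₐ[k] Q) {x y : A ⊗[k] F} (hxy : x * y = 0) :
    (∀ i, ψ ((Algebra.TensorProduct.basis A b).repr x i) = 0) ∨
      ∀ i, ψ ((Algebra.TensorProduct.basis A b).repr y i) = 0 := by
  have hdom := isDomain_tensor_of_finite (L := Q) h
  let π : A ⊗[k] F →ₐ[k] Q ⊗[k] F := Algebra.TensorProduct.map ψ (AlgHom.id k F)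
  let σ := (Algebra.TensorProduct.comm k Q F)
  have hπ : ∀ z i, (Algebra.TensorProduct.basis Q b).repr (π z) i =
      ψ ((Algebra.TensorProduct.basis A b).repr z i) := fun z i => by
    induction z with
    | zero => simp
    | add u v hu hv => simp [hu, hv]
    | tmul u v => simp [π, Algebra.TensorProduct.basis_repr_tmul]
  have hprod : σ (π x) * σ (π y) = 0 := by rw [← map_mul, ← map_mul, hxy, map_zero, map_zero]
  refine (mul_eq_zero.1 hprod).imp (fun h0 i => ?_) fun h0 i => ?_ <;>
  · rw [← hπ, (map_eq_zero_iff σ σ.injective).1 h0]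
    simp

/-- If `k` is algebraically closed in `F`, then `L ⊗ F` is a domain for every field `L ⊇ k`. -/
theorem isDomain_tensor {k F L : Type*} [Field k] [CharZero k] [Field F] [Field L]
    [Algebra k F] [Algebra k L]
    (h : ∀ x : F, IsAlgebraic k x → x ∈ (algebraMap k F).range) : IsDomain (L ⊗[k] F) := by
  have : NoZeroDivisors (L ⊗[k] F) := ⟨fun {x y} hxy => by
    by_contra! hne
    obtain ⟨hx, hy⟩ := hne
    let b := Module.Basis.ofVectorSpace k F
    let B := Algebra.TensorProduct.basis L b
    let c := B.repr x
    let c' := B.repr y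
    obtain ⟨i, hi⟩ : ∃ i, c i ≠ 0 := by
      by_contra! hc
      exact hx (B.repr.injective (by ext i; simpa using hc i))
    obtain ⟨j, hj⟩ : ∃ j, c' j ≠ 0 := by
      by_contra! hc
      exact hy (B.repr.injective (by ext i; simpa using hc i))
    classical
    let S : Finset L := c.support.image c ∪ c'.support.image c'
    let A : Subalgebra k L := Algebra.adjoin k (S : Set L)
    have hA : Algebra.FiniteType k A := Subalgebra.fg_iff_finiteType _ |>.1 ⟨S, rfl⟩
    have hc : ∀ i, c i ∈ A := fun i => by
      by_cases h0 : c i = 0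
      · rw [h0]; exact A.zero_mem
      · exact Algebra.subset_adjoin (by
          simp only [S, Finset.coe_union, Finset.coe_image]
          exact Or.inl ⟨i, by simpa using h0, rfl⟩)
    have hc' : ∀ i, c' i ∈ A := fun i => by
      by_cases h0 : c' i = 0
      · rw [h0]; exact A.zero_mem
      · exact Algebra.subset_adjoin (by
          simp only [S, Finset.coe_union, Finset.coe_image]
          exact Or.inr ⟨i, by simpa using h0, rfl⟩)
    let BA := Algebra.TensorProduct.basis A b
    let ι : A ⊗[k] F →ₐ[k] L ⊗[k] F := Algebra.TensorProduct.map A.val (AlgHom.id k F)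
    have hrepr : ∀ z, ∀ i, B.repr (ι z) i = BA.repr z i := fun z i => by
      induction z with
      | zero => simp
      | add u v hu hv => simp [hu, hv]
      | tmul u v => simp [ι, B, BA, Algebra.TensorProduct.basis_repr_tmul]
    have hι : Function.Injective ι := fun u v huv => BA.repr.injective (by
      ext i
      rw [← hrepr, ← hrepr, huv])
    have hlift : ∀ z : L ⊗[k] F, (∀ i, B.repr z i ∈ A) → ∃ w, ι w = z := fun z hz => by
      refine ⟨BA.repr.symm (Finsupp.onFinset (B.repr z).support (fun i => ⟨B.repr z i, hz i⟩)
        fun i hi => by simpa [Subtype.ext_iff] using hi), B.repr.injective ?_⟩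
      ext i
      rw [hrepr]
      simp
    obtain ⟨x', hx'⟩ := hlift x hc
    obtain ⟨y', hy'⟩ := hlift y hc'
    have hxy' : x' * y' = 0 := hι (by rw [map_mul, hx', hy', hxy, map_zero])
    have hJ : IsJacobsonRing A := isJacobsonRing_of_finiteType (A := k)
    let d : A := ⟨c i, hc i⟩ * ⟨c' j, hc' j⟩
    have hd : d ≠ 0 := mul_ne_zero (by simpa [Subtype.ext_iff] using hi)
      (by simpa [Subtype.ext_iff] using hj)
    obtain ⟨m, hm, hdm⟩ : ∃ m : Ideal A, m.IsMaximal ∧ d ∉ m := by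
      by_contra! hcon
      have h1 : (⊥ : Ideal A).jacobson = ⊥ :=
        isJacobsonRing_iff.1 hJ ⊥ (Ideal.isPrime_bot (α := A)).isRadical
      have : d ∈ (⊥ : Ideal A).jacobson := by
        rw [Ideal.jacobson, Submodule.mem_sInf]
        exact fun m hm => hcon m hm.2
      rw [h1] at this
      exact hd this
    let _ : Field (A ⧸ m) := Ideal.Quotient.field m
    have hfin : Module.Finite k (A ⧸ m) := finite_of_finite_type_of_isJacobsonRing k (A ⧸ m)
    have hex : BA.repr x' i = ⟨c i, hc i⟩ := Subtype.ext (by rw [← hrepr, hx'])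
    have hey : BA.repr y' j = ⟨c' j, hc' j⟩ := Subtype.ext (by rw [← hrepr, hy'])
    apply hdm
    rcases repr_eq_zero_of_mul_eq_zero h b (Ideal.Quotient.mkₐ k m) hxy' with h0 | h0
    · have h2 := h0 i
      rw [hex] at h2
      exact m.mul_mem_right _ (Ideal.Quotient.eq_zero_iff_mem.1 h2)
    · have h2 := h0 j
      rw [hey] at h2
      exact m.mul_mem_left _ (Ideal.Quotient.eq_zero_iff_mem.1 h2)⟩
  exact NoZeroDivisors.to_isDomain _

lemma algebraMap_homogeneous_eq {A E F : Type*} [CommRing A] [CommRing E] [Field F] [Algebra A E]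
    [Algebra E F] [Algebra A F] [IsScalarTower A E F] {P : Polynomial A} (hP : P.Monic) {u v : E}
    (hv : algebraMap E F v ≠ 0)
    (h0 : P.eval₂ (algebraMap A F) (algebraMap E F u / algebraMap E F v) = 0) :
    algebraMap E F (u ^ P.natDegree +
      ∑ i ∈ Finset.range P.natDegree, P.coeff i • (u ^ i * v ^ (P.natDegree - i))) = 0 := by
  rw [Polynomial.eval₂_eq_sum_range, Finset.sum_range_succ, hP.coeff_natDegree] at h0
  have h2 := congrArg (fun t => t * algebraMap E F v ^ P.natDegree) h0
  simp only [add_mul, zero_mul, map_one, one_mul] at h2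
  rw [← h2, map_add, map_sum, add_comm, Finset.sum_mul]
  congr 1
  · refine Finset.sum_congr rfl fun i hi => ?_
    have hi' : i ≤ P.natDegree := (Finset.mem_range.1 hi).le
    rw [Algebra.smul_def, map_mul, map_mul, map_pow, map_pow, ← IsScalarTower.algebraMap_apply A E F,
      div_pow, ← pow_sub_mul_pow (algebraMap E F v) hi']
    field_simp
  · rw [map_pow, div_pow, div_mul_cancel₀ _ (pow_ne_zero _ hv)]

lemma mem_range_of_isAlgebraic {A E k F : Type*} [CommRing A] [IsDomain A]
    [CommRing E] [IsDomain E] [Field k] [Field F] [Algebra A E] [FaithfulSMul A E] [Algebra A k]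
    [IsFractionRing A k] [Algebra E F] [IsFractionRing E F] [Algebra k F] [Algebra A F]
    [IsScalarTower A k F] [IsScalarTower A E F]
    (h : ∀ u v : E, v ≠ 0 → (∃ n : ℕ, 0 < n ∧ ∃ c : ℕ → A,
      u ^ n + ∑ i ∈ Finset.range n, c i • (u ^ i * v ^ (n - i)) = 0) → ∃ p : A, u = p • v)
    {x : F} (hx : IsAlgebraic k x) : x ∈ (algebraMap k F).range := by
  have hinjE : Function.Injective (algebraMap E F) := IsFractionRing.injective E F
  have hinjA : Function.Injective (algebraMap A E) := FaithfulSMul.algebraMap_injective A E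
  obtain ⟨u, v, hv, rfl⟩ := IsFractionRing.div_surjective (A := E) x
  have hv0 : v ≠ 0 := nonZeroDivisors.ne_zero hv
  have hv1 : algebraMap E F v ≠ 0 := (map_ne_zero_iff _ hinjE).2 hv0
  obtain ⟨a, ha, hint⟩ := ((IsFractionRing.isAlgebraic_iff A k F).2 hx).exists_integral_multiple
  have hau : a • (algebraMap E F u / algebraMap E F v) =
      algebraMap E F (a • u) / algebraMap E F v := by
    rw [Algebra.smul_def, Algebra.smul_def, map_mul, ← IsScalarTower.algebraMap_apply A E F,
      mul_div_assoc]
  rw [hau] at hint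
  obtain ⟨P, hP, hPx⟩ := hint
  have hn : 0 < P.natDegree := by
    rcases Nat.eq_zero_or_pos P.natDegree with h0 | h0
    · rw [hP.natDegree_eq_zero.1 h0] at hPx
      simp at hPx
    · exact h0
  obtain ⟨p, hp⟩ := h (a • u) v hv0 ⟨P.natDegree, hn, fun i => P.coeff i,
    (map_eq_zero_iff _ hinjE).1 (algebraMap_homogeneous_eq hP hv1 hPx)⟩
  have ha' : algebraMap A F a ≠ 0 := by
    rw [IsScalarTower.algebraMap_apply A E F]
    exact (map_ne_zero_iff _ hinjE).2 ((map_ne_zero_iff _ hinjA).2 ha)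
  refine ⟨algebraMap A k p / algebraMap A k a, ?_⟩
  rw [map_div₀, ← IsScalarTower.algebraMap_apply A k F, ← IsScalarTower.algebraMap_apply A k F,
    div_eq_div_iff ha' hv1]
  have h3 := congrArg (algebraMap E F) hp
  rw [Algebra.smul_def, Algebra.smul_def, map_mul, map_mul, ← IsScalarTower.algebraMap_apply,
    ← IsScalarTower.algebraMap_apply] at h3
  rw [← h3, mul_comm]

/-- If the fraction field of `A` is algebraically closed in that of `E`, then `Ω ⊗ E` is a domain for
every field `Ω` containing `A`. -/
theorem noZeroDivisors_tensor {A E Ω : Type*} [CommRing A] [IsDomain A] [IsPrincipalIdealRing A]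
    [CharZero A] [CommRing E] [IsDomain E] [Field Ω] [Algebra A E] [Algebra A Ω] [FaithfulSMul A E]
    [FaithfulSMul A Ω]
    (h : ∀ u v : E, v ≠ 0 → (∃ n : ℕ, 0 < n ∧ ∃ c : ℕ → A,
      u ^ n + ∑ i ∈ Finset.range n, c i • (u ^ i * v ^ (n - i)) = 0) → ∃ p : A, u = p • v) :
    NoZeroDivisors (Ω ⊗[A] E) := by
  let _ : Algebra (FractionRing A) (FractionRing E) := FractionRing.liftAlgebra A (FractionRing E)
  let _ : Algebra (FractionRing A) Ω := FractionRing.liftAlgebra A Ω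
  have : IsScalarTower A (FractionRing A) (FractionRing E) :=
    FractionRing.isScalarTower_liftAlgebra A (FractionRing E)
  have : IsScalarTower A (FractionRing A) Ω := FractionRing.isScalarTower_liftAlgebra A Ω
  have : CharZero (FractionRing A) :=
    charZero_of_injective_algebraMap (IsFractionRing.injective A (FractionRing A))
  have hdom : IsDomain (Ω ⊗[FractionRing A] FractionRing E) :=
    isDomain_tensor fun x hx => mem_range_of_isAlgebraic h hx
  let g : Ω ⊗[A] E →ₐ[A] Ω ⊗[FractionRing A] FractionRing E := Algebra.TensorProduct.lift
    ((Algebra.TensorProduct.includeLeft : Ω →ₐ[FractionRing A] Ω ⊗[FractionRing A]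
      FractionRing E).restrictScalars A)
    (((Algebra.TensorProduct.includeRight : FractionRing E →ₐ[FractionRing A] Ω ⊗[FractionRing A]
      FractionRing E).restrictScalars A).comp
      (IsScalarTower.toAlgHom A E (FractionRing E)))
    fun _ _ => .all _ _
  have : Module.IsTorsionFree A Ω := Module.isTorsionFree_iff_faithfulSMul.2 inferInstance
  have hg : Function.Injective g := by
    have h1 := Module.Flat.lTensor_preserves_injective_linearMap (M := Ω)
      (IsScalarTower.toAlgHom A E (FractionRing E)).toLinearMap (IsFractionRing.injective E _)
    have h2 := (IsLocalization.moduleTensorEquiv (nonZeroDivisors A) (FractionRing A) Ω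
      (FractionRing E)).symm.injective.comp h1
    have h3 : ⇑g = (IsLocalization.moduleTensorEquiv (nonZeroDivisors A) (FractionRing A) Ω
      (FractionRing E)).symm ∘ LinearMap.lTensor Ω
        (IsScalarTower.toAlgHom A E (FractionRing E)).toLinearMap := by
      ext z
      induction z with
      | zero => simp
      | add u v hu hv => rw [map_add, hu, hv]; simp
      | tmul u v =>
        rw [Function.comp_apply, LinearMap.lTensor_tmul, LinearEquiv.eq_symm_apply]
        simp [g, IsLocalization.moduleTensorEquiv, TensorProduct.equivOfCompatibleSMul]
    rw [h3]
    exact h2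
  exact hg.noZeroDivisors g (map_zero g) (map_mul g)

end EFun

namespace EFun

open PowerSeries

/-- The rational E-functions: series with rational E-type coefficients, killed by a linear
differential operator. -/
def eFun : Subalgebra Pol ℚ⟦X⟧ where
  carrier := {f | f ∈ eSeries ∧ HasLattice (nonZeroDivisors Pol) f}
  mul_mem' hf hg := ⟨mul_mem hf.1 hg.1, hf.2.mul hg.2⟩
  add_mem' hf hg := ⟨add_mem hf.1 hg.1, hf.2.add hg.2⟩
  algebraMap_mem' p := ⟨coe_mem_eSeries p, by
    have := (hasLattice_one (nonZeroDivisors Pol)).smul p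
    rwa [smul_def, mul_one] at this⟩

lemma D_mem_eFun {f : ℚ⟦X⟧} (h : f ∈ eFun) : D f ∈ eFun := ⟨D_mem_eSeries h.1, h.2.D⟩

lemma iterate_D_mem_eFun {f : ℚ⟦X⟧} (h : f ∈ eFun) (i : ℕ) : D^[i] f ∈ eFun := by
  induction i with
  | zero => exact h
  | succ i ih => rw [Function.iterate_succ_apply']; exact D_mem_eFun ih

lemma derivSpan_le_eFun {f : ℚ⟦X⟧} (h : f ∈ eFun) (r : ℕ) :
    derivSpan f r ≤ Subalgebra.toSubmodule eFun := by
  refine Submodule.span_le.2 ?_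
  rintro _ ⟨i, -, rfl⟩
  exact iterate_D_mem_eFun h i

/-- Every rational E-function lies in a lattice of E-functions which is nonsingular at `1`. -/
lemma exists_lattice_mem {f : ℚ⟦X⟧} (h : f ∈ eFun) :
    ∃ M, IsLattice nonvanishing M ∧ M ≤ Subalgebra.toSubmodule eFun ∧ f ∈ M := by
  obtain ⟨r, Q, hQ, hr⟩ := h.2.exists_smul_mem
  obtain ⟨s, T, hT, hs⟩ :=
    (hasLattice_nonvanishing h.1 (nonZeroDivisors.ne_zero hQ) hr).exists_smul_mem
  exact ⟨_, isLattice_derivSpan hT (smul_iterate_succ_mem hs), derivSpan_le_eFun h _,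
    iterate_mem_derivSpan f (i := 0) (Nat.succ_pos s)⟩

lemma exists_lattice_finset {ι : Type*} (s : Finset ι) (f : ι → ℚ⟦X⟧) (h : ∀ i ∈ s, f i ∈ eFun) :
    ∃ M, IsLattice nonvanishing M ∧ M ≤ Subalgebra.toSubmodule eFun ∧ ∀ i ∈ s, f i ∈ M := by
  classical
  induction s using Finset.induction_on with
  | empty => exact ⟨⊥, isLattice_bot _, bot_le, by simp⟩
  | insert a s _ ih =>
    obtain ⟨M, hM, hME, hMs⟩ := ih fun i hi => h i (Finset.mem_insert_of_mem hi)
    obtain ⟨N, hN, hNE, hNa⟩ := exists_lattice_mem (h a (Finset.mem_insert_self a s))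
    refine ⟨M ⊔ N, hM.sup hN, sup_le hME hNE, fun i hi => ?_⟩
    rcases Finset.mem_insert.1 hi with rfl | hi
    · exact Submodule.mem_sup_right hNa
    · exact Submodule.mem_sup_left (hMs i hi)

lemma hasLattice_inv_sPol : HasLattice (nonZeroDivisors Pol) (PowerSeries.mk 1 : ℚ⟦X⟧) := by
  have h1 : (1 - X) * (PowerSeries.mk 1 : ℚ⟦X⟧) = 1 := by
    rw [mul_comm]; exact PowerSeries.mk_one_mul_one_sub_eq_one ℚ
  have h2 : sPol • (PowerSeries.mk 1 : ℚ⟦X⟧) = 1 := by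
    rw [smul_def, ← h1]; simp
  have h3 := congrArg D h2
  rw [D_smul] at h3
  have hs : sPol ≠ 0 := fun h => by
    have := congrArg (Polynomial.eval 0) h
    simp at this
  refine hasLattice_of_smul_mem (r := 1) (Q := sPol) (mem_nonZeroDivisors_of_ne_zero hs) ?_
  have h4 : sPol • D (PowerSeries.mk 1 : ℚ⟦X⟧) = (PowerSeries.mk 1 : ℚ⟦X⟧) := by
    have h5 : D (1 : ℚ⟦X⟧) = 0 := D.map_one_eq_zero
    rw [h5] at h3
    have h6 : Polynomial.derivative sPol = -1 := by simp
    rw [h6, neg_smul, one_smul] at h3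
    exact eq_of_sub_eq_zero (by rw [sub_eq_add_neg]; exact h3)
  rw [Function.iterate_one, h4]
  exact iterate_mem_derivSpan _ (i := 0) Nat.one_pos

/-- A rational E-function vanishing at `1` is divisible by `1 - X` among E-functions. -/
lemma exists_sPol_smul {f : ℚ⟦X⟧} (hf : f ∈ eFun) (h0 : value 1 f = 0) :
    ∃ g ∈ eFun, sPol • g = f := by
  obtain ⟨g, hg, h⟩ := exists_one_sub_X_mul hf.1 h0
  refine ⟨g, ⟨hg, ?_⟩, by rw [smul_def, ← h]; simp⟩
  have h1 : g = PowerSeries.mk 1 * f := by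
    rw [← h, ← mul_assoc, PowerSeries.mk_one_mul_one_sub_eq_one, one_mul]
  rw [h1]
  exact hasLattice_inv_sPol.mul hf.2

lemma value_sum {ι : Type*} (s : Finset ι) {f : ι → ℚ⟦X⟧} (hf : ∀ i ∈ s, f i ∈ eSeries) (z : ℂ) :
    value z (∑ i ∈ s, f i) = ∑ i ∈ s, value z (f i) := by
  classical
  induction s using Finset.induction_on with
  | empty => simp [value]
  | insert a s ha ih =>
    have h1 : ∀ i ∈ s, f i ∈ eSeries := fun i hi => hf i (Finset.mem_insert_of_mem hi)
    rw [Finset.sum_insert ha, Finset.sum_insert ha,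
      value_add (hf a (Finset.mem_insert_self a s)) (sum_mem h1), ih h1]

instance : FaithfulSMul Pol ℚ⟦X⟧ :=
  (faithfulSMul_iff_algebraMap_injective _ _).2 (Polynomial.coe_injective ℚ)

instance : Module.IsTorsionFree Pol ℚ⟦X⟧ := Module.isTorsionFree_iff_faithfulSMul.2 inferInstance

lemma IsLattice.free {Z : Submonoid Pol} {M : Submodule Pol ℚ⟦X⟧} (hM : IsLattice Z M) :
    ∃ n, ∃ m : Fin n → ℚ⟦X⟧, LinearIndependent Pol m ∧ Submodule.span Pol (Set.range m) = M := by
  have : Module.Finite Pol M := Module.Finite.iff_fg.2 hM.1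
  have : Module.Free Pol M := Module.free_of_finite_type_torsion_free'
  let b := Module.finBasis Pol M
  refine ⟨_, fun i => (b i : ℚ⟦X⟧), ?_, ?_⟩
  · exact b.linearIndependent.map' M.subtype M.ker_subtype
  · have := congrArg (Submodule.map M.subtype) b.span_eq
    rw [Submodule.map_span, ← Set.range_comp, Submodule.map_subtype_top] at this
    exact this

/-- The values at `1` of a basis of a lattice nonsingular at `1` are linearly independent. -/
lemma linearIndependent_value {n : ℕ} {m : Fin n → ℚ⟦X⟧} (hm : LinearIndependent Pol m)
    (hM : IsLattice nonvanishing (Submodule.span Pol (Set.range m)))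
    (hE : Submodule.span Pol (Set.range m) ≤ Subalgebra.toSubmodule eFun) {c : Fin n → ℚ}
    (h : ∑ i, (c i : ℂ) * value 1 (m i) = 0) : c = 0 := by
  have hmE : ∀ i, m i ∈ eFun := fun i => hE (Submodule.subset_span ⟨i, rfl⟩)
  have hsum : ∑ i, Polynomial.C (c i) • m i ∈ eFun :=
    sum_mem fun i _ => Subalgebra.smul_mem _ (hmE i) _
  have hval : value 1 (∑ i, Polynomial.C (c i) • m i) = 0 := by
    rw [value_sum _ fun i _ => smul_mem_eSeries (hmE i).1 _, ← h]
    refine Finset.sum_congr rfl fun i _ => ?_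
    rw [value_smul (hmE i).1]
    simp
  obtain ⟨w, hw, hws⟩ := exists_sPol_smul hsum hval
  obtain ⟨N, hN, -, hwN⟩ := exists_lattice_mem hw
  have hs : sPol ≠ 0 := fun h => by
    have := congrArg (Polynomial.eval 0) h
    simp at this
  obtain ⟨q, hq, hqw⟩ := exists_nonvanishing_smul_mem hM hN hwN hs (by
    rw [hws]
    exact sum_mem fun i _ => Submodule.smul_mem _ _ (Submodule.subset_span ⟨i, rfl⟩))
  obtain ⟨p, hp⟩ := (Submodule.mem_span_range_iff_exists_fun Pol).1 hqw
  have h1 : ∑ i, (q * Polynomial.C (c i)) • m i = ∑ i, (sPol * p i) • m i := by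
    simp only [mul_smul]
    rw [← Finset.smul_sum, ← Finset.smul_sum, hp, ← hws, smul_comm]
  have h2 := Fintype.linearIndependent_iff.1 hm (fun i => q * Polynomial.C (c i) - sPol * p i) (by
    simp only [sub_smul, Finset.sum_sub_distrib, h1, sub_self])
  funext i
  have h3 := congrArg (Polynomial.eval 1) (h2 i)
  simp only [Polynomial.eval_sub, Polynomial.eval_mul, Polynomial.eval_C, Polynomial.eval_one,
    Polynomial.eval_X, sub_self, zero_mul, sub_zero, Polynomial.eval_zero] at h3
  exact (mul_eq_zero.1 h3).resolve_left (mem_nonvanishing.1 hq)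

/-- The Taylor series at `1` of the entire function defined by an E-series. -/
def taylorOne (f : ℚ⟦X⟧) : ℂ⟦X⟧ := PowerSeries.mk fun j => value 1 (D^[j] f) / j.factorial

lemma coeff_taylorOne (j : ℕ) (f : ℚ⟦X⟧) :
    coeff j (taylorOne f) = value 1 (D^[j] f) / j.factorial := coeff_mk _ _

lemma coeff_zero_taylorOne (f : ℚ⟦X⟧) : coeff 0 (taylorOne f) = value 1 f := by
  simp [coeff_taylorOne]

lemma coeff_succ_taylorOne (j : ℕ) (f : ℚ⟦X⟧) :
    coeff (j + 1) (taylorOne f) = coeff j (taylorOne (D f)) / (j + 1) := by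
  rw [coeff_taylorOne, coeff_taylorOne, Function.iterate_succ_apply, Nat.factorial_succ]
  push_cast
  rw [div_div, mul_comm]

lemma taylorOne_add {f g : ℚ⟦X⟧} (hf : f ∈ eSeries) (hg : g ∈ eSeries) :
    taylorOne (f + g) = taylorOne f + taylorOne g := by
  ext j
  rw [map_add, coeff_taylorOne, coeff_taylorOne, coeff_taylorOne, ← add_div,
    ← value_add (iterate_D_mem_eSeries hf j) (iterate_D_mem_eSeries hg j)]
  congr 2
  exact iterate_map_add D j f g

lemma taylorOne_mul {f g : ℚ⟦X⟧} (hf : f ∈ eSeries) (hg : g ∈ eSeries) :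
    taylorOne (f * g) = taylorOne f * taylorOne g := by
  ext n
  induction n generalizing f g with
  | zero =>
    rw [coeff_zero_taylorOne, value_mul hf hg, ← coeff_zero_taylorOne, ← coeff_zero_taylorOne]
    simp
  | succ n ih =>
    have h0 : ∀ h : ℚ⟦X⟧, d⁄dX ℂ (taylorOne h) = taylorOne (D h) := by
      intro h
      ext k
      have : (k : ℂ) + 1 ≠ 0 := Nat.cast_add_one_ne_zero k
      rw [coeff_derivative, coeff_succ_taylorOne, div_mul_cancel₀ _ this]
    have h1 : coeff (n + 1) (taylorOne f * taylorOne g) =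
        coeff n (d⁄dX ℂ (taylorOne f * taylorOne g)) / (n + 1) := by
      have : (n : ℂ) + 1 ≠ 0 := Nat.cast_add_one_ne_zero n
      rw [coeff_derivative, mul_div_cancel_right₀ _ this]
    rw [h1, coeff_succ_taylorOne, Derivation.leibniz, Derivation.leibniz, smul_eq_mul, smul_eq_mul,
      taylorOne_add (mul_mem hf (D_mem_eSeries hg)) (mul_mem hg (D_mem_eSeries hf)), map_add,
      ih hf (D_mem_eSeries hg), ih hg (D_mem_eSeries hf), smul_eq_mul, smul_eq_mul, map_add,
      h0, h0]

lemma taylorOne_C (q : ℚ) : taylorOne (C q) = C (q : ℂ) := by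
  ext j
  rw [coeff_taylorOne, coeff_C]
  rcases j with _ | j
  · simp [value_C]
  · have : D^[j] (0 : ℚ⟦X⟧) = 0 := iterate_map_zero D j
    rw [Function.iterate_succ_apply, show D (C q) = 0 from derivative_C, this]
    simp [value]

lemma taylorOne_X : taylorOne X = 1 + X := by
  ext j
  rw [coeff_taylorOne, map_add, coeff_one, coeff_X]
  rcases j with _ | _ | j
  · simp [value_X]
  · have h1 : value 1 (1 : ℚ⟦X⟧) = 1 := by simpa using value_C 1 1
    simp [h1]
  · have : D^[j] (0 : ℚ⟦X⟧) = 0 := iterate_map_zero D j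
    have h1 : D (1 : ℚ⟦X⟧) = 0 := D.map_one_eq_zero
    rw [Function.iterate_succ_apply, Function.iterate_succ_apply, show D X = 1 from derivative_X,
      h1, this]
    simp [value]

lemma taylorOne_coe (p : Pol) :
    taylorOne (p : ℚ⟦X⟧) = PowerSeries.map (algebraMap ℚ ℂ) (Polynomial.aeval (1 + X : ℚ⟦X⟧) p) := by
  let F : eSeries →+* ℂ⟦X⟧ :=
    { toFun := fun f => taylorOne f
      map_one' := by simpa using taylorOne_C 1
      map_mul' := fun f g => taylorOne_mul f.2 g.2
      map_zero' := by simpa using taylorOne_C 0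
      map_add' := fun f g => taylorOne_add f.2 g.2 }
  let c : Pol →+* eSeries := (Polynomial.coeToPowerSeries.ringHom (R := ℚ)).codRestrict
    eSeries.toSubring coe_mem_eSeries
  have : F.comp c = (PowerSeries.map (algebraMap ℚ ℂ)).comp
      (Polynomial.aeval (1 + X : ℚ⟦X⟧) : Pol →ₐ[ℚ] ℚ⟦X⟧).toRingHom := by
    refine Polynomial.ringHom_ext (fun q => ?_) ?_
    · have h1 : (F.comp c) (Polynomial.C q) = taylorOne ((Polynomial.C q : Pol) : ℚ⟦X⟧) := rfl
      rw [h1, Polynomial.coe_C, taylorOne_C]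
      simp
    · have h1 : (F.comp c) Polynomial.X = taylorOne ((Polynomial.X : Pol) : ℚ⟦X⟧) := rfl
      rw [h1, Polynomial.coe_X, taylorOne_X]
      simp
  exact RingHom.congr_fun this p

lemma constantCoeff_aeval (p : Pol) :
    constantCoeff (Polynomial.aeval (1 + X : ℚ⟦X⟧) p) = p.eval 1 := by
  have := Polynomial.hom_eval₂ p (algebraMap ℚ ℚ⟦X⟧) (constantCoeff (R := ℚ)) (1 + X)
  rw [← Polynomial.aeval_def] at this
  rw [this]
  have h1 : (constantCoeff (R := ℚ)).comp (algebraMap ℚ ℚ⟦X⟧) = RingHom.id ℚ := Subsingleton.elim _ _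
  rw [h1, Polynomial.eval₂_id]
  simp

/-- The Taylor series at `1` of a basis of a lattice nonsingular at `1` are linearly independent over
`ℚ⟦X⟧`. -/
lemma eq_zero_of_sum_taylorOne {n : ℕ} {m : Fin n → ℚ⟦X⟧} (hm : LinearIndependent Pol m)
    (hM : IsLattice nonvanishing (Submodule.span Pol (Set.range m)))
    (hE : Submodule.span Pol (Set.range m) ≤ Subalgebra.toSubmodule eFun) {l : Fin n → ℚ⟦X⟧}
    (h : ∑ i, PowerSeries.map (algebraMap ℚ ℂ) (l i) * taylorOne (m i) = 0) : l = 0 := by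
  have key : ∀ N, (fun i => coeff N (l i)) = 0 := by
    intro N
    induction N using Nat.strong_induction_on with
    | _ N ih =>
      refine linearIndependent_value hm hM hE ?_
      have h1 := congrArg (coeff N) h
      rw [map_sum, map_zero] at h1
      rw [← h1]
      refine Finset.sum_congr rfl fun i _ => ?_
      rw [coeff_mul, Finset.sum_eq_single (N, 0)]
      · simp [coeff_zero_taylorOne, -coeff_zero_eq_constantCoeff]
      · rintro ⟨a, b⟩ hab hne
        rw [Finset.HasAntidiagonal.mem_antidiagonal] at hab
        have ha : a < N := by
          rcases Nat.eq_zero_or_pos b with rfl | hb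
          · exact absurd (by simpa using hab) hne
          · simp only at hab; omega
        have := congrFun (ih a ha) i
        simp only [Pi.zero_apply] at this
        simp [this]
      · simp
  funext i
  ext N
  exact congrFun (key N) i

lemma sum_neg_X_pow_taylorOne (f : ℚ⟦X⟧) (n : ℕ) :
    coeff n (∑ j ∈ Finset.range (n + 1),
      PowerSeries.map (algebraMap ℚ ℂ) (C ((-1) ^ j / j.factorial : ℚ) * X ^ j) *
        taylorOne (D^[j] f)) = coeff n (C (value 1 f)) := by
  rw [map_sum]
  have h1 : ∀ j ∈ Finset.range (n + 1), coeff n (PowerSeries.map (algebraMap ℚ ℂ)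
      (C ((-1) ^ j / j.factorial : ℚ) * X ^ j) * taylorOne (D^[j] f)) =
        ((((-1) ^ j * (n.choose j) : ℤ)) : ℂ) * (value 1 (D^[n] f) / n.factorial) := by
    intro j hj
    have hj' : j ≤ n := Nat.lt_succ_iff.1 (Finset.mem_range.1 hj)
    obtain ⟨k, rfl⟩ := Nat.exists_eq_add_of_le hj'
    have h0 : PowerSeries.map (algebraMap ℚ ℂ) (C ((-1) ^ j / j.factorial : ℚ) * X ^ j) =
        C ((-1) ^ j / j.factorial : ℂ) * X ^ j := by simp
    have hk : (k.factorial : ℂ) ≠ 0 := Nat.cast_ne_zero.2 k.factorial_ne_zero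
    have hj0 : (j.factorial : ℂ) ≠ 0 := Nat.cast_ne_zero.2 j.factorial_ne_zero
    have hkj : ((k + j).factorial : ℂ) ≠ 0 := Nat.cast_ne_zero.2 (k + j).factorial_ne_zero
    have h3 : (((k + j).choose j : ℕ) : ℂ) * k.factorial * j.factorial = (k + j).factorial := by
      exact_mod_cast Nat.add_choose_mul_factorial_mul_factorial k j
    rw [h0, mul_assoc, coeff_C_mul, add_comm j k, coeff_X_pow_mul, coeff_taylorOne,
      ← Function.iterate_add_apply]
    push_cast
    rw [← h3] at hkj ⊢
    have h4 := left_ne_zero_of_mul (left_ne_zero_of_mul hkj)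
    field_simp
  rw [Finset.sum_congr rfl h1, ← Finset.sum_mul]
  have h2 := Int.alternating_sum_range_choose (n := n)
  have h3 := congrArg (Int.cast : ℤ → ℂ) h2
  rw [Int.cast_sum] at h3
  rw [h3, coeff_C]
  rcases n with _ | n <;> simp

lemma taylorOne_smul {f : ℚ⟦X⟧} (hf : f ∈ eSeries) (p : Pol) : taylorOne (p • f) =
    PowerSeries.map (algebraMap ℚ ℂ) (Polynomial.aeval (1 + X : ℚ⟦X⟧) p) * taylorOne f := by
  rw [smul_def, taylorOne_mul (coe_mem_eSeries p) hf, taylorOne_coe]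

lemma taylorOne_sum {ι : Type*} (s : Finset ι) {f : ι → ℚ⟦X⟧} (hf : ∀ i ∈ s, f i ∈ eSeries) :
    taylorOne (∑ i ∈ s, f i) = ∑ i ∈ s, taylorOne (f i) := by
  classical
  induction s using Finset.induction_on with
  | empty => simpa using taylorOne_C 0
  | insert a s ha ih =>
    have h1 : ∀ i ∈ s, f i ∈ eSeries := fun i hi => hf i (Finset.mem_insert_of_mem hi)
    rw [Finset.sum_insert ha, Finset.sum_insert ha,
      taylorOne_add (hf a (Finset.mem_insert_self a s)) (sum_mem h1), ih h1]

/-- The derivatives of an element of a lattice nonsingular at `1` have Taylor series in the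
`ℚ⟦X⟧`-span of the Taylor series of generators. -/
lemma exists_taylorOne_iterate_eq {n : ℕ} {m : Fin n → ℚ⟦X⟧}
    (hM : IsLattice nonvanishing (Submodule.span Pol (Set.range m)))
    (hE : Submodule.span Pol (Set.range m) ≤ Subalgebra.toSubmodule eFun) {u : ℚ⟦X⟧}
    (hu : u ∈ Submodule.span Pol (Set.range m)) (j : ℕ) : ∃ g : Fin n → ℚ⟦X⟧,
      taylorOne (D^[j] u) = ∑ i, PowerSeries.map (algebraMap ℚ ℂ) (g i) * taylorOne (m i) := by
  have hmE : ∀ i, m i ∈ eSeries := fun i => (hE (Submodule.subset_span ⟨i, rfl⟩)).1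
  obtain ⟨-, T, hT, hTM⟩ := hM
  have h1 := pow_smul_iterate_mem hTM hu j
  obtain ⟨p, hp⟩ := (Submodule.mem_span_range_iff_exists_fun Pol).1 h1
  have h2 := congrArg taylorOne hp
  rw [taylorOne_sum _ fun i _ => smul_mem_eSeries (hmE i) _,
    taylorOne_smul (iterate_D_mem_eSeries (hE hu).1 j)] at h2
  have hT0 : constantCoeff (Polynomial.aeval (1 + X : ℚ⟦X⟧) (T ^ j)) ≠ 0 := by
    rw [constantCoeff_aeval, Polynomial.eval_pow]
    exact pow_ne_zero _ (mem_nonvanishing.1 hT)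
  set U := Polynomial.aeval (1 + X : ℚ⟦X⟧) (T ^ j)
  refine ⟨fun i => U⁻¹ * Polynomial.aeval (1 + X : ℚ⟦X⟧) (p i), ?_⟩
  have h3 : PowerSeries.map (algebraMap ℚ ℂ) U⁻¹ * PowerSeries.map (algebraMap ℚ ℂ) U = 1 := by
    rw [← map_mul, PowerSeries.inv_mul_cancel _ hT0, map_one]
  simp only [map_mul, mul_assoc]
  rw [← Finset.mul_sum, ← one_mul (taylorOne (D^[j] u)), ← h3, mul_assoc, ← h2]
  congr 1
  exact Finset.sum_congr rfl fun i _ => taylorOne_smul (hmE i) _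

/-- The constants `u(1)` lie in the `ℚ⟦X⟧`-span of the Taylor series of a lattice. -/
lemma exists_sum_taylorOne_eq_C {n : ℕ} {m : Fin n → ℚ⟦X⟧}
    (hM : IsLattice nonvanishing (Submodule.span Pol (Set.range m)))
    (hE : Submodule.span Pol (Set.range m) ≤ Subalgebra.toSubmodule eFun) {u : ℚ⟦X⟧}
    (hu : u ∈ Submodule.span Pol (Set.range m)) : ∃ l : Fin n → ℚ⟦X⟧,
      ∑ i, PowerSeries.map (algebraMap ℚ ℂ) (l i) * taylorOne (m i) = C (value 1 u) := by
  choose g hg using exists_taylorOne_iterate_eq hM hE hu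
  let t : ℕ → ℚ⟦X⟧ := fun j => C ((-1) ^ j / j.factorial : ℚ) * X ^ j
  have ht : ∀ j N (f : ℚ⟦X⟧), N < j → coeff N (t j * f) = 0 := by
    intro j N f h
    rw [show t j * f = X ^ j * (C ((-1) ^ j / j.factorial : ℚ) * f) by simp only [t]; ring]
    rw [coeff_X_pow_mul', if_neg (by omega)]
  refine ⟨fun i => PowerSeries.mk fun N => ∑ j ∈ Finset.range (N + 1), coeff N (t j * g j i), ?_⟩
  ext N
  rw [← sum_neg_X_pow_taylorOne u N]
  have h1 : ∑ j ∈ Finset.range (N + 1), PowerSeries.map (algebraMap ℚ ℂ)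
      (C ((-1) ^ j / j.factorial : ℚ) * X ^ j) * taylorOne (D^[j] u) =
      ∑ i, PowerSeries.map (algebraMap ℚ ℂ) (∑ j ∈ Finset.range (N + 1), t j * g j i) *
        taylorOne (m i) := by
    simp only [map_sum (PowerSeries.map (algebraMap ℚ ℂ)), Finset.sum_mul]
    rw [Finset.sum_comm]
    refine Finset.sum_congr rfl fun j _ => ?_
    rw [hg, Finset.mul_sum]
    refine Finset.sum_congr rfl fun i _ => ?_
    rw [← mul_assoc, ← map_mul]
  rw [h1, map_sum, map_sum]
  refine Finset.sum_congr rfl fun i _ => ?_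
  rw [coeff_mul, coeff_mul]
  refine Finset.sum_congr rfl fun ab hab => ?_
  rw [Finset.HasAntidiagonal.mem_antidiagonal] at hab
  rw [coeff_map, coeff_map, coeff_mk, map_sum (coeff ab.1)]
  congr 2
  have hle : ab.1 + 1 ≤ N + 1 := by omega
  refine Finset.sum_subset (Finset.range_mono hle) fun j _ hj => ht _ _ _ ?_
  simpa [Nat.lt_succ_iff] using hj

end EFun

namespace EFun

open PowerSeries Filter Topology

/-- The entire function `f` is the sum of the power series `F`. -/
def Represents (F : ℂ⟦X⟧) (f : ℂ → ℂ) : Prop := ∀ z, HasSum (fun n => coeff n F * z ^ n) (f z)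

lemma hasSum_of_eq {f g : ℕ → ℂ} {a : ℂ} (h : HasSum g a) (e : ∀ n, f n = g n) : HasSum f a := by
  rwa [funext e]

lemma Represents.summable_norm {F : ℂ⟦X⟧} {f : ℂ → ℂ} (h : Represents F f) (z : ℂ) :
    Summable fun n => ‖coeff n F * z ^ n‖ := (h z).summable.norm

lemma Represents.add {F G : ℂ⟦X⟧} {f g : ℂ → ℂ} (hf : Represents F f) (hg : Represents G g) :
    Represents (F + G) (f + g) := fun z => by
  simpa [add_mul] using (hf z).add (hg z)

lemma Represents.sub {F G : ℂ⟦X⟧} {f g : ℂ → ℂ} (hf : Represents F f) (hg : Represents G g) :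
    Represents (F - G) (f - g) := fun z => by
  simpa [sub_mul] using (hf z).sub (hg z)

lemma Represents.zero : Represents 0 0 := fun z => by simp

lemma Represents.sum {ι : Type*} (s : Finset ι) {F : ι → ℂ⟦X⟧} {f : ι → ℂ → ℂ}
    (h : ∀ i, Represents (F i) (f i)) : Represents (∑ i ∈ s, F i) (∑ i ∈ s, f i) := by
  classical
  induction s using Finset.induction_on with
  | empty => simpa using Represents.zero
  | insert a s ha ih => rw [Finset.sum_insert ha, Finset.sum_insert ha]; exact (h a).add ih

lemma Represents.mul {F G : ℂ⟦X⟧} {f g : ℂ → ℂ} (hf : Represents F f) (hg : Represents G g) :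
    Represents (F * G) (f * g) := fun z => by
  have h1 := tsum_mul_tsum_eq_tsum_sum_antidiagonal_of_summable_norm (hf.summable_norm z)
    (hg.summable_norm z)
  have h2 := (summable_norm_sum_mul_antidiagonal_of_summable_norm (hf.summable_norm z)
    (hg.summable_norm z)).of_norm.hasSum
  rw [← h1, (hf z).tsum_eq, (hg z).tsum_eq] at h2
  refine hasSum_of_eq h2 fun n => ?_
  rw [coeff_mul, Finset.sum_mul]
  refine Finset.sum_congr rfl fun ij hij => ?_
  rw [← Finset.HasAntidiagonal.mem_antidiagonal.1 hij, pow_add]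
  ring

lemma represents_coe (p : Polynomial ℂ) : Represents (p : ℂ⟦X⟧) fun z => p.eval z := fun z => by
  beta_reduce
  rw [Polynomial.eval_eq_sum_range]
  simp only [Polynomial.coeff_coe]
  refine hasSum_sum_of_ne_finset_zero fun n hn => ?_
  rw [Polynomial.coeff_eq_zero_of_natDegree_lt (by simpa [Nat.lt_succ_iff] using hn), zero_mul]

lemma Represents.eq_zero {F : ℂ⟦X⟧} (h : Represents F 0) : F = 0 := by
  let p : FormalMultilinearSeries ℂ ℂ ℂ := FormalMultilinearSeries.ofScalars ℂ fun n => coeff n F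
  have hp : ∀ n, p.coeff n = coeff n F := fun n => by
    simp [p, FormalMultilinearSeries.coeff_ofScalars]
  have h1 : HasFPowerSeriesAt (0 : ℂ → ℂ) p 0 := by
    rw [hasFPowerSeriesAt_iff]
    refine Eventually.of_forall fun z => ?_
    have := h z
    simp only [hp, smul_eq_mul, Pi.zero_apply] at this ⊢
    simpa only [mul_comm] using this
  have h2 := h1.eq_zero
  ext n
  rw [← hp, h2]
  simp [FormalMultilinearSeries.coeff]

lemma Represents.unique {F G : ℂ⟦X⟧} {f : ℂ → ℂ} (hF : Represents F f) (hG : Represents G f) :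
    F = G := by
  have := hF.sub hG
  rw [sub_self] at this
  exact sub_eq_zero.1 this.eq_zero

lemma Represents.differentiable {F : ℂ⟦X⟧} {f : ℂ → ℂ} (h : Represents F f) :
    Differentiable ℂ f := by
  intro z
  have h1 := Complex.differentiableOn_tsum_of_summable_norm (U := Metric.ball (0 : ℂ) (‖z‖ + 1))
    (F := fun n w => coeff n F * w ^ n) (h.summable_norm ((‖z‖ + 1 : ℝ) : ℂ))
    (fun n => by fun_prop) Metric.isOpen_ball (fun n w hw => by
      have hw' : ‖w‖ < ‖z‖ + 1 := by simpa using hw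
      rw [norm_mul, norm_mul, norm_pow, norm_pow, Complex.norm_real, Real.norm_of_nonneg (by positivity)]
      gcongr)
  have h2 : (fun w => ∑' n, coeff n F * w ^ n) = f := funext fun w => (h w).tsum_eq
  rw [h2] at h1
  exact h1.differentiableAt (Metric.isOpen_ball.mem_nhds (by simp))

lemma Represents.coeff_eq {F : ℂ⟦X⟧} {f : ℂ → ℂ} (h : Represents F f) (n : ℕ) :
    coeff n F = (n.factorial : ℂ)⁻¹ * iteratedDeriv n f 0 := by
  have h1 : Represents (PowerSeries.mk fun n => (n.factorial : ℂ)⁻¹ * iteratedDeriv n f 0) f := by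
    intro z
    refine hasSum_of_eq (Complex.hasSum_taylorSeries_of_entire h.differentiable 0 z) fun n => ?_
    rw [coeff_mk, smul_eq_mul, smul_eq_mul, sub_zero]
    ring
  rw [h.unique h1, coeff_mk]

lemma Represents.deriv {F : ℂ⟦X⟧} {f : ℂ → ℂ} (h : Represents F f) :
    Represents (d⁄dX ℂ F) (deriv f) := by
  intro z
  have hd : Differentiable ℂ (_root_.deriv f) := fun z =>
    (h.differentiable.analyticAt z).deriv.differentiableAt
  refine hasSum_of_eq (Complex.hasSum_taylorSeries_of_entire hd 0 z) fun n => ?_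
  have : (n : ℂ) + 1 ≠ 0 := Nat.cast_add_one_ne_zero n
  rw [coeff_derivative, h.coeff_eq, iteratedDeriv_succ', Nat.factorial_succ, smul_eq_mul,
    smul_eq_mul, sub_zero]
  push_cast
  field_simp

lemma Represents.iteratedDeriv {F : ℂ⟦X⟧} {f : ℂ → ℂ} (h : Represents F f) (j : ℕ) :
    Represents ((d⁄dX ℂ)^[j] F) (iteratedDeriv j f) := by
  induction j with
  | zero => simpa using h
  | succ j ih => rw [Function.iterate_succ_apply', iteratedDeriv_succ]; exact ih.deriv

lemma represents_value {f : ℚ⟦X⟧} (hf : f ∈ eSeries) :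
    Represents (PowerSeries.map (algebraMap ℚ ℂ) f) fun z => value z f := fun z => by
  simpa using hasSum_value hf z

lemma exists_retraction : ∃ l : ℂ →ₗ[ℚ] ℚ, ∀ q : ℚ, l q = q := by
  obtain ⟨l, hl⟩ := LinearMap.exists_leftInverse_of_injective (Algebra.linearMap ℚ ℂ)
    (LinearMap.ker_eq_bot.2 (algebraMap ℚ ℂ).injective)
  exact ⟨l, fun q => by simpa using LinearMap.congr_fun hl q⟩

lemma retraction_mul {l : ℂ →ₗ[ℚ] ℚ} (x : ℂ) (q : ℚ) : l (x * q) = l x * q := by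
  have : x * (q : ℂ) = q • x := by rw [mul_comm, Rat.smul_def]
  rw [this, map_smul, smul_eq_mul, mul_comm]

/-- A ratio of rational power series which is a complex polynomial is a rational polynomial. -/
lemma exists_eq_smul {u v : ℚ⟦X⟧} {G : Polynomial ℂ} (h : PowerSeries.map (algebraMap ℚ ℂ) u =
    (G : ℂ⟦X⟧) * PowerSeries.map (algebraMap ℚ ℂ) v) : ∃ p : Pol, u = p • v := by
  obtain ⟨l, hl⟩ := exists_retraction
  refine ⟨∑ i ∈ Finset.range (G.natDegree + 1), Polynomial.monomial i (l (G.coeff i)), ?_⟩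
  have hp : ∀ a, (∑ i ∈ Finset.range (G.natDegree + 1),
      Polynomial.monomial i (l (G.coeff i))).coeff a = l (G.coeff a) := by
    intro a
    rw [Polynomial.finsetSum_coeff]
    simp only [Polynomial.coeff_monomial, Finset.sum_ite_eq', Finset.mem_range]
    split_ifs with ha
    · rfl
    · rw [Polynomial.coeff_eq_zero_of_natDegree_lt (by omega), map_zero]
  ext n
  have h1 := congrArg (fun F => l (coeff n F)) h
  simp only [coeff_map, coeff_mul, map_sum, eq_ratCast, hl, retraction_mul,
    Polynomial.coeff_coe] at h1
  rw [h1, smul_def, coeff_mul]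
  simp only [Polynomial.coeff_coe, hp]

lemma norm_le_of_homogeneous {n : ℕ} (hn : 0 < n) {u v : ℂ} {c : ℕ → ℂ}
    (h : u ^ n + ∑ i ∈ Finset.range n, c i * (u ^ i * v ^ (n - i)) = 0) :
    ‖u‖ ≤ (1 + ∑ i ∈ Finset.range n, ‖c i‖) * ‖v‖ := by
  by_contra! hlt
  set K := ∑ i ∈ Finset.range n, ‖c i‖ with hK
  have hK0 : 0 ≤ K := Finset.sum_nonneg fun _ _ => norm_nonneg _
  have hv0 := norm_nonneg v
  have hvu : ‖v‖ ≤ ‖u‖ := by nlinarith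
  have hKv : K * ‖v‖ < ‖u‖ ∧ 0 < ‖u‖ := by constructor <;> nlinarith
  have h1 : ‖u‖ ^ n ≤ K * (‖u‖ ^ (n - 1) * ‖v‖) := by
    have h2 : u ^ n = -∑ i ∈ Finset.range n, c i * (u ^ i * v ^ (n - i)) :=
      eq_neg_of_add_eq_zero_left h
    rw [← norm_pow, h2, norm_neg, hK, Finset.sum_mul]
    refine (norm_sum_le _ _).trans (Finset.sum_le_sum fun i hi => ?_)
    have hi' := Finset.mem_range.1 hi
    rw [norm_mul, norm_mul, norm_pow, norm_pow]
    have h3 : ‖v‖ ^ (n - i) ≤ ‖u‖ ^ (n - 1 - i) * ‖v‖ := by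
      rw [show n - i = n - 1 - i + 1 by omega, pow_succ]
      gcongr
    have h4 : ‖u‖ ^ (n - 1) = ‖u‖ ^ i * ‖u‖ ^ (n - 1 - i) := by
      rw [← pow_add]; congr 1; omega
    rw [h4, mul_assoc (‖u‖ ^ i)]
    gcongr
  have h5 : ‖u‖ ^ n = ‖u‖ ^ (n - 1) * ‖u‖ := by
    rw [← pow_succ]; congr 1; omega
  have h6 : 0 < ‖u‖ ^ (n - 1) := pow_pos hKv.2 _
  nlinarith

lemma exists_norm_eval_le (p : Polynomial ℂ) : ∃ K : ℝ, 0 ≤ K ∧ ∃ d : ℕ, ∀ z : ℂ, ‖p.eval z‖ ≤ K * (1 + ‖z‖) ^ d := by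
  refine ⟨∑ i ∈ Finset.range (p.natDegree + 1), ‖p.coeff i‖,
    Finset.sum_nonneg fun _ _ => norm_nonneg _, p.natDegree, fun z => ?_⟩
  rw [Polynomial.eval_eq_sum_range, Finset.sum_mul]
  refine (norm_sum_le _ _).trans (Finset.sum_le_sum fun i hi => ?_)
  have hi' := Nat.lt_succ_iff.1 (Finset.mem_range.1 hi)
  rw [norm_mul, norm_pow]
  have h1 : ‖z‖ ^ i ≤ (1 + ‖z‖) ^ i := by gcongr; linarith
  have h2 : (1 + ‖z‖) ^ i ≤ (1 + ‖z‖) ^ p.natDegree :=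
    pow_le_pow_right₀ (by linarith [norm_nonneg z]) hi'
  gcongr
  exact h1.trans h2

lemma exists_sum_norm_eval_le (c : ℕ → Polynomial ℂ) (n : ℕ) : ∃ K : ℝ, 0 ≤ K ∧ ∃ d : ℕ, ∀ z : ℂ,
    1 + ∑ i ∈ Finset.range n, ‖(c i).eval z‖ ≤ K * (1 + ‖z‖) ^ d := by
  induction n with
  | zero => exact ⟨1, zero_le_one, 0, fun z => by simp⟩
  | succ n ih =>
    obtain ⟨K, hK, d, h⟩ := ih
    obtain ⟨L, hL, e, h'⟩ := exists_norm_eval_le (c n)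
    refine ⟨K + L, add_nonneg hK hL, d + e, fun z => ?_⟩
    have h1 : 1 ≤ 1 + ‖z‖ := by linarith [norm_nonneg z]
    rw [Finset.sum_range_succ, ← add_assoc, add_mul]
    refine add_le_add ((h z).trans ?_) ((h' z).trans ?_)
    · gcongr
      omega
    · gcongr
      omega

/-- `ℚ(X)` is algebraically closed in the field of fractions of rational E-series. -/
lemma exists_eq_smul_of_homogeneous {u v : ℚ⟦X⟧} (hu : u ∈ eSeries) (hv : v ∈ eSeries) (hv0 : v ≠ 0)
    {n : ℕ} (hn : 0 < n) {c : ℕ → Pol}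
    (h : u ^ n + ∑ i ∈ Finset.range n, c i • (u ^ i * v ^ (n - i)) = 0) : ∃ p : Pol, u = p • v := by
  have hmv : PowerSeries.map (algebraMap ℚ ℂ) v ≠ 0 := fun h0 => hv0
    (PowerSeries.map_injective _ (algebraMap ℚ ℂ).injective (by rw [h0, map_zero]))
  have hval0 : (fun z => value z v) ≠ 0 := fun h0 => hmv (by
    have := represents_value hv
    rw [h0] at this
    exact this.eq_zero)
  have hpow : ∀ {f : ℚ⟦X⟧}, f ∈ eSeries → ∀ (k : ℕ) z, value z (f ^ k) = value z f ^ k := by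
    intro f hf k z
    exact map_pow (valueHom z) ⟨f, hf⟩ k
  have hrel : ∀ z, value z u ^ n + ∑ i ∈ Finset.range n, ((c i).map (algebraMap ℚ ℂ)).eval z *
      (value z u ^ i * value z v ^ (n - i)) = 0 := by
    intro z
    have hmem : ∀ i ∈ Finset.range n, c i • (u ^ i * v ^ (n - i)) ∈ eSeries := fun i _ =>
      smul_mem_eSeries (mul_mem (pow_mem hu _) (pow_mem hv _)) _
    have h1 := congrArg (value z) h
    rw [value_add (pow_mem hu n) (sum_mem hmem), value_sum _ hmem, hpow hu] at h1
    have h2 : value z (0 : ℚ⟦X⟧) = 0 := by simp [value]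
    rw [h2] at h1
    rw [← h1]
    congr 1
    refine Finset.sum_congr rfl fun i _ => ?_
    rw [value_smul (mul_mem (pow_mem hu _) (pow_mem hv _)), value_mul (pow_mem hu _) (pow_mem hv _),
      hpow hu, hpow hv, Polynomial.eval_map_algebraMap]
  obtain ⟨K, -, d, hK⟩ := exists_sum_norm_eval_le (fun i => (c i).map (algebraMap ℚ ℂ)) n
  obtain ⟨G, hG⟩ := exists_polynomial_mul (represents_value hu).differentiable
    (represents_value hv).differentiable hval0 (K := K) (d := d) fun z =>
      (norm_le_of_homogeneous hn (hrel z)).trans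
        (mul_le_mul_of_nonneg_right (hK z) (norm_nonneg _))
  refine exists_eq_smul (G := G) ?_
  refine (represents_value hu).unique ?_
  have h3 := (represents_coe G).mul (represents_value hv)
  have h4 : (fun z => value z u) = (fun z => G.eval z) * fun z => value z v := funext hG
  rw [h4]
  exact h3

end EFun

namespace EFun

open scoped TensorProduct

lemma injective_productMap_of_isIntegral {A S T B E : Type*} [CommRing A] [CommRing S] [CommRing T]
    [CommRing B] [CommRing E] [IsDomain T] [Algebra A S] [Algebra A T] [Algebra A B] [Algebra A E]
    [Algebra S B] [Algebra S T] [Algebra B T] [IsScalarTower A S B] [IsScalarTower A S T]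
    [IsScalarTower A B T] [IsScalarTower S B T]
    [Algebra.IsIntegral S B] [IsDomain (B ⊗[A] E)] (τ : E →ₐ[A] T)
    (h : Function.Injective (Algebra.TensorProduct.productMap (IsScalarTower.toAlgHom A S T) τ)) :
    Function.Injective (Algebra.TensorProduct.productMap (IsScalarTower.toAlgHom A B T) τ) := by
  let g : S ⊗[A] E →ₐ[A] B ⊗[A] E :=
    Algebra.TensorProduct.map (IsScalarTower.toAlgHom A S B) (AlgHom.id A E)
  let _ : Algebra (S ⊗[A] E) (B ⊗[A] E) := g.toRingHom.toAlgebra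
  have hcomp : ∀ x, Algebra.TensorProduct.productMap (IsScalarTower.toAlgHom A B T) τ (g x) =
      Algebra.TensorProduct.productMap (IsScalarTower.toAlgHom A S T) τ x := by
    intro x
    induction x with
    | zero => simp
    | add u v hu hv => rw [map_add, map_add, map_add, hu, hv]
    | tmul s e => simp [g, ← IsScalarTower.algebraMap_apply S B T]
  have hnt : Nontrivial (S ⊗[A] E) := g.toRingHom.domain_nontrivial
  have hint : Algebra.IsIntegral (S ⊗[A] E) (B ⊗[A] E) := by
    refine ⟨fun x => ?_⟩
    induction x with
    | zero => exact isIntegral_zero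
    | add u v hu hv => exact hu.add hv
    | tmul b e =>
      have h1 : b ⊗ₜ[A] e = (b ⊗ₜ[A] (1 : E)) * ((1 : B) ⊗ₜ[A] e) := by simp
      rw [h1]
      refine IsIntegral.mul ?_ ?_
      · obtain ⟨p, hp, hpb⟩ := Algebra.IsIntegral.isIntegral (R := S) b
        refine ⟨p.map (Algebra.TensorProduct.includeLeft : S →ₐ[A] S ⊗[A] E).toRingHom, hp.map _, ?_⟩
        rw [Polynomial.eval₂_map]
        have h2 := Polynomial.hom_eval₂ p (algebraMap S B)
          (Algebra.TensorProduct.includeLeft : B →ₐ[A] B ⊗[A] E).toRingHom b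
        rw [hpb, map_zero] at h2
        have h3 : (algebraMap (S ⊗[A] E) (B ⊗[A] E)).comp
            (Algebra.TensorProduct.includeLeft : S →ₐ[A] S ⊗[A] E).toRingHom =
            (Algebra.TensorProduct.includeLeft : B →ₐ[A] B ⊗[A] E).toRingHom.comp
              (algebraMap S B) := by
          ext s
          change g (s ⊗ₜ 1) = (algebraMap S B s) ⊗ₜ 1
          simp [g]
        rw [h3]
        exact h2.symm
      · have h2 : (1 : B) ⊗ₜ[A] e = algebraMap (S ⊗[A] E) (B ⊗[A] E) (1 ⊗ₜ e) := by
          change _ = g (1 ⊗ₜ e)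
          simp [g]
        rw [h2]
        exact isIntegral_algebraMap
  have hker : RingHom.ker (Algebra.TensorProduct.productMap (IsScalarTower.toAlgHom A B T) τ) = ⊥ := by
    refine Ideal.eq_bot_of_comap_eq_bot (R := S ⊗[A] E) ?_
    rw [eq_bot_iff]
    intro x hx
    have hx' : Algebra.TensorProduct.productMap (IsScalarTower.toAlgHom A B T) τ (g x) = 0 := hx
    rw [hcomp] at hx'
    exact h (hx'.trans (map_zero _).symm)
  exact (RingHom.injective_iff_ker_eq_bot _).2 hker

end EFun

namespace EFun

section

open scoped TensorProduct

theorem isDomain_tensor_of_isDomain {A E B : Type*} [CommRing A] [IsDomain A] [IsPrincipalIdealRing A]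
    [CharZero A] [CommRing E] [IsDomain E] [CommRing B] [IsDomain B] [Algebra A E] [Algebra A B]
    [FaithfulSMul A E] [FaithfulSMul A B]
    (h : ∀ u v : E, v ≠ 0 → (∃ n : ℕ, 0 < n ∧ ∃ c : ℕ → A,
      u ^ n + ∑ i ∈ Finset.range n, c i • (u ^ i * v ^ (n - i)) = 0) → ∃ p : A, u = p • v) :
    IsDomain (B ⊗[A] E) := by
  have hF : FaithfulSMul A (FractionRing B) := by
    rw [faithfulSMul_iff_algebraMap_injective, IsScalarTower.algebraMap_eq A B (FractionRing B)]
    exact (IsFractionRing.injective B _).comp (FaithfulSMul.algebraMap_injective A B)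
  have hE : Module.IsTorsionFree A E := Module.isTorsionFree_iff_faithfulSMul.2 inferInstance
  have hnz : NoZeroDivisors (FractionRing B ⊗[A] E) := noZeroDivisors_tensor h
  let g : B ⊗[A] E →ₐ[A] FractionRing B ⊗[A] E :=
    Algebra.TensorProduct.map (IsScalarTower.toAlgHom A B (FractionRing B)) (AlgHom.id A E)
  have hg : Function.Injective g :=
    Module.Flat.rTensor_preserves_injective_linearMap (M := E)
      (IsScalarTower.toAlgHom A B (FractionRing B)).toLinearMap (IsFractionRing.injective B _)
  have h1 : NoZeroDivisors (B ⊗[A] E) := hg.noZeroDivisors g (map_zero g) (map_mul g)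
  have h2 : Nontrivial (B ⊗[A] E) :=
    (Algebra.TensorProduct.includeRight_injective (A := B) (B := E)
      (FaithfulSMul.algebraMap_injective A B)).nontrivial
  exact NoZeroDivisors.to_isDomain _

end

open PowerSeries

/-- Power series, viewed as an algebra over the polynomials in the variable `1 + X`. -/
def Shift (F : Type*) [CommRing F] : Type _ := F⟦X⟧

instance (F : Type*) [CommRing F] : CommRing (Shift F) := inferInstanceAs (CommRing F⟦X⟧)

instance (F : Type*) [Field F] : IsDomain (Shift F) := inferInstanceAs (IsDomain F⟦X⟧)

instance : Algebra Pol (Shift ℚ) :=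
  (Polynomial.aeval (1 + X : ℚ⟦X⟧) : Pol →ₐ[ℚ] ℚ⟦X⟧).toRingHom.toAlgebra

instance : Algebra (Shift ℚ) (Shift ℂ) := (PowerSeries.map (algebraMap ℚ ℂ)).toAlgebra

instance : Algebra Pol (Shift ℂ) :=
  ((PowerSeries.map (algebraMap ℚ ℂ)).comp
    (Polynomial.aeval (1 + X : ℚ⟦X⟧) : Pol →ₐ[ℚ] ℚ⟦X⟧).toRingHom).toAlgebra

instance : IsScalarTower Pol (Shift ℚ) (Shift ℂ) := IsScalarTower.of_algebraMap_eq fun _ => rfl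

lemma algebraMap_pol_shift (p : Pol) : algebraMap Pol (Shift ℂ) p =
    PowerSeries.map (algebraMap ℚ ℂ) (Polynomial.aeval (1 + X : ℚ⟦X⟧) p) := rfl

lemma aeval_one_add_X_injective :
    Function.Injective (Polynomial.aeval (1 + X : ℚ⟦X⟧) : Pol →ₐ[ℚ] ℚ⟦X⟧) := by
  have h : ∀ p : Pol, Polynomial.aeval (1 + X : ℚ⟦X⟧) p = ((Polynomial.taylor 1 p : Pol) : ℚ⟦X⟧) := by
    intro p
    have h2 : (Polynomial.coeToPowerSeries.algHom ℚ) (Polynomial.X + Polynomial.C 1 : Pol) =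
        (1 + X : ℚ⟦X⟧) := by
      simp [Polynomial.coeToPowerSeries.algHom_apply, add_comm]
    have h3 : ((Polynomial.taylor 1 p : Pol) : ℚ⟦X⟧) =
        Polynomial.coeToPowerSeries.algHom ℚ (Polynomial.taylor 1 p) := by
      simp [Polynomial.coeToPowerSeries.algHom_apply]
    rw [h3, Polynomial.taylor_apply, ← h2, Polynomial.comp_eq_aeval, Polynomial.aeval_algHom_apply]
  intro p q hpq
  rw [h, h] at hpq
  exact Polynomial.taylor_injective 1 (Polynomial.coe_injective _ hpq)

/-- The integral closure of `ℚ⟦X⟧` in `ℂ⟦X⟧`. -/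
abbrev IntShift : Subalgebra (Shift ℚ) (Shift ℂ) := integralClosure (Shift ℚ) (Shift ℂ)

instance : FaithfulSMul Pol IntShift := by
  rw [faithfulSMul_iff_algebraMap_injective]
  refine Function.Injective.of_comp (f := Subtype.val) ?_
  exact (PowerSeries.map_injective _ (algebraMap ℚ ℂ).injective).comp aeval_one_add_X_injective

instance : FaithfulSMul Pol eFun := by
  rw [faithfulSMul_iff_algebraMap_injective]
  refine Function.Injective.of_comp (f := Subtype.val) ?_
  exact FaithfulSMul.algebraMap_injective Pol ℚ⟦X⟧

/-- Taylor expansion at `1` as an algebra homomorphism. -/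
def taylorHom : eFun →ₐ[Pol] Shift ℂ where
  toFun f := taylorOne f
  map_one' := by
    have h : taylorOne 1 = 1 := by simpa using taylorOne_C 1
    exact h
  map_mul' f g := taylorOne_mul f.2.1 g.2.1
  map_zero' := by
    have h : taylorOne 0 = 0 := by simpa using taylorOne_C 0
    exact h
  map_add' f g := taylorOne_add f.2.1 g.2.1
  commutes' p := by
    rw [algebraMap_pol_shift, ← taylorOne_coe]
    rfl

end EFun

namespace EFun

open PowerSeries
open scoped TensorProduct

lemma exists_basis_finset {ι : Type*} (s : Finset ι) (f : ι → eFun) : ∃ n, ∃ m : Fin n → eFun,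
    LinearIndependent Pol m ∧
    IsLattice nonvanishing (Submodule.span Pol (Set.range fun k => (m k : ℚ⟦X⟧))) ∧
    ∀ i ∈ s, f i ∈ Submodule.span Pol (Set.range m) := by
  obtain ⟨M, hM, hME, hfM⟩ := exists_lattice_finset s (fun i => (f i : ℚ⟦X⟧)) fun i _ => (f i).2
  obtain ⟨n, m, hm, rfl⟩ := hM.free
  have hmE : ∀ k, m k ∈ eFun := fun k => hME (Submodule.subset_span (Set.mem_range_self k))
  refine ⟨n, fun k => ⟨m k, hmE k⟩, ?_, hM, fun i hi => ?_⟩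
  · exact LinearIndependent.of_comp eFun.val.toLinearMap hm
  · obtain ⟨c, hc⟩ := (Submodule.mem_span_range_iff_exists_fun Pol).1 (hfM i hi)
    refine (Submodule.mem_span_range_iff_exists_fun Pol).2 ⟨c, Subtype.ext ?_⟩
    rw [← hc]
    simp

lemma span_le_eFun {n : ℕ} (m : Fin n → eFun) :
    Submodule.span Pol (Set.range fun k => (m k : ℚ⟦X⟧)) ≤ Subalgebra.toSubmodule eFun := by
  rw [Submodule.span_le]
  rintro _ ⟨k, rfl⟩
  exact (m k).2

lemma linearIndependent_coe {n : ℕ} {m : Fin n → eFun} (hm : LinearIndependent Pol m) :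
    LinearIndependent Pol fun k => (m k : ℚ⟦X⟧) :=
  hm.map' eFun.val.toLinearMap (LinearMap.ker_eq_bot.2 Subtype.val_injective)

lemma injective_productMap_shift : Function.Injective
    (Algebra.TensorProduct.productMap (IsScalarTower.toAlgHom Pol (Shift ℚ) (Shift ℂ)) taylorHom) := by
  rw [injective_iff_map_eq_zero]
  intro x hx
  obtain ⟨s, rfl⟩ := TensorProduct.exists_finset x
  obtain ⟨n, m, hm, hM, hs⟩ := exists_basis_finset s Prod.snd
  choose! c hc using fun i hi => (Submodule.mem_span_range_iff_exists_fun Pol).1 (hs i hi)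
  have h1 : ∑ i ∈ s, i.1 ⊗ₜ[Pol] i.2 = ∑ k, (∑ i ∈ s, c i k • i.1) ⊗ₜ[Pol] m k := by
    simp_rw [TensorProduct.sum_tmul]
    rw [Finset.sum_comm]
    refine Finset.sum_congr rfl fun i hi => ?_
    conv_lhs => rw [← hc i hi]
    rw [TensorProduct.tmul_sum]
    exact Finset.sum_congr rfl fun k _ => by rw [TensorProduct.tmul_smul, TensorProduct.smul_tmul']
  rw [h1] at hx ⊢
  have h2 : (fun k => ∑ i ∈ s, c i k • i.1 : Fin n → Shift ℚ) = 0 := by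
    refine eq_zero_of_sum_taylorOne (linearIndependent_coe hm) hM (span_le_eFun m) ?_
    rw [map_sum] at hx
    exact hx
  refine Finset.sum_eq_zero fun k _ => ?_
  rw [congrFun h2 k]
  simp

instance : Module.IsTorsionFree Pol IntShift := Module.isTorsionFree_iff_faithfulSMul.2 inferInstance

lemma injective_productMap_intShift : Function.Injective
    (Algebra.TensorProduct.productMap (IsScalarTower.toAlgHom Pol IntShift (Shift ℂ)) taylorHom) := by
  have : IsDomain (IntShift ⊗[Pol] eFun) := by
    refine isDomain_tensor_of_isDomain fun u v hv ⟨n, hn, c, h⟩ => ?_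
    obtain ⟨p, hp⟩ := exists_eq_smul_of_homogeneous u.2.1 v.2.1 (fun h0 => hv (Subtype.ext h0)) hn
      (c := c) (by simpa using congrArg Subtype.val h)
    exact ⟨p, Subtype.ext hp⟩
  exact injective_productMap_of_isIntegral taylorHom injective_productMap_shift

/-- Constant power series. -/
def shiftC (F : Type*) [CommRing F] : F →+* Shift F := (C : F →+* F⟦X⟧)

lemma isIntegral_shiftC {κ : ℂ} (h : IsAlgebraic ℚ κ) : IsIntegral (Shift ℚ) (shiftC ℂ κ) := by
  obtain ⟨p, hp, hpk⟩ := h.isIntegral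
  refine ⟨p.map (shiftC ℚ), hp.map _, ?_⟩
  have h2 := Polynomial.hom_eval₂ p (algebraMap ℚ ℂ) (shiftC ℂ) κ
  rw [hpk, map_zero] at h2
  rw [Polynomial.eval₂_map]
  have h3 : (algebraMap (Shift ℚ) (Shift ℂ)).comp (shiftC ℚ) =
      (shiftC ℂ).comp (algebraMap ℚ ℂ) :=
    RingHom.ext fun q => PowerSeries.map_C (algebraMap ℚ ℂ) q
  rw [h3]
  exact h2.symm

/-- Linear independence over `ℚ` of algebraic numbers is preserved over the field of values at `1` of
rational E-functions. -/
theorem value_eq_zero_of_sum {ι : Type*} [Fintype ι] {κ : ι → ℂ} (hκ : LinearIndependent ℚ κ)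
    (halg : ∀ i, IsAlgebraic ℚ (κ i)) {u : ι → ℚ⟦X⟧} (hu : ∀ i, u i ∈ eFun)
    (h : ∑ i, κ i * value 1 (u i) = 0) (i : ι) : value 1 (u i) = 0 := by
  obtain ⟨n, m, hm, hM, hs⟩ := exists_basis_finset Finset.univ fun i => (⟨u i, hu i⟩ : eFun)
  have hu' : ∀ i, u i ∈ Submodule.span Pol (Set.range fun k => (m k : ℚ⟦X⟧)) := by
    intro i
    obtain ⟨c, hc⟩ := (Submodule.mem_span_range_iff_exists_fun Pol).1 (hs i (Finset.mem_univ i))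
    exact (Submodule.mem_span_range_iff_exists_fun Pol).2
      ⟨c, by simpa using congrArg Subtype.val hc⟩
  choose l hl using fun i => exists_sum_taylorOne_eq_C hM (span_le_eFun m) (hu' i)
  let b : ι → IntShift := fun i => ⟨C (κ i), isIntegral_shiftC (halg i)⟩
  let L : Fin n → IntShift := fun k => ∑ i, b i * algebraMap (Shift ℚ) IntShift (l i k)
  have hLcoe : ∀ k, (L k : Shift ℂ) = ∑ i, C (κ i) * PowerSeries.map (algebraMap ℚ ℂ) (l i k) := by
    intro k
    simp only [L, AddSubmonoidClass.coe_finsetSum]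
    rfl
  have hx : ∑ k, L k ⊗ₜ[Pol] m k = 0 := by
    refine injective_productMap_intShift ?_
    rw [map_sum, map_zero]
    have h1 : ∀ k, Algebra.TensorProduct.productMap (IsScalarTower.toAlgHom Pol IntShift (Shift ℂ))
        taylorHom (L k ⊗ₜ[Pol] m k) =
        (∑ i, C (κ i) * PowerSeries.map (algebraMap ℚ ℂ) (l i k)) * taylorOne (m k) := by
      intro k
      rw [← hLcoe]
      rfl
    rw [Finset.sum_congr rfl fun k _ => h1 k]
    change (∑ k, (∑ i, C (κ i) * PowerSeries.map (algebraMap ℚ ℂ) (l i k)) * taylorOne (m k) :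
      ℂ⟦X⟧) = 0
    simp_rw [Finset.sum_mul, mul_assoc]
    rw [Finset.sum_comm]
    simp_rw [← Finset.mul_sum, hl, ← map_mul]
    rw [← map_sum, h, map_zero]
  have hL : ∀ k, L k = 0 := by
    have h2 := Fintype.linearIndependent_iff.1 (Module.Flat.linearIndependent_one_tmul (S := IntShift) hm)
    refine h2 L ?_
    rw [← hx]
    refine Finset.sum_congr rfl fun k _ => ?_
    rw [TensorProduct.smul_tmul', smul_eq_mul, mul_one]
  have hl0 : ∀ k i, l i k = 0 := by
    intro k i
    ext N
    refine Fintype.linearIndependent_iff.1 hκ (fun i => coeff N (l i k)) ?_ i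
    have h3 : (∑ i, C (κ i) * PowerSeries.map (algebraMap ℚ ℂ) (l i k) : ℂ⟦X⟧) = 0 :=
      (hLcoe k).symm.trans (congrArg Subtype.val (hL k))
    have h4 := congrArg (coeff N) h3
    rw [map_sum, map_zero] at h4
    rw [← h4]
    refine Finset.sum_congr rfl fun i _ => ?_
    rw [coeff_C_mul, coeff_map, Algebra.smul_def, mul_comm]
  have h5 := hl i
  simp only [hl0, map_zero, zero_mul, Finset.sum_const_zero] at h5
  exact C_injective (h5.symm.trans (map_zero C).symm)

end EFun

namespace EFun

open PowerSeries

section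

variable {K : Type*} [Field K] [Algebra ℚ K]

/-- Apply a linear functional to the coefficients of a power series. -/
def mapCoeff (l : K →ₗ[ℚ] ℚ) (F : K⟦X⟧) : ℚ⟦X⟧ := PowerSeries.mk fun n => l (coeff n F)

lemma coeff_mapCoeff (l : K →ₗ[ℚ] ℚ) (F : K⟦X⟧) (n : ℕ) : coeff n (mapCoeff l F) = l (coeff n F) :=
  coeff_mk _ _

lemma mapCoeff_add (l : K →ₗ[ℚ] ℚ) (F G : K⟦X⟧) :
    mapCoeff l (F + G) = mapCoeff l F + mapCoeff l G := by
  ext n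
  simp [coeff_mapCoeff]

lemma mapCoeff_sum (l : K →ₗ[ℚ] ℚ) {ι : Type*} (s : Finset ι) (F : ι → K⟦X⟧) :
    mapCoeff l (∑ i ∈ s, F i) = ∑ i ∈ s, mapCoeff l (F i) := by
  ext n
  rw [coeff_mapCoeff, map_sum (coeff n), map_sum (coeff n), map_sum]
  exact Finset.sum_congr rfl fun i _ => (coeff_mapCoeff l (F i) n).symm

lemma mapCoeff_derivative (l : K →ₗ[ℚ] ℚ) (F : K⟦X⟧) :
    mapCoeff l (d⁄dX K F) = D (mapCoeff l F) := by
  ext n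
  rw [coeff_mapCoeff, coeff_derivative, coeff_derivative, coeff_mapCoeff]
  have : coeff (n + 1) F * ((n : K) + 1) = ((n : ℚ) + 1) • coeff (n + 1) F := by
    rw [Algebra.smul_def, mul_comm, map_add, map_one, map_natCast]
  rw [this, map_smul, smul_eq_mul, mul_comm]

lemma mapCoeff_iterate_derivative (l : K →ₗ[ℚ] ℚ) (F : K⟦X⟧) (j : ℕ) :
    mapCoeff l ((d⁄dX K)^[j] F) = D^[j] (mapCoeff l F) := by
  induction j generalizing F with
  | zero => rfl
  | succ j ih => rw [Function.iterate_succ_apply, Function.iterate_succ_apply, ih, mapCoeff_derivative]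

lemma mapCoeff_X_pow_mul (l : K →ₗ[ℚ] ℚ) (F : K⟦X⟧) (n : ℕ) :
    mapCoeff l (X ^ n * F) = X ^ n * mapCoeff l F := by
  ext k
  rw [coeff_mapCoeff, coeff_X_pow_mul', coeff_X_pow_mul']
  split_ifs
  · rw [coeff_mapCoeff]
  · simp

lemma mapCoeff_C_mul {ι : Type*} [Fintype ι] (b : Module.Basis ι ℚ K) (l : K →ₗ[ℚ] ℚ) (a : K)
    (F : K⟦X⟧) : mapCoeff l (C a * F) = ∑ i, C (l (a * b i)) * mapCoeff (b.coord i) F := by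
  ext n
  rw [coeff_mapCoeff, coeff_C_mul, map_sum (coeff n)]
  conv_lhs => rw [← b.sum_repr (coeff n F)]
  rw [Finset.mul_sum, map_sum]
  refine Finset.sum_congr rfl fun i _ => ?_
  rw [coeff_C_mul, coeff_mapCoeff, mul_smul_comm, map_smul, smul_eq_mul, mul_comm]
  rfl

lemma mapCoeff_mul_mem {ι : Type*} [Fintype ι] (b : Module.Basis ι ℚ K) (l : K →ₗ[ℚ] ℚ)
    (q : Polynomial K) (F : K⟦X⟧) (M : Submodule Pol ℚ⟦X⟧) (h : ∀ i, mapCoeff (b.coord i) F ∈ M) :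
    mapCoeff l ((q : K⟦X⟧) * F) ∈ M := by
  induction q using Polynomial.induction_on' with
  | add p q hp hq =>
    rw [Polynomial.coe_add, add_mul, mapCoeff_add]
    exact add_mem hp hq
  | monomial n a =>
    have h1 : ((Polynomial.monomial n a : Polynomial K) : K⟦X⟧) * F = X ^ n * (C a * F) := by
      rw [← Polynomial.C_mul_X_pow_eq_monomial]
      simp
      ring
    rw [h1, mapCoeff_X_pow_mul, mapCoeff_C_mul b, Finset.mul_sum]
    refine sum_mem fun i _ => ?_
    have h2 : (X : ℚ⟦X⟧) ^ n * (C (l (a * b i)) * mapCoeff (b.coord i) F) =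
        (Polynomial.X ^ n * Polynomial.C (l (a * b i)) : Pol) • mapCoeff (b.coord i) F := by
      rw [smul_def]
      simp
      ring
    rw [h2]
    exact M.smul_mem _ (h i)

lemma mapCoeff_map_mul (l : K →ₗ[ℚ] ℚ) (Q : Pol) (F : K⟦X⟧) :
    mapCoeff l (((Q.map (algebraMap ℚ K) : Polynomial K) : K⟦X⟧) * F) = Q • mapCoeff l F := by
  rw [smul_def]
  ext n
  rw [coeff_mapCoeff, coeff_mul, coeff_mul, map_sum]
  refine Finset.sum_congr rfl fun i _ => ?_
  rw [Polynomial.coeff_coe, Polynomial.coeff_coe, Polynomial.coeff_map, ← Algebra.smul_def, map_smul,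
    coeff_mapCoeff, smul_eq_mul]

lemma exists_mul_eq_map [FiniteDimensional ℚ K] {q : Polynomial K} (hq : q ≠ 0) :
    ∃ p : Polynomial K, ∃ Q : Pol, Q ≠ 0 ∧ p * q = Q.map (algebraMap ℚ K) := by
  let _ : Algebra Pol (Polynomial K) := Polynomial.algebra ℚ K
  have h1 : (Ideal.span {q}).comap (algebraMap Pol (Polynomial K)) ≠ ⊥ := fun h =>
    hq (Ideal.span_singleton_eq_bot.1 (Ideal.eq_bot_of_comap_eq_bot h))
  obtain ⟨Q, hQ, hQ0⟩ := Submodule.exists_mem_ne_zero_of_ne_bot h1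
  obtain ⟨p, hp⟩ := Ideal.mem_span_singleton'.1 (Ideal.mem_comap.1 hQ)
  exact ⟨p, Q, hQ0, hp⟩

/-- The coordinates of a solution of a differential equation over `K[X]` are solutions of
differential equations over `ℚ[X]`. -/
lemma hasLattice_mapCoeff [FiniteDimensional ℚ K] {F : K⟦X⟧} {q : ℕ → Polynomial K} {r : ℕ}
    (hq : q r ≠ 0) (h : ∑ j ∈ Finset.range (r + 1), (q j : K⟦X⟧) * (d⁄dX K)^[j] F = 0)
    {ι : Type*} [Fintype ι] (b : Module.Basis ι ℚ K) (i : ι) :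
    HasLattice (nonZeroDivisors Pol) (mapCoeff (b.coord i) F) := by
  obtain ⟨p, Q, hQ, hpq⟩ := exists_mul_eq_map hq
  let M : Submodule Pol ℚ⟦X⟧ := ⨆ i, derivSpan (mapCoeff (b.coord i) F) r
  have hM : ∀ (i) {j}, j < r → D^[j] (mapCoeff (b.coord i) F) ∈ M := fun i j hj =>
    Submodule.mem_iSup_of_mem i (iterate_mem_derivSpan _ hj)
  have hr : ∀ i, Q • D^[r] (mapCoeff (b.coord i) F) ∈ M := by
    intro i
    have h1 : ((Q.map (algebraMap ℚ K) : Polynomial K) : K⟦X⟧) * (d⁄dX K)^[r] F =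
        ∑ j ∈ Finset.range r, ((-p * q j : Polynomial K) : K⟦X⟧) * (d⁄dX K)^[j] F := by
      rw [Finset.sum_range_succ, add_eq_zero_iff_neg_eq] at h
      rw [← hpq, Polynomial.coe_mul, mul_assoc, ← h, ← Finset.sum_neg_distrib, Finset.mul_sum]
      refine Finset.sum_congr rfl fun j _ => ?_
      simp only [Polynomial.coe_mul, Polynomial.coe_neg]
      ring
    rw [← mapCoeff_iterate_derivative, ← mapCoeff_map_mul, h1, mapCoeff_sum]
    refine sum_mem fun j hj => mapCoeff_mul_mem b _ _ _ _ fun k => ?_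
    rw [mapCoeff_iterate_derivative]
    exact hM k (Finset.mem_range.1 hj)
  rcases Nat.eq_zero_or_pos r with rfl | hr0
  · refine hasLattice_of_smul_mem (r := 0) (mem_nonZeroDivisors_of_ne_zero hQ) ?_
    have h2 := hr i
    have h3 : M = ⊥ := by simp [M, derivSpan]
    rw [h3] at h2
    rw [(Submodule.mem_bot _).1 h2]
    exact zero_mem _
  · refine ⟨M, ⟨Submodule.fg_iSup _ fun i => derivSpan_fg _ _, Q, mem_nonZeroDivisors_of_ne_zero hQ,
      fun x hx => ?_⟩, hM i hr0⟩
    induction hx using Submodule.iSup_induction' with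
    | zero => simp
    | add x y _ _ hx hy => rw [map_add, smul_add]; exact add_mem hx hy
    | mem k x hx =>
      induction hx using Submodule.span_induction with
      | mem x hx =>
        obtain ⟨j, hj, rfl⟩ := hx
        simp only [← Function.iterate_succ_apply' (f := D)]
        rcases (Nat.succ_le_of_lt hj).lt_or_eq with hj | hj
        · exact Submodule.smul_mem _ _ (hM k hj)
        · rw [hj]; exact hr k
      | zero => simp
      | add x y _ _ hx hy => rw [map_add, smul_add]; exact add_mem hx hy
      | smul p x h hx =>
        rw [D_smul, smul_add, smul_comm]
        exact add_mem (Submodule.smul_mem _ _ hx) (Submodule.smul_mem _ _ (Submodule.smul_mem _ _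
          (Submodule.mem_iSup_of_mem k h)))

end

lemma exists_leading {K : Type*} [Field K] {F : K⟦X⟧} {q : ℕ → Polynomial K} {R : ℕ} (hq : ∃ j ≤ R, q j ≠ 0)
    (h : ∑ j ∈ Finset.range (R + 1), (q j : K⟦X⟧) * (d⁄dX K)^[j] F = 0) :
    ∃ r, q r ≠ 0 ∧ ∑ j ∈ Finset.range (r + 1), (q j : K⟦X⟧) * (d⁄dX K)^[j] F = 0 := by
  induction R with
  | zero =>
    obtain ⟨j, hj, hj0⟩ := hq
    obtain rfl : j = 0 := by omega
    exact ⟨0, hj0, h⟩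
  | succ R ih =>
    by_cases h0 : q (R + 1) = 0
    · refine ih ?_ ?_
      · obtain ⟨j, hj, hj0⟩ := hq
        refine ⟨j, ?_, hj0⟩
        have : j ≠ R + 1 := fun e => hj0 (e ▸ h0)
        omega
      · rwa [Finset.sum_range_succ, h0, Polynomial.coe_zero, zero_mul, add_zero] at h
    · exact ⟨R + 1, h0, h⟩

end EFun

namespace EFun

open PowerSeries

lemma exists_eq_trace {K : Type*} [Field K] [Algebra ℚ K] [FiniteDimensional ℚ K] (l : K →ₗ[ℚ] ℚ) :
    ∃ θ : K, ∀ x, l x = Algebra.trace ℚ K (θ * x) := by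
  obtain ⟨θ, h⟩ := ((Algebra.traceForm ℚ K).toDual (traceForm_nondegenerate ℚ K)).surjective l
  exact ⟨θ, fun x => by rw [← h]; rfl⟩

lemma exists_nat_isIntegral {K : Type*} [Field K] [Algebra ℚ K] {θ : K} (h : IsAlgebraic ℚ θ) :
    ∃ t : ℕ, 0 < t ∧ IsIntegral ℤ ((t : K) * θ) := by
  obtain ⟨t, ht, h⟩ := ((IsFractionRing.isAlgebraic_iff ℤ ℚ K).2 h).exists_integral_multiple
  refine ⟨t.natAbs, Int.natAbs_pos.2 ht, ?_⟩
  rcases Int.natAbs_eq t with h1 | h1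
  · rw [h1, zsmul_eq_mul] at h
    simpa using h
  · rw [h1, zsmul_eq_mul] at h
    simpa using h.neg

/-- Coordinates of an exponential series with bounded conjugates and denominators. -/
lemma mapCoeff_mem_eSeries {K : Type*} [Field K] [Algebra ℚ K] [FiniteDimensional ℚ K] {c : ℕ → K}
    {A : ℝ} (hA : ∀ (σ : K →ₐ[ℚ] ℂ) n, ‖σ (c n)‖ ≤ A ^ (n + 1)) {B : ℝ} {d : ℕ → ℕ}
    (hd : ∀ n, d n ≠ 0 ∧ (d n : ℝ) ≤ B ^ (n + 1))
    (hint : ∀ n, ∀ m ≤ n, IsIntegral ℤ ((d n : K) * c m)) (l : K →ₗ[ℚ] ℚ) :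
    mapCoeff l (PowerSeries.mk fun n => c n / n.factorial) ∈ eSeries := by
  obtain ⟨θ, hθ⟩ := exists_eq_trace l
  obtain ⟨t, ht, hti⟩ := exists_nat_isIntegral (Algebra.IsAlgebraic.isAlgebraic (R := ℚ) θ)
  have hc : ∀ n, expCoeff n (mapCoeff l (PowerSeries.mk fun n => c n / n.factorial)) = l (c n) := by
    intro n
    rw [expCoeff, coeff_mapCoeff, coeff_mk, ← smul_eq_mul, ← map_smul, Algebra.smul_def,
      map_natCast, mul_div_cancel₀]
    rw [← map_natCast (algebraMap ℚ K)]
    exact (map_ne_zero _).2 (Nat.cast_ne_zero.2 n.factorial_ne_zero)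
  set S : ℝ := ∑ σ : K →ₐ[ℚ] ℂ, ‖σ θ‖ with hS
  have hS0 : 0 ≤ S := Finset.sum_nonneg fun _ _ => norm_nonneg _
  refine ⟨⌈(S + 1) * (|A| + 1)⌉₊ + ⌈t * |B|⌉₊, fun n => ⟨?_, t * d n, ?_, ?_, fun m hm => ?_⟩⟩
  · rw [hc, ← Rat.cast_le (K := ℝ), Rat.cast_abs]
    have h1 : |((l (c n) : ℚ) : ℝ)| = ‖algebraMap ℚ ℂ (l (c n))‖ := by
      simp
    have h2 : ‖algebraMap ℚ ℂ (l (c n))‖ ≤ S * |A| ^ (n + 1) := by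
      rw [hθ, trace_eq_sum_embeddings, hS, Finset.sum_mul]
      refine (norm_sum_le _ _).trans (Finset.sum_le_sum fun σ _ => ?_)
      rw [map_mul, norm_mul]
      refine mul_le_mul_of_nonneg_left ((hA σ n).trans ?_) (norm_nonneg _)
      rw [← abs_pow]
      exact le_abs_self _
    rw [h1]
    calc _ ≤ S * |A| ^ (n + 1) := h2
      _ ≤ (S + 1) ^ (n + 1) * (|A| + 1) ^ (n + 1) := by
        gcongr
        · exact (by linarith : S ≤ S + 1).trans (le_self_pow₀ (by linarith) (by omega))
        · linarith
      _ = ((S + 1) * (|A| + 1)) ^ (n + 1) := (mul_pow _ _ _).symm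
      _ ≤ _ := by
        push_cast
        gcongr
        exact (Nat.le_ceil _).trans (by linarith [Nat.cast_nonneg (α := ℝ) ⌈t * |B|⌉₊])
  · exact Nat.mul_pos ht (Nat.pos_of_ne_zero (hd n).1)
  · rw [← Nat.cast_le (α := ℝ)]
    push_cast
    calc (t : ℝ) * d n ≤ (t : ℝ) ^ (n + 1) * |B| ^ (n + 1) := by
          gcongr
          · exact le_self_pow₀ (by exact_mod_cast ht) (by omega)
          · rw [← abs_pow]
            exact (hd n).2.trans (le_abs_self _)
      _ = (t * |B|) ^ (n + 1) := (mul_pow _ _ _).symm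
      _ ≤ _ := by
        gcongr
        exact (Nat.le_ceil _).trans
          (by linarith [Nat.cast_nonneg (α := ℝ) ⌈(S + 1) * (|A| + 1)⌉₊])
  · rw [hc, hθ]
    have h1 : ((t * d n : ℕ) : ℚ) * Algebra.trace ℚ K (θ * c m) =
        Algebra.trace ℚ K ((t * θ) * (d n * c m)) := by
      rw [← smul_eq_mul, ← map_smul, Algebra.smul_def, map_natCast]
      congr 1
      push_cast
      ring
    rw [h1]
    obtain ⟨z, hz⟩ := IsIntegrallyClosed.isIntegral_iff.1
      (Algebra.isIntegral_trace (L := ℚ) (hti.mul (hint n m hm)))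
    exact ⟨z, hz.symm⟩

lemma iterate_derivative_map {K L : Type*} [Field K] [Field L] (φ : K →+* L) (F : K⟦X⟧) (j : ℕ) :
    (d⁄dX L)^[j] (PowerSeries.map φ F) = PowerSeries.map φ ((d⁄dX K)^[j] F) := by
  induction j generalizing F with
  | zero => rfl
  | succ j ih =>
    rw [Function.iterate_succ_apply, Function.iterate_succ_apply, ← ih]
    congr 1
    ext n
    simp [coeff_derivative]

lemma exists_polynomial_coeff {K L : Type*} [Field K] [Field L] [Algebra K L] (l : L →ₗ[K] K)
    (p : Polynomial L) : ∃ q : Polynomial K, ∀ i, q.coeff i = l (p.coeff i) := by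
  refine ⟨∑ i ∈ Finset.range (p.natDegree + 1), Polynomial.monomial i (l (p.coeff i)), fun i => ?_⟩
  rw [Polynomial.finsetSum_coeff]
  simp only [Polynomial.coeff_monomial]
  rw [Finset.sum_ite_eq' (Finset.range (p.natDegree + 1)) i]
  split_ifs with h
  · rfl
  · rw [Polynomial.coeff_eq_zero_of_natDegree_lt (by simpa using h), map_zero]

/-- A series over `K` that is a solution of a linear differential equation over a larger field is also
a solution of one over `K`. -/
lemma exists_equation_of_extension {K L : Type*} [Field K] [Field L] [Algebra K L] {F : K⟦X⟧}
    {p : ℕ → Polynomial L} {R : ℕ} (hp : ∃ j ≤ R, p j ≠ 0)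
    (h : ∑ j ∈ Finset.range (R + 1),
      (p j : L⟦X⟧) * (d⁄dX L)^[j] (PowerSeries.map (algebraMap K L) F) = 0) :
    ∃ q : ℕ → Polynomial K, (∃ j ≤ R, q j ≠ 0) ∧
      ∑ j ∈ Finset.range (R + 1), (q j : K⟦X⟧) * (d⁄dX K)^[j] F = 0 := by
  obtain ⟨j, hj, hpj⟩ := hp
  obtain ⟨i, hi⟩ : ∃ i, (p j).coeff i ≠ 0 := by
    by_contra! h0
    exact hpj (Polynomial.ext h0)
  obtain ⟨l, hl⟩ : ∃ l : Module.Dual K L, l ((p j).coeff i) ≠ 0 := by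
    by_contra! h0
    exact hi ((Module.forall_dual_apply_eq_zero_iff K _).1 h0)
  choose q hq using fun j => exists_polynomial_coeff l (p j)
  refine ⟨q, ⟨j, hj, fun h0 => hl ?_⟩, ?_⟩
  · rw [← hq, h0, Polynomial.coeff_zero]
  · ext n
    have h1 := congrArg l (congrArg (coeff n) h)
    rw [map_zero, map_zero, map_sum (coeff n), map_sum] at h1
    rw [map_zero, map_sum (coeff n), ← h1]
    refine Finset.sum_congr rfl fun k _ => ?_
    rw [iterate_derivative_map, coeff_mul, coeff_mul, map_sum]
    refine Finset.sum_congr rfl fun x _ => ?_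
    rw [Polynomial.coeff_coe, Polynomial.coeff_coe, hq, coeff_map, mul_comm ((p k).coeff _),
      ← Algebra.smul_def, map_smul, smul_eq_mul, mul_comm]

/-- The statement at the point `1`. -/
theorem transcendental_or_mem_of_one (K : IntermediateField ℚ ℂ) [FiniteDimensional ℚ K] {c : ℕ → K}
    {g : ℂ → ℂ} (hg : ∀ z, HasSum (fun n => (c n : ℂ) / n.factorial * z ^ n) (g z))
    {A : ℝ} (hA : ∀ (σ : K →ₐ[ℚ] ℂ) n, ‖σ (c n)‖ ≤ A ^ (n + 1)) {B : ℝ} {d : ℕ → ℕ}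
    (hd : ∀ n, d n ≠ 0 ∧ (d n : ℝ) ≤ B ^ (n + 1))
    (hint : ∀ n, ∀ m ≤ n, IsIntegral ℤ ((d n : K) * c m)) {R : ℕ} {p : ℕ → Polynomial ℂ}
    (hp : ∃ j ≤ R, p j ≠ 0)
    (hode : ∀ z, ∑ j ∈ Finset.range (R + 1), (p j).eval z * iteratedDeriv j g z = 0) :
    Transcendental ℚ (g 1) ∨ g 1 ∈ K := by
  by_contra! hcon
  obtain ⟨h1, h2⟩ := hcon
  rw [Transcendental, not_not] at h1
  set F : K⟦X⟧ := PowerSeries.mk fun n => c n / n.factorial with hF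
  have hrep : Represents (PowerSeries.map (algebraMap K ℂ) F) g := fun z =>
    hasSum_of_eq (hg z) fun n => by simp [hF]
  have hode' : ∑ j ∈ Finset.range (R + 1),
      (p j : ℂ⟦X⟧) * (d⁄dX ℂ)^[j] (PowerSeries.map (algebraMap K ℂ) F) = 0 := by
    have h3 := Represents.sum (Finset.range (R + 1)) fun j =>
      (represents_coe (p j)).mul (hrep.iteratedDeriv j)
    refine Represents.eq_zero ?_
    have h4 : (∑ j ∈ Finset.range (R + 1), (fun z => (p j).eval z) * iteratedDeriv j g) =
        (0 : ℂ → ℂ) := by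
      funext z
      simpa using hode z
    rwa [h4] at h3
  obtain ⟨q, hq, hqF⟩ := exists_equation_of_extension hp hode'
  obtain ⟨r, hr, hrF⟩ := exists_leading hq hqF
  let b := Module.finBasis ℚ K
  let u : Option (Fin (Module.finrank ℚ K)) → ℚ⟦X⟧ := fun o =>
    o.elim (C (-1)) fun i => mapCoeff (b.coord i) F
  let κ : Option (Fin (Module.finrank ℚ K)) → ℂ := fun o => o.elim (g 1) fun i => (b i : ℂ)
  have hsE : ∀ i, mapCoeff (b.coord i) F ∈ eSeries := fun i => mapCoeff_mem_eSeries hA hd hint _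
  have hu : ∀ o, u o ∈ eFun := by
    rintro (_ | i)
    · have := eFun.algebraMap_mem (Polynomial.C (-1))
      rw [Algebra.algebraMap_eq_smul_one, smul_def, mul_one, Polynomial.coe_C] at this
      exact this
    · exact ⟨hsE i, hasLattice_mapCoeff hr hrF b i⟩
  have hκ : LinearIndependent ℚ κ := by
    rw [linearIndependent_option]
    constructor
    · exact b.linearIndependent.map' K.val.toLinearMap
        (LinearMap.ker_eq_bot.2 Subtype.val_injective)
    · intro h
      have h5 : Submodule.span ℚ (Set.range (κ ∘ some)) ≤
          Subalgebra.toSubmodule K.toSubalgebra := by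
        rw [Submodule.span_le]
        rintro _ ⟨i, rfl⟩
        exact (b i).2
      exact h2 (h5 h)
  have halg : ∀ o, IsAlgebraic ℚ (κ o) := by
    rintro (_ | i)
    · exact h1
    · exact (Algebra.IsAlgebraic.isAlgebraic (R := ℚ) (b i)).algebraMap
  have hsum : ∑ i, (b i : ℂ) * value 1 (mapCoeff (b.coord i) F) = g 1 := by
    refine HasSum.unique (hasSum_sum fun i _ => (hasSum_value (hsE i) 1).mul_left (b i : ℂ)) ?_
    refine hasSum_of_eq (hg 1) fun n => ?_
    have h6 : (c n : ℂ) / n.factorial = ((coeff n F : K) : ℂ) := by simp [hF]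
    rw [h6]
    conv_rhs => rw [← b.sum_repr (coeff n F)]
    rw [AddSubmonoidClass.coe_finsetSum, Finset.sum_mul]
    refine Finset.sum_congr rfl fun i _ => ?_
    rw [coeff_mapCoeff, Module.Basis.coord_apply]
    rw [← mul_assoc, mul_comm (b i : ℂ)]
    congr 1
  have h7 := value_eq_zero_of_sum hκ halg hu (by
    rw [Fintype.sum_option]
    change g 1 * value 1 (C (-1)) + ∑ i, (b i : ℂ) * value 1 (mapCoeff (b.coord i) F) = 0
    rw [hsum, value_C]
    simp) none
  have h8 : value 1 (C (-1) : ℚ⟦X⟧) = 0 := h7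
  rw [value_C] at h8
  simp at h8

end EFun

namespace EFun

lemma finiteDimensional_adjoin (K : IntermediateField ℚ ℂ) [FiniteDimensional ℚ K] {α : ℂ}
    (hα : IsAlgebraic ℚ α) :
    FiniteDimensional ℚ ((IntermediateField.adjoin K {α}).restrictScalars ℚ) := by
  have h1 : FiniteDimensional K (IntermediateField.adjoin K {α}) :=
    IntermediateField.adjoin.finiteDimensional (hα.isIntegral.tower_top)
  exact Module.Finite.trans (R := ℚ) K (IntermediateField.adjoin K {α})

lemma exists_ringHom_Qbar {K : IntermediateField ℚ ℂ} (hK : K ≤ Qbar) (σ : K →ₐ[ℚ] ℂ) :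
    ∃ τ : Qbar →+* ℂ, ∀ x : K, τ (IntermediateField.inclusion hK x) = σ x := by
  let _ : Algebra K Qbar := (IntermediateField.inclusion hK).toRingHom.toAlgebra
  let _ : Algebra K ℂ := σ.toRingHom.toAlgebra
  have : IsScalarTower ℚ K Qbar :=
    IsScalarTower.of_algebraMap_eq fun q => ((IntermediateField.inclusion hK).commutes q).symm
  have h1 : Algebra.IsAlgebraic ℚ Qbar := algebraicClosure.isAlgebraic ℚ ℂ
  have h2 : Algebra.IsAlgebraic K Qbar := Algebra.IsAlgebraic.tower_top (K := ℚ) K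
  let τ : Qbar →ₐ[K] ℂ := IsAlgClosed.lift
  exact ⟨τ, fun x => τ.commutes x⟩

/-- The rescaled function `f(αz)` at `1`. -/
lemma transcendental_or_mem {K : IntermediateField ℚ ℂ} [FiniteDimensional ℚ K] {a : ℕ → Qbar}
    {f : ℂ → ℂ} (hf : IsEFunctionWith a f) (ha : ∀ n, (a n : ℂ) ∈ K) {α : ℂ} (hα : α ∈ K)
    (hα0 : α ≠ 0) : Transcendental ℚ (f α) ∨ f α ∈ K := by
  obtain ⟨hsum, ⟨A, hA0, hA⟩, ⟨B, hB0, d, hd, hint⟩, r, p, -, hp, hode⟩ := hf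
  have hK : K ≤ Qbar := fun x hx =>
    mem_algebraicClosure_iff.2 (Algebra.IsAlgebraic.isAlgebraic (R := ℚ) (⟨x, hx⟩ : K)).algebraMap
  let c : ℕ → K := fun n => ⟨a n, ha n⟩ * ⟨α, hα⟩ ^ n
  have hc : ∀ n, (c n : ℂ) = a n * α ^ n := fun n => rfl
  obtain ⟨t, ht, hti⟩ := exists_nat_isIntegral
    (Algebra.IsAlgebraic.isAlgebraic (R := ℚ) (⟨α, hα⟩ : K))
  have hti' : IsIntegral ℤ ((t : ℂ) * α) := hti.map (K.val.restrictScalars ℤ)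
  set S : ℝ := ∑ σ : K →ₐ[ℚ] ℂ, ‖σ ⟨α, hα⟩‖ with hS
  have hS0 : 0 ≤ S := Finset.sum_nonneg fun _ _ => norm_nonneg _
  have hfd : Differentiable ℂ f := by
    have : Represents (PowerSeries.mk fun n => (a n : ℂ) / n.factorial) f := fun z =>
      hasSum_of_eq (hsum z) fun n => by simp
    exact this.differentiable
  have key := transcendental_or_mem_of_one K (c := c) (g := fun z => f (α * z)) (R := r)
    (A := A * (S + 1)) (B := B * t) (d := fun n => d n * t ^ n)
    (p := fun j => if h : j < r + 1 then
      Polynomial.C (α ^ j)⁻¹ * (p ⟨j, h⟩).comp (Polynomial.C α * Polynomial.X) else 0)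
    (fun z => hasSum_of_eq (hsum (α * z)) fun n => by rw [hc, mul_pow]; ring) ?_ ?_ ?_ ?_ ?_
  · simpa using key
  · intro σ n
    obtain ⟨τ, hτ⟩ := exists_ringHom_Qbar hK σ
    have h1 : σ (c n) = τ (a n) * σ ⟨α, hα⟩ ^ n := by
      rw [map_mul, map_pow, ← hτ]
      rfl
    have h2 : ‖σ ⟨α, hα⟩‖ ≤ S := Finset.single_le_sum (f := fun σ : K →ₐ[ℚ] ℂ => ‖σ ⟨α, hα⟩‖)
      (fun _ _ => norm_nonneg _) (Finset.mem_univ σ)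
    rw [h1, norm_mul, norm_pow, mul_pow]
    have h3 : ‖σ ⟨α, hα⟩‖ ^ n ≤ (S + 1) ^ (n + 1) :=
      (pow_le_pow_left₀ (norm_nonneg _) (h2.trans (by linarith)) n).trans
        (pow_le_pow_right₀ (by linarith) (Nat.le_succ n))
    exact mul_le_mul (hA τ n) h3 (by positivity) (by positivity)
  · intro n
    refine ⟨mul_ne_zero (hd n).1 (pow_ne_zero _ ht.ne'), ?_⟩
    push_cast
    rw [mul_pow]
    have : (1 : ℝ) ≤ t := by exact_mod_cast ht
    exact mul_le_mul (hd n).2 (pow_le_pow_right₀ this (Nat.le_succ n)) (by positivity) (by positivity)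
  · intro n m hm
    have h1 : IsIntegral ℤ (((((d n * t ^ n : ℕ) : K) * c m : K)) : ℂ) := by
      have h2 : (((((d n * t ^ n : ℕ) : K) * c m : K)) : ℂ) =
          ((d n : ℂ) * a m) * ((t * α) ^ m * ((t ^ (n - m) : ℕ) : ℂ)) := by
        obtain ⟨k, rfl⟩ := Nat.exists_eq_add_of_le hm
        rw [MulMemClass.coe_mul, hc, Nat.add_sub_cancel_left]
        push_cast
        ring
      rw [h2]
      exact (hint n m hm).mul ((hti'.pow m).mul (isIntegral_algebraMap (R := ℤ) (x := _)))
    exact (isIntegral_algHom_iff (K.val.restrictScalars ℤ) Subtype.val_injective).1 h1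
  · obtain ⟨j, hj⟩ := hp
    refine ⟨j, Nat.lt_succ_iff.1 j.2, ?_⟩
    rw [dif_pos j.2]
    refine mul_ne_zero (Polynomial.C_ne_zero.2 (inv_ne_zero (pow_ne_zero _ hα0))) fun h => hj ?_
    have h1 := congrArg (fun q => Polynomial.comp q (Polynomial.C α⁻¹ * Polynomial.X)) h
    simp only [Polynomial.comp_assoc, Polynomial.mul_comp, Polynomial.C_comp, Polynomial.X_comp,
      Polynomial.zero_comp] at h1
    rwa [← mul_assoc, ← Polynomial.C_mul, mul_inv_cancel₀ hα0, Polynomial.C_1, one_mul,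
      Polynomial.comp_X] at h1
  · intro z
    rw [← hode (α * z), Finset.sum_range]
    refine Finset.sum_congr rfl fun j _ => ?_
    rw [dif_pos j.2, iteratedDeriv_comp_const_mul hfd.contDiff]
    have : α ^ (j : ℕ) ≠ 0 := pow_ne_zero _ hα0
    simp only [Polynomial.eval_mul, Polynomial.eval_C, Polynomial.eval_comp, Polynomial.eval_X]
    field_simp

end EFun

/-- If `f` is an E-function whose Taylor coefficients `aₙ` all lie in a number field
`𝕂`, then for every algebraic `α`, either `f(α)` is transcendental or
`f(α) ∈ 𝕂(α)`. -/
theorem value_transcendental_or_in_field (𝕂 : IntermediateField ℚ ℂ)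
    (hfin : FiniteDimensional ℚ 𝕂) (a : ℕ → Qbar) (f : ℂ → ℂ)
    (hf : IsEFunctionWith a f) (ha : ∀ n, (a n : ℂ) ∈ 𝕂)
    (α : ℂ) (hα : IsAlgebraic ℚ α) :
    Transcendental ℚ (f α) ∨ f α ∈ IntermediateField.adjoin 𝕂 {α} := by
  have hK : 𝕂 ≤ (IntermediateField.adjoin 𝕂 {α}).restrictScalars ℚ := fun x hx =>
    (IntermediateField.adjoin 𝕂 {α}).algebraMap_mem ⟨x, hx⟩
  by_cases hα0 : α = 0
  · right
    have h1 : f 0 = a 0 := by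
      refine (hf.1 0).unique ?_
      have h2 := hasSum_single (f := fun n : ℕ => (a n : ℂ) / n.factorial * 0 ^ n) 0
        fun n hn => by simp [hn]
      simpa using h2
    rw [hα0, h1, ← hα0]
    exact hK (ha 0)
  · have := EFun.finiteDimensional_adjoin 𝕂 hα
    exact EFun.transcendental_or_mem (K := (IntermediateField.adjoin 𝕂 {α}).restrictScalars ℚ) hf
      (fun n => hK (ha n)) (IntermediateField.mem_adjoin_simple_self 𝕂 α) hα0
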